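/- (Theorem 4.1.) Let c*(x) = 1 + β*(x) with c* ∈ C^{15}(ℝ³), β* ≥ 0 and β* = 0 outside Ω₁, let k̄ > 0, and let u*(·, k̄) ∈ C^{2+α}(ℝ³) be the unique solution of the Lippmann–Schwinger equation u*(x) = exp(−i k̄ x₃) + k̄² ∫_Ω Φ(x,y) β*(y) u*(y) dy. Let χ ∈ C²(ℝ³) be a cutoff function with χ = 1 on Ω₁, 0 ≤ χ ≤ 1 on Ω ∖ Ω₁, and χ = 0 on ℝ³ ∖ Ω. For ρ ∈ C^α(Ω̄) put ρ̂ = χρ. Then there exist a sufficiently small θ* = θ*(β*, k̄, χ, Ω₁, Ω) ∈ (0,1) and a constant Z* = Z*(β*, k̄, χ, Ω₁, Ω) > 0 such that: for every θ ∈ (0, θ*) and every ρ ∈ C^α(Ω̄) with |ρ − β*|_α ≤ θ, the equation u_ρ(x) = exp(−i k̄ x₃) + k̄² ∫_Ω Φ(x,y) ρ̂(y) u_ρ(y) dy, x ∈ Ω, has a unique solution u_ρ ∈ C^α(Ω̄); moreover (extending u_ρ to ℝ³ by the right-hand side) u_ρ ∈ C^{2+α}(ℝ³) and |u_ρ − u*(·,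 k̄)|_{2+α} ≤ Z*·θ. -/

import Mathlib

noncomputable section

open MeasureTheory Real Set Filter Bornology

/-- ℝ³ as Euclidean space. -/
abbrev E3 : Type := EuclideanSpace ℝ (Fin 3)

/-- the `j`-th standard basis vector of ℝ³. -/
def e3 (j : Fin 3) : E3 := EuclideanSpace.single j (1 : ℝ)

/-- partial derivative `∂_{x_j} f` of a complex-valued function on ℝ³. -/
def pder (j : Fin 3) (f : E3 → ℂ) (x : E3) : ℂ := fderiv ℝ f x (e3 j)

/-- iterated partial derivative along a list of coordinate directions. -/
def pderList (l : List (Fin 3)) (f : E3 → ℂ) : E3 → ℂ := l.foldr pder f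

/-- Laplacian `Δf = ∑_j ∂²_{x_j} f`. -/
def lap (f : E3 → ℂ) (x : E3) : ℂ := ∑ j : Fin 3, pder j (pder j f) x

/-- `∇f·∇g = ∑_j ∂_{x_j}f ∂_{x_j}g` (non-Hermitian dot product of complex gradients). -/
def gradDot (f g : E3 → ℂ) (x : E3) : ℂ := ∑ j : Fin 3, pder j f x * pder j g x

/-- the set of values `‖f x‖`, `x ∈ S`. -/
def supSet (f : E3 → ℂ) (S : Set E3) : Set ℝ := (fun x => ‖f x‖) '' S

/-- the set of Hölder difference quotients of `f` on `S`. -/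
def holderSet (α : ℝ) (f : E3 → ℂ) (S : Set E3) : Set ℝ :=
  {r | ∃ x ∈ S, ∃ y ∈ S, x ≠ y ∧ r = ‖f x - f y‖ / ‖x - y‖ ^ α}

/-- the Hölder norm `|f|_α = sup_S ‖f‖ + [f]_α` over `S`. -/
def hNorm (α : ℝ) (f : E3 → ℂ) (S : Set E3) : ℝ :=
  sSup (supSet f S) + sSup (holderSet α f S)

/-- the Hölder norm `|f|_{m+α}`: sum of `|D^γ f|_α` over all partial derivatives of order `≤ m`. -/
def cNorm (m : ℕ) (α : ℝ) (f : E3 → ℂ) (S : Set E3) : ℝ :=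
  ∑ k ∈ Finset.range (m + 1), ∑ γ : Fin k → Fin 3, hNorm α (pderList (List.ofFn γ) f) S

/-- membership in the Hölder space `C^{m+α}(S̄)`: continuity up to the boundary,
`m` continuous derivatives on `S`, and finite Hölder norms of all derivatives of order `≤ m`. -/
def InHolder (m : ℕ) (α : ℝ) (f : E3 → ℂ) (S : Set E3) : Prop :=
  ContinuousOn f (closure S) ∧ ContDiffOn ℝ m f S ∧
  ∀ k : ℕ, k ≤ m → ∀ γ : Fin k → Fin 3,
    BddAbove (supSet (pderList (List.ofFn γ) f) S) ∧
    BddAbove (holderSet α (pderList (List.ofFn γ) f) S)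

/-- a boundary function of class `C^{m+α}(∂Ω)`: one admitting a `C^{m+α}(Ω̄)` extension. -/
def InHolderBd (m : ℕ) (α : ℝ) (ψ : E3 → ℂ) (Ω : Set E3) : Prop :=
  ∃ Ψ : E3 → ℂ, InHolder m α Ψ Ω ∧ Set.EqOn Ψ ψ (frontier Ω)

/-- boundary Hölder norm `‖ψ‖_{C^{m+α}(∂Ω)}`: infimum of `|Ψ|_{m+α}` over extensions. -/
def bNorm (m : ℕ) (α : ℝ) (ψ : E3 → ℂ) (Ω : Set E3) : ℝ :=
  sInf { r | ∃ Ψ : E3 → ℂ, InHolder m α Ψ Ω ∧ Set.EqOn Ψ ψ (frontier Ω) ∧ r = cNorm m α Ψ Ω }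

/-- the fundamental solution `Φ(x,y) = exp(−ik|x−y|)/(4π|x−y|)`. -/
def Phi (k : ℝ) (x y : E3) : ℂ :=
  Complex.exp (-Complex.I * k * ‖x - y‖) / (4 * Real.pi * ‖x - y‖)

/-- the incident plane wave `exp(−ikx₃)`. -/
def planeWave (k : ℝ) (x : E3) : ℂ := Complex.exp (-Complex.I * k * (x 2))

/-- the Sommerfeld radiation condition `∂u_sc/∂r + ik u_sc = o(r⁻¹)`, `r = |x| → ∞`,
uniformly over directions. -/
def RadCond (k : ℝ) (usc : E3 → ℂ) : Prop :=
  ∀ ε > 0, ∃ R : ℝ, ∀ x : E3, R ≤ ‖x‖ →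
    ‖x‖ * ‖fderiv ℝ usc x ((‖x‖)⁻¹ • x) + Complex.I * k * usc x‖ ≤ ε

/-- `Ω` has boundary of class `C^{m+α}`: it is the sublevel set of a `C^m` defining function with
`α`-Hölder `m`-th derivatives and nonvanishing gradient on the boundary. -/
def HolderBoundary (m : ℕ) (α : ℝ) (Ω : Set E3) : Prop :=
  ∃ φ : E3 → ℝ, ContDiff ℝ m φ ∧
    (∃ C : ℝ, ∀ x y : E3, ‖iteratedFDeriv ℝ m φ x - iteratedFDeriv ℝ m φ y‖ ≤ C * ‖x - y‖ ^ α) ∧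
    Ω = {x | φ x < 0} ∧ frontier Ω = {x | φ x = 0} ∧
    ∀ x ∈ frontier Ω, fderiv ℝ φ x ≠ 0

/-- `∑_{j=0}^{n-1} q_j`. -/
def sumFun (q : ℕ → E3 → ℂ) (n : ℕ) : E3 → ℂ := fun x => ∑ j ∈ Finset.range n, q j x

section

open scoped ContDiff Topology BoundedContinuousFunction

/-! ### Partial derivatives -/

lemma fderiv_apply_eq_sum_pder (f : E3 → ℂ) (x v : E3) :
    fderiv ℝ f x v = ∑ i, (v i) • pder i f x := by
  have hv : v = ∑ i, v i • e3 i := by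
    ext j
    simp [e3, Fin.sum_univ_three]
    fin_cases j <;> simp
  conv_lhs => rw [hv]
  simp [map_sum, pder]

lemma norm_coord_le (v : E3) (i : Fin 3) : ‖v i‖ ≤ ‖v‖ := PiLp.norm_apply_le v i

lemma norm_e3 (i : Fin 3) : ‖e3 i‖ = 1 := by simp [e3]

lemma norm_fderiv_le_sum_pder (f : E3 → ℂ) (x : E3) :
    ‖fderiv ℝ f x‖ ≤ ∑ i, ‖pder i f x‖ := by
  refine ContinuousLinearMap.opNorm_le_bound _ (by positivity) fun v => ?_
  rw [fderiv_apply_eq_sum_pder, Finset.sum_mul]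
  refine (norm_sum_le _ _).trans (Finset.sum_le_sum fun i _ => ?_)
  rw [norm_smul, mul_comm]
  gcongr
  exact norm_coord_le v i

lemma fderiv_eq_sum_smulRight (f : E3 → ℂ) (x : E3) :
    fderiv ℝ f x = ∑ i, (EuclideanSpace.proj i : E3 →L[ℝ] ℝ).smulRight (pder i f x) := by
  ext v
  rw [fderiv_apply_eq_sum_pder]
  simp

lemma contDiff_succ_of_pder {n : ℕ} {f : E3 → ℂ} (hf : Differentiable ℝ f)
    (h : ∀ i, ContDiff ℝ n (pder i f)) : ContDiff ℝ (n + 1) f := by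
  rw [contDiff_succ_iff_fderiv]
  refine ⟨hf, by simp, ?_⟩
  have : fderiv ℝ f = fun x => ∑ i, (EuclideanSpace.proj i : E3 →L[ℝ] ℝ).smulRight (pder i f x) :=
    funext (fderiv_eq_sum_smulRight f)
  rw [this]
  refine ContDiff.sum fun i _ => ?_
  exact ((ContinuousLinearMap.smulRightL ℝ E3 ℂ
    (EuclideanSpace.proj i : E3 →L[ℝ] ℝ)).contDiff).comp (h i)

lemma contDiff_pder {m n : WithTop ℕ∞} (hmn : m + 1 ≤ n) {f : E3 → ℂ} (hf : ContDiff ℝ n f)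
    (i : Fin 3) : ContDiff ℝ m (pder i f) :=
  (hf.fderiv_right hmn).clm_apply contDiff_const

lemma contDiff_infty_pder {f : E3 → ℂ} (hf : ContDiff ℝ ∞ f) (i : Fin 3) :
    ContDiff ℝ ∞ (pder i f) := contDiff_pder (by simp) hf i

lemma contDiff_infty_pderList {f : E3 → ℂ} (hf : ContDiff ℝ ∞ f) (l : List (Fin 3)) :
    ContDiff ℝ ∞ (pderList l f) := by
  induction l with
  | nil => exact hf
  | cons i l ih => exact contDiff_infty_pder ih i

lemma pderList_cons (i : Fin 3) (l : List (Fin 3)) (f : E3 → ℂ) :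
    pderList (i :: l) f = pder i (pderList l f) := rfl

lemma pder_congr {f g : E3 → ℂ} {U : Set E3} (hU : IsOpen U) (h : EqOn f g U) (i : Fin 3) :
    EqOn (pder i f) (pder i g) U := fun x hx => by
  unfold pder
  rw [(h.eventuallyEq_of_mem (hU.mem_nhds hx)).fderiv_eq]

lemma pderList_congr {f g : E3 → ℂ} {U : Set E3} (hU : IsOpen U) (h : EqOn f g U)
    (l : List (Fin 3)) : EqOn (pderList l f) (pderList l g) U := by
  induction l with
  | nil => exact h
  | cons i l ih => exact pder_congr hU ih i

lemma pder_zero (i : Fin 3) : pder i (fun _ => 0) = fun _ => 0 := by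
  funext x
  simp [pder]

lemma pderList_zero (l : List (Fin 3)) : pderList l (fun _ => 0) = fun _ => 0 := by
  induction l with
  | nil => rfl
  | cons i l ih => rw [pderList_cons, ih, pder_zero]

lemma pder_add {f g : E3 → ℂ} {x : E3} (hf : DifferentiableAt ℝ f x)
    (hg : DifferentiableAt ℝ g x) (i : Fin 3) :
    pder i (fun y => f y + g y) x = pder i f x + pder i g x := by
  unfold pder
  rw [show (fun y => f y + g y) = f + g from rfl, fderiv_add hf hg]
  rfl

lemma pder_mul {f g : E3 → ℂ} {x : E3} (hf : DifferentiableAt ℝ f x)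
    (hg : DifferentiableAt ℝ g x) (i : Fin 3) :
    pder i (fun y => f y * g y) x = pder i f x * g x + f x * pder i g x := by
  unfold pder
  rw [show (fun y => f y * g y) = f * g from rfl, fderiv_mul hf hg]
  simp
  ring

lemma pder_const_mul {f : E3 → ℂ} {x : E3} (hf : DifferentiableAt ℝ f x) (c : ℂ) (i : Fin 3) :
    pder i (fun y => c * f y) x = c * pder i f x := by
  have := pder_mul (f := fun _ => c) (g := f) (x := x) (by fun_prop) hf i
  rw [this]
  simp [pder]

lemma dist_le_of_pder_bound {f : E3 → ℂ} (hf : Differentiable ℝ f) {B : ℝ}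
    (hB : ∀ i x, ‖pder i f x‖ ≤ B) (x y : E3) : ‖f x - f y‖ ≤ 3 * B * ‖x - y‖ := by
  refine Convex.norm_image_sub_le_of_norm_fderiv_le (𝕜 := ℝ) (s := univ)
    (fun z _ => hf z) (fun z _ => ?_) convex_univ (mem_univ y) (mem_univ x)
  refine (norm_fderiv_le_sum_pder f z).trans ?_
  refine (Finset.sum_le_sum fun i _ => hB i z).trans ?_
  simp

/-! ### Bounded compactly supported sources and convolutions -/

/-- `F` is measurable, bounded by `A` and vanishes outside the ball of radius `M`. -/
structure IsSource (M A : ℝ) (F : E3 → ℂ) : Prop where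
  meas : AEStronglyMeasurable F volume
  bound : ∀ x, ‖F x‖ ≤ A
  supp : ∀ x, M < ‖x‖ → F x = 0

/-- convolution of a kernel with a source. -/
def conv (ψ F : E3 → ℂ) (x : E3) : ℂ := ∫ y, ψ (x - y) * F y

/-- the volume of the unit ball. -/
def ballVol : ℝ := volume.real (Metric.closedBall (0 : E3) 1)

lemma ballVol_nonneg : 0 ≤ ballVol := measureReal_nonneg

lemma volume_real_closedBall (x : E3) {r : ℝ} (hr : 0 ≤ r) :
    volume.real (Metric.closedBall x r) = r ^ 3 * ballVol := by
  have := Measure.addHaar_real_closedBall' (volume : Measure E3) x hr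
  rw [this, finrank_euclideanSpace_fin, Measure.addHaar_real_closedBall_eq_addHaar_real_ball, ballVol,
    Measure.addHaar_real_closedBall_eq_addHaar_real_ball]

lemma norm_integral_le_of_support_closedBall {g : E3 → ℂ} {c : E3} {r B : ℝ} (hr : 0 ≤ r)
    (hB : ∀ y, ‖g y‖ ≤ B) (hs : ∀ y, y ∉ Metric.closedBall c r → g y = 0) :
    ‖∫ y, g y‖ ≤ B * (r ^ 3 * ballVol) := by
  rw [← setIntegral_eq_integral_of_forall_compl_eq_zero hs, ← volume_real_closedBall c hr]
  exact norm_setIntegral_le_of_norm_le_const measure_closedBall_lt_top (fun y _ => hB y)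

lemma IsSource.nonneg {M A : ℝ} {F : E3 → ℂ} (hF : IsSource M A F) : 0 ≤ A :=
  (norm_nonneg _).trans (hF.bound 0)

lemma integrable_of_bounded_support {g : E3 → ℂ} {r B : ℝ}
    (hm : AEStronglyMeasurable g volume) (hB : ∀ y, ‖g y‖ ≤ B)
    (hs : ∀ y, r < ‖y‖ → g y = 0) : Integrable g := by
  have h1 : IntegrableOn g (Metric.closedBall 0 r) :=
    Measure.integrableOn_of_bounded (M := B) measure_closedBall_lt_top.ne hm
      (Eventually.of_forall hB)
  refine h1.integrable_of_forall_notMem_eq_zero fun y hy => hs y ?_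
  simpa using hy

lemma IsSource.integrable {M A : ℝ} {F : E3 → ℂ} (hF : IsSource M A F) : Integrable F :=
  integrable_of_bounded_support hF.meas hF.bound hF.supp

lemma integrable_kernel_mul {ψ F : E3 → ℂ} {B : ℝ} (hψ : Continuous ψ) (hB : ∀ z, ‖ψ z‖ ≤ B)
    (hF : Integrable F) (x : E3) : Integrable fun y => ψ (x - y) * F y := by
  refine hF.bdd_mul (c := B) ?_ (Eventually.of_forall fun y => hB _)
  exact (hψ.comp (by fun_prop)).aestronglyMeasurable

lemma norm_conv_le {M A B : ℝ} {ψ F : E3 → ℂ} (hM : 0 ≤ M) (hF : IsSource M A F)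
    (hB : ∀ z, ‖ψ z‖ ≤ B) (x : E3) : ‖conv ψ F x‖ ≤ B * A * (M ^ 3 * ballVol) := by
  have hB0 : 0 ≤ B := (norm_nonneg _).trans (hB 0)
  refine norm_integral_le_of_support_closedBall (c := 0) hM (fun y => ?_) (fun y hy => ?_)
  · rw [norm_mul]
    exact mul_le_mul (hB _) (hF.bound y) (norm_nonneg _) hB0
  · rw [hF.supp y (by simpa using hy), mul_zero]

lemma norm_conv_le_of_support {M A B r : ℝ} {ψ F : E3 → ℂ} (hr : 0 ≤ r) (hF : IsSource M A F)
    (hB : ∀ z, ‖ψ z‖ ≤ B) (hs : ∀ z, r < ‖z‖ → ψ z = 0) (x : E3) :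
    ‖conv ψ F x‖ ≤ B * A * (r ^ 3 * ballVol) := by
  have hB0 : 0 ≤ B := (norm_nonneg _).trans (hB 0)
  refine norm_integral_le_of_support_closedBall (c := x) hr (fun y => ?_) (fun y hy => ?_)
  · rw [norm_mul]
    exact mul_le_mul (hB _) (hF.bound y) (norm_nonneg _) hB0
  · rw [hs (x - y), zero_mul]
    rw [Metric.mem_closedBall, not_le, dist_comm, dist_eq_norm] at hy
    exact hy

lemma norm_conv_sub_le_of_support {M A B r H α : ℝ} {ψ F : E3 → ℂ} (hr : 0 ≤ r) (hα : 0 < α)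
    (hF : IsSource M A F) (hψ : Continuous ψ)
    (hH : ∀ x y, ‖F x - F y‖ ≤ H * ‖x - y‖ ^ α) (hH0 : 0 ≤ H)
    (hB : ∀ z, ‖ψ z‖ ≤ B) (hs : ∀ z, r < ‖z‖ → ψ z = 0) (x : E3) :
    ‖conv ψ F x - (∫ z, ψ z) * F x‖ ≤ B * (H * r ^ α) * (r ^ 3 * ballVol) := by
  have hB0 : 0 ≤ B := (norm_nonneg _).trans (hB 0)
  have hψi : Integrable ψ := integrable_of_bounded_support hψ.aestronglyMeasurable hB hs
  have h1 : (∫ z, ψ z) * F x = ∫ y, ψ (x - y) * F x := by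
    rw [integral_mul_const, integral_sub_left_eq_self ψ volume x]
  rw [h1, conv, ← integral_sub (integrable_kernel_mul hψ hB hF.integrable x)
    ((hψi.comp_sub_left x).mul_const _)]
  refine norm_integral_le_of_support_closedBall (c := x) hr (fun y => ?_) (fun y hy => ?_)
  · rw [← mul_sub, norm_mul]
    by_cases h : r < ‖x - y‖
    · rw [hs _ h, norm_zero, zero_mul]
      positivity
    · refine mul_le_mul (hB _) ((hH y x).trans ?_) (norm_nonneg _) hB0
      rw [norm_sub_rev]
      gcongr
      exact not_lt.1 h
  · rw [hs (x - y)]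
    · simp
    rw [Metric.mem_closedBall, not_le, dist_comm, dist_eq_norm] at hy
    exact hy

/-- smooth functions all of whose derivatives are bounded. -/
structure SmoothBdd (ψ : E3 → ℂ) : Prop where
  smooth : ContDiff ℝ ∞ ψ
  bdd : ∀ l, ∃ B, ∀ x, ‖pderList l ψ x‖ ≤ B

lemma SmoothBdd.pder {ψ : E3 → ℂ} (h : SmoothBdd ψ) (i : Fin 3) : SmoothBdd (pder i ψ) := by
  refine ⟨contDiff_infty_pder h.smooth i, fun l => ?_⟩
  obtain ⟨B, hB⟩ := h.bdd (l ++ [i])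
  refine ⟨B, fun x => ?_⟩
  have := hB x
  rwa [pderList, List.foldr_append] at this

lemma SmoothBdd.pderList {ψ : E3 → ℂ} (h : SmoothBdd ψ) (l : List (Fin 3)) :
    SmoothBdd (pderList l ψ) := by
  induction l with
  | nil => exact h
  | cons i l ih => exact ih.pder i

lemma SmoothBdd.exists_bound {ψ : E3 → ℂ} (h : SmoothBdd ψ) : ∃ B, ∀ x, ‖ψ x‖ ≤ B := h.bdd []

lemma SmoothBdd.hasFDerivAt_conv {ψ F : E3 → ℂ} (h : SmoothBdd ψ) (hF : Integrable F) (x : E3) :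
    HasFDerivAt (conv ψ F) (∫ y, (F y) • fderiv ℝ ψ (x - y)) x := by
  obtain ⟨B, hB⟩ := h.exists_bound
  choose C hC using fun i => (h.pder i).exists_bound
  have hd : ∀ z, ‖fderiv ℝ ψ z‖ ≤ ∑ i, C i := fun z =>
    (norm_fderiv_le_sum_pder ψ z).trans (Finset.sum_le_sum fun i _ => hC i z)
  have hc : Continuous (fderiv ℝ ψ) := h.smooth.continuous_fderiv (by simp)
  refine hasFDerivAt_integral_of_dominated_of_fderiv_le (s := univ)
    (bound := fun y => ‖F y‖ * ∑ i, C i) (F := fun x y => ψ (x - y) * F y)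
    (F' := fun x y => (F y) • fderiv ℝ ψ (x - y)) univ_mem ?_ ?_ ?_ ?_ ?_ ?_
  · exact Eventually.of_forall fun x =>
      (integrable_kernel_mul h.smooth.continuous hB hF x).aestronglyMeasurable
  · exact integrable_kernel_mul h.smooth.continuous hB hF x
  · exact hF.aestronglyMeasurable.smul (hc.comp (by fun_prop)).aestronglyMeasurable
  · refine Eventually.of_forall fun y z _ => ?_
    rw [norm_smul]
    gcongr
    exact hd _
  · exact hF.norm.mul_const _
  · refine Eventually.of_forall fun y z _ => ?_
    have h1 : HasFDerivAt ψ (fderiv ℝ ψ (z - y)) (z - y) :=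
      (h.smooth.differentiable (by simp) _).hasFDerivAt
    have h2 := (h1.comp z ((hasFDerivAt_id z).sub_const y)).mul_const (F y)
    simpa using h2

lemma SmoothBdd.differentiable_conv {ψ F : E3 → ℂ} (h : SmoothBdd ψ) (hF : Integrable F) :
    Differentiable ℝ (conv ψ F) := fun x => (h.hasFDerivAt_conv hF x).differentiableAt

lemma SmoothBdd.pder_conv {ψ F : E3 → ℂ} (h : SmoothBdd ψ) (hF : Integrable F) (i : Fin 3) :
    _root_.pder i (conv ψ F) = conv (_root_.pder i ψ) F := by
  funext x
  choose C hC using fun i => (h.pder i).exists_bound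
  have hd : ∀ z, ‖fderiv ℝ ψ z‖ ≤ ∑ i, C i := fun z =>
    (norm_fderiv_le_sum_pder ψ z).trans (Finset.sum_le_sum fun i _ => hC i z)
  have hc : Continuous (fderiv ℝ ψ) := h.smooth.continuous_fderiv (by simp)
  have hi : Integrable fun y => (F y) • fderiv ℝ ψ (x - y) := by
    refine hF.smul_bdd (∑ i, C i) ?_ (Eventually.of_forall fun y => hd _)
    exact (hc.comp (by fun_prop)).aestronglyMeasurable
  unfold _root_.pder
  rw [(h.hasFDerivAt_conv hF x).fderiv, ContinuousLinearMap.integral_apply hi]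
  simp [conv, mul_comm]

lemma smoothBdd_of_compact_support {ψ : E3 → ℂ} (h : ContDiff ℝ ∞ ψ) {r : ℝ}
    (hs : ∀ x, r < ‖x‖ → ψ x = 0) : SmoothBdd ψ := by
  refine ⟨h, fun l => ?_⟩
  obtain ⟨B, hB⟩ := (isCompact_closedBall (0 : E3) r).exists_bound_of_continuousOn
    (contDiff_infty_pderList h l).continuous.continuousOn
  refine ⟨max B 0, fun x => ?_⟩
  by_cases hx : ‖x‖ ≤ r
  · exact (hB x (by simpa using hx)).trans (le_max_left _ _)
  · have hU : IsOpen {x : E3 | r < ‖x‖} := isOpen_lt continuous_const continuous_norm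
    have := pderList_congr hU (f := ψ) (g := fun _ => 0) (fun y hy => hs y hy) l (not_le.1 hx)
    rw [this, pderList_zero]
    simp

lemma pderList_eq_zero_of_support {ψ : E3 → ℂ} {r : ℝ} (hs : ∀ x, r < ‖x‖ → ψ x = 0)
    (l : List (Fin 3)) (x : E3) (hx : r < ‖x‖) : pderList l ψ x = 0 := by
  have hU : IsOpen {x : E3 | r < ‖x‖} := isOpen_lt continuous_const continuous_norm
  have := pderList_congr hU (f := ψ) (g := fun _ => 0) (fun y hy => hs y hy) l hx
  rw [this, pderList_zero]

lemma integral_pder_eq_zero {ψ : E3 → ℂ} (h : ContDiff ℝ 1 ψ) {r : ℝ}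
    (hs : ∀ x, r < ‖x‖ → ψ x = 0) (i : Fin 3) : ∫ x, pder i ψ x = 0 := by
  have hcs : HasCompactSupport ψ := by
    refine HasCompactSupport.intro (isCompact_closedBall (0 : E3) r) fun x hx => hs x ?_
    simpa using hx
  have hc : Continuous (fun x => fderiv ℝ ψ x (e3 i)) :=
    (h.continuous_fderiv (by simp)).clm_apply continuous_const
  have hi : Integrable (fun x => fderiv ℝ ψ x (e3 i)) :=
    hc.integrable_of_hasCompactSupport (hcs.fderiv_apply (𝕜 := ℝ) (e3 i))
  have hi2 : Integrable ψ := h.continuous.integrable_of_hasCompactSupport hcs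
  have := integral_mul_fderiv_eq_neg_fderiv_mul_of_integrable (μ := (volume : Measure E3))
    (𝕜 := ℂ) (f := fun _ => (1:ℂ)) (g := ψ) (v := e3 i) (by simp) (by simpa using hi)
    (by simpa using hi2) (fun x _ => by fun_prop) (fun x _ => h.differentiable (by simp) x)
  simpa [pder] using this

/-! ### The Helmholtz kernel and its dyadic pieces -/

/-- the Helmholtz kernel as a function of the displacement. -/
def helm (k : ℝ) (z : E3) : ℂ :=
  Complex.exp (-Complex.I * k * ‖z‖) / (4 * Real.pi * ‖z‖)

/-- a smooth radial cutoff, equal to `1` on the unit ball and to `0` outside the ball of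
radius `2`. -/
def cut (x : E3) : ℝ := Real.smoothTransition (2 - ‖x‖ ^ 2)

lemma contDiff_cut : ContDiff ℝ ∞ cut :=
  Real.smoothTransition.contDiff.comp (contDiff_const.sub (contDiff_norm_sq ℝ))

lemma cut_eq_one {x : E3} (h : ‖x‖ ≤ 1) : cut x = 1 :=
  Real.smoothTransition.one_of_one_le (by nlinarith [norm_nonneg x])

lemma cut_eq_zero {x : E3} (h : 2 ≤ ‖x‖) : cut x = 0 :=
  Real.smoothTransition.zero_of_nonpos (by nlinarith)

lemma hasFDerivAt_norm_E3 {x : E3} (hx : x ≠ 0) :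
    HasFDerivAt (fun y : E3 => ‖y‖) (‖x‖⁻¹ • innerSL ℝ x) x := by
  have h1 : HasFDerivAt (fun y : E3 => ‖y‖ ^ 2) (2 • innerSL ℝ x) x :=
    (hasStrictFDerivAt_norm_sq x).hasFDerivAt
  have hx' : ‖x‖ ≠ 0 := norm_ne_zero_iff.2 hx
  have h2 := h1.sqrt (by positivity)
  have h3 : (fun y : E3 => √(‖y‖ ^ 2)) = fun y => ‖y‖ := by
    funext y
    exact Real.sqrt_sq (norm_nonneg y)
  rw [h3, Real.sqrt_sq (norm_nonneg x)] at h2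
  refine h2.congr_fderiv ?_
  rw [two_smul, ← two_smul ℝ, smul_smul]
  congr 1
  field_simp

lemma hasFDerivAt_comp_norm {g : ℝ → ℂ} {g' : ℂ} {x : E3} (hx : x ≠ 0)
    (hg : HasDerivAt g g' ‖x‖) :
    HasFDerivAt (fun y : E3 => g ‖y‖) ((‖x‖⁻¹ • innerSL ℝ x).smulRight g') x := by
  have h := hg.hasFDerivAt.comp x (hasFDerivAt_norm_E3 hx)
  refine HasFDerivAt.congr_fderiv h ?_
  ext v
  simp [mul_assoc]

lemma pder_comp_norm {g : ℝ → ℂ} {g' : ℂ} {x : E3} (hx : x ≠ 0)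
    (hg : HasDerivAt g g' ‖x‖) (i : Fin 3) :
    pder i (fun y : E3 => g ‖y‖) x = g' * ((x i : ℂ) * (‖x‖ : ℂ)⁻¹) := by
  unfold pder
  rw [(hasFDerivAt_comp_norm hx hg).fderiv]
  simp [e3, EuclideanSpace.inner_single_right]
  ring

/-- the region away from the origin. -/
def awayZero : Set E3 := {x | 1 / 2 < ‖x‖}

lemma isOpen_awayZero : IsOpen awayZero := isOpen_lt continuous_const continuous_norm

lemma ne_zero_of_mem_awayZero {x : E3} (hx : x ∈ awayZero) : x ≠ 0 := by
  rintro rfl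
  simp [awayZero] at hx
  norm_num at hx

/-- functions generated by `1/r`, `x_i/r` and `exp(-ikr)`. -/
inductive RadialSymbol (k : ℝ) : (E3 → ℂ) → Prop
  | const (c : ℂ) : RadialSymbol k fun _ => c
  | inv : RadialSymbol k fun x => (‖x‖ : ℂ)⁻¹
  | dir (i : Fin 3) : RadialSymbol k fun x => (x i : ℂ) * (‖x‖ : ℂ)⁻¹
  | exp : RadialSymbol k fun x => Complex.exp (-Complex.I * k * ‖x‖)
  | add {f g : E3 → ℂ} : RadialSymbol k f → RadialSymbol k g → RadialSymbol k fun x => f x + g x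
  | mul {f g : E3 → ℂ} : RadialSymbol k f → RadialSymbol k g → RadialSymbol k fun x => f x * g x

lemma hasDerivAt_inv_ofReal {r : ℝ} (hr : r ≠ 0) :
    HasDerivAt (fun t : ℝ => (t : ℂ)⁻¹) (-((r : ℂ)⁻¹ * (r : ℂ)⁻¹)) r := by
  have h := (hasDerivAt_inv (𝕜 := ℂ) (x := (r : ℂ)) (by exact_mod_cast hr)).comp_ofReal
  convert h using 1
  field_simp

lemma hasDerivAt_exp_ofReal (k r : ℝ) :
    HasDerivAt (fun t : ℝ => Complex.exp (-Complex.I * k * t))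
      (-Complex.I * k * Complex.exp (-Complex.I * k * r)) r := by
  have h : HasDerivAt (fun t : ℂ => Complex.exp (-Complex.I * k * t))
      (-Complex.I * k * Complex.exp (-Complex.I * k * r)) (r : ℂ) := by
    have := ((hasDerivAt_id (r : ℂ)).const_mul (-Complex.I * k)).cexp
    simpa [mul_comm] using this
  exact h.comp_ofReal

lemma norm_exp_neg_I_mul (k r : ℝ) : ‖Complex.exp (-Complex.I * k * r)‖ = 1 := by
  rw [Complex.norm_exp]
  simp

lemma hasFDerivAt_coord (i : Fin 3) (x : E3) :
    HasFDerivAt (fun y : E3 => ((y i : ℝ) : ℂ))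
      (Complex.ofRealCLM.comp (EuclideanSpace.proj i : E3 →L[ℝ] ℝ)) x :=
  (Complex.ofRealCLM.comp (EuclideanSpace.proj i : E3 →L[ℝ] ℝ)).hasFDerivAt

lemma pder_coord (i j : Fin 3) (x : E3) :
    pder j (fun y : E3 => ((y i : ℝ) : ℂ)) x = if i = j then 1 else 0 := by
  unfold pder
  rw [(hasFDerivAt_coord i x).fderiv]
  by_cases h : i = j
  · simp [e3, h]
  · simp [e3, h]

namespace RadialSymbol

variable {k : ℝ} {g : E3 → ℂ}

lemma differentiableAt (h : RadialSymbol k g) {x : E3} (hx : x ∈ awayZero) :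
    DifferentiableAt ℝ g x := by
  have hx0 := ne_zero_of_mem_awayZero hx
  have hinv : DifferentiableAt ℝ (fun x : E3 => (‖x‖ : ℂ)⁻¹) x :=
    (hasFDerivAt_comp_norm hx0 (hasDerivAt_inv_ofReal (norm_ne_zero_iff.2 hx0))).differentiableAt
  induction h with
  | const c => fun_prop
  | inv => exact hinv
  | dir i => exact (hasFDerivAt_coord i x).differentiableAt.mul hinv
  | exp => exact (hasFDerivAt_comp_norm hx0 (hasDerivAt_exp_ofReal k _)).differentiableAt
  | add _ _ h1 h2 => exact h1.add h2
  | mul _ _ h1 h2 => exact h1.mul h2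

lemma exists_bound (h : RadialSymbol k g) : ∃ B, ∀ x ∈ awayZero, ‖g x‖ ≤ B := by
  induction h with
  | const c => exact ⟨‖c‖, fun _ _ => le_rfl⟩
  | inv =>
    refine ⟨2, fun x hx => ?_⟩
    have hx' : 1 / 2 < ‖x‖ := hx
    rw [norm_inv, Complex.norm_real, norm_norm, show (2 : ℝ) = (1 / 2)⁻¹ by norm_num]
    gcongr
  | dir i =>
    refine ⟨1, fun x hx => ?_⟩
    rw [norm_mul, norm_inv, Complex.norm_real, Complex.norm_real, norm_norm, ← div_eq_mul_inv]
    exact div_le_one_of_le₀ (norm_coord_le x i) (norm_nonneg x)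
  | exp => exact ⟨1, fun x _ => (norm_exp_neg_I_mul k ‖x‖).le⟩
  | add _ _ h1 h2 =>
    obtain ⟨B, hB⟩ := h1
    obtain ⟨C, hC⟩ := h2
    exact ⟨B + C, fun x hx => (norm_add_le _ _).trans (add_le_add (hB x hx) (hC x hx))⟩
  | mul _ _ h1 h2 =>
    obtain ⟨B, hB⟩ := h1
    obtain ⟨C, hC⟩ := h2
    refine ⟨B * C, fun x hx => ?_⟩
    rw [norm_mul]
    exact mul_le_mul (hB x hx) (hC x hx) (norm_nonneg _) ((norm_nonneg _).trans (hB x hx))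

lemma pder_eqOn (h : RadialSymbol k g) (j : Fin 3) :
    ∃ g', RadialSymbol k g' ∧ EqOn (pder j g) g' awayZero := by
  have hinv : EqOn (pder j fun x => (‖x‖ : ℂ)⁻¹)
      (fun x => -1 * ((‖x‖ : ℂ)⁻¹ * (‖x‖ : ℂ)⁻¹) * ((x j : ℂ) * (‖x‖ : ℂ)⁻¹)) awayZero := by
    intro x hx
    have hx0 := ne_zero_of_mem_awayZero hx
    rw [pder_comp_norm hx0 (hasDerivAt_inv_ofReal (norm_ne_zero_iff.2 hx0))]
    ring
  induction h with
  | const c => exact ⟨fun _ => 0, .const 0, fun x _ => by simp [pder]⟩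
  | inv => exact ⟨_, .mul (.mul (.const (-1)) (.mul .inv .inv)) (.dir j), hinv⟩
  | dir i =>
    refine ⟨_, .add (.mul (.const (if i = j then 1 else 0)) .inv)
      (.mul (.const (-1)) (.mul (.dir i) (.mul (.dir j) .inv))), fun x hx => ?_⟩
    rw [pder_mul (hasFDerivAt_coord i x).differentiableAt (inv.differentiableAt (k := k) hx),
      pder_coord, hinv hx]
    ring
  | exp =>
    refine ⟨_, .mul (.const (-Complex.I * k)) (.mul .exp (.dir j)), fun x hx => ?_⟩
    rw [pder_comp_norm (ne_zero_of_mem_awayZero hx) (hasDerivAt_exp_ofReal k _)]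
    ring
  | @add f g hf hg h1 h2 =>
    obtain ⟨f', hf', h1⟩ := h1
    obtain ⟨g', hg', h2⟩ := h2
    refine ⟨_, .add hf' hg', fun x hx => ?_⟩
    rw [pder_add (hf.differentiableAt hx) (hg.differentiableAt hx), h1 hx, h2 hx]
  | @mul f g hf hg h1 h2 =>
    obtain ⟨f', hf', h1⟩ := h1
    obtain ⟨g', hg', h2⟩ := h2
    refine ⟨_, .add (.mul hf' hg) (.mul hf hg'), fun x hx => ?_⟩
    rw [pder_mul (hf.differentiableAt hx) (hg.differentiableAt hx), h1 hx, h2 hx]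

lemma pderList_eqOn (h : RadialSymbol k g) (l : List (Fin 3)) :
    ∃ g', RadialSymbol k g' ∧ EqOn (pderList l g) g' awayZero := by
  induction l with
  | nil => exact ⟨g, h, fun _ _ => rfl⟩
  | cons i l ih =>
    obtain ⟨g', hg', h1⟩ := ih
    obtain ⟨g'', hg'', h2⟩ := hg'.pder_eqOn i
    exact ⟨g'', hg'', (pder_congr isOpen_awayZero h1 i).trans h2⟩

end RadialSymbol

lemma helm_radialSymbol (k : ℝ) : RadialSymbol k (helm k) := by
  have h : RadialSymbol k fun x => ((4 * Real.pi : ℂ)⁻¹) *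
      (Complex.exp (-Complex.I * k * ‖x‖) * (‖x‖ : ℂ)⁻¹) := .mul (.const _) (.mul .exp .inv)
  convert h using 1
  funext x
  rw [helm, div_eq_mul_inv, mul_inv]
  ring

lemma contDiffAt_norm_complex {x : E3} (hx : x ≠ 0) : ContDiffAt ℝ ∞ (fun y : E3 => (‖y‖ : ℂ)) x :=
  Complex.ofRealCLM.contDiff.contDiffAt.comp x (contDiffAt_norm ℝ hx)

lemma contDiffAt_helm (k : ℝ) {x : E3} (hx : x ≠ 0) : ContDiffAt ℝ ∞ (helm k) x := by
  have h := contDiffAt_norm_complex hx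
  unfold helm
  simp only [div_eq_mul_inv]
  refine ((contDiffAt_const.mul h).cexp).mul ((contDiffAt_const.mul h).inv ?_)
  have : ‖x‖ ≠ 0 := norm_ne_zero_iff.2 hx
  have := Real.pi_ne_zero
  norm_cast
  positivity

lemma norm_helm_le (k : ℝ) (z : E3) : ‖helm k z‖ ≤ ‖z‖⁻¹ := by
  rw [helm, norm_div, norm_exp_neg_I_mul, norm_mul, Complex.norm_real, norm_norm, one_div, mul_inv]
  have h : ‖(4 * Real.pi : ℂ)‖⁻¹ ≤ 1 := by
    apply inv_le_one_of_one_le₀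
    rw [norm_mul, Complex.norm_real, Real.norm_of_nonneg Real.pi_pos.le]
    norm_num
    nlinarith [Real.pi_gt_three]
  exact mul_le_of_le_one_left (by positivity) h

/-- the kernel cut off at scale `2⁻ⁿ`. -/
def truncKernel (k : ℝ) (n : ℕ) (x : E3) : ℂ := (1 - cut ((2 : ℝ) ^ n • x) : ℝ) * helm k x

/-- the dyadic pieces of the kernel. -/
def piece (k : ℝ) : ℕ → E3 → ℂ
  | 0 => truncKernel k 0
  | n + 1 => fun x => truncKernel k (n + 1) x - truncKernel k n x

lemma sum_piece (k : ℝ) (n : ℕ) (x : E3) :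
    ∑ j ∈ Finset.range (n + 1), piece k j x = truncKernel k n x := by
  induction n with
  | zero => simp [piece]
  | succ n ih => rw [Finset.sum_range_succ, ih, piece]; ring

lemma contDiff_truncKernel (k : ℝ) (n : ℕ) : ContDiff ℝ ∞ (truncKernel k n) := by
  rw [contDiff_iff_contDiffAt]
  intro x
  by_cases hx : x = 0
  · subst hx
    have hU : {y : E3 | ‖(2 : ℝ) ^ n • y‖ < 1} ∈ 𝓝 (0 : E3) :=
      (isOpen_lt (by fun_prop) continuous_const).mem_nhds (by simp)
    have : truncKernel k n =ᶠ[𝓝 0] fun _ => 0 := by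
      filter_upwards [hU] with y hy
      simp [truncKernel, cut_eq_one (le_of_lt hy)]
    exact contDiffAt_const.congr_of_eventuallyEq this
  · refine ContDiffAt.mul ?_ (contDiffAt_helm k hx)
    refine Complex.ofRealCLM.contDiff.contDiffAt.comp x ?_
    exact contDiffAt_const.sub (contDiff_cut.comp (contDiff_const_smul _)).contDiffAt

lemma smoothBdd_truncKernel_zero (k : ℝ) : SmoothBdd (truncKernel k 0) := by
  refine ⟨contDiff_truncKernel k 0, fun l => ?_⟩
  obtain ⟨B, hB⟩ := (isCompact_closedBall (0 : E3) 2).exists_bound_of_continuousOn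
    (contDiff_infty_pderList (contDiff_truncKernel k 0) l).continuous.continuousOn
  obtain ⟨g, hg, hgl⟩ := (helm_radialSymbol k).pderList_eqOn l
  obtain ⟨C, hC⟩ := hg.exists_bound
  refine ⟨max B C, fun x => ?_⟩
  by_cases hx : ‖x‖ ≤ 2
  · exact (hB x (by simpa using hx)).trans (le_max_left _ _)
  · have hU : IsOpen {x : E3 | 2 < ‖x‖} := isOpen_lt continuous_const continuous_norm
    have h1 := pderList_congr hU (f := truncKernel k 0) (g := helm k) (fun y hy => by
      simp [truncKernel, cut_eq_zero (le_of_lt hy)]) l (not_le.1 hx)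
    have hxa : x ∈ awayZero := by
      have := not_le.1 hx
      show 1 / 2 < ‖x‖
      linarith
    rw [h1, hgl hxa]
    exact (hC x hxa).trans (le_max_right _ _)

/-- the rescaled annular kernel. -/
def annKernel (κ : ℝ) (z : E3) : ℂ := (cut z - cut ((2 : ℝ) • z) : ℝ) * helm κ z

lemma piece_succ_eq (k : ℝ) (n : ℕ) (x : E3) :
    piece k (n + 1) x = (2 : ℂ) ^ n * annKernel (k * (1 / 2) ^ n) ((2 : ℝ) ^ n • x) := by
  have h1 : helm (k * (1 / 2) ^ n) ((2 : ℝ) ^ n • x) = ((2 : ℂ) ^ n)⁻¹ * helm k x := by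
    simp only [helm, norm_smul, norm_pow, Real.norm_ofNat]
    have h2 : -Complex.I * ((k * (1 / 2) ^ n : ℝ) : ℂ) * ((2 ^ n * ‖x‖ : ℝ) : ℂ) =
        -Complex.I * k * ‖x‖ := by
      push_cast
      rw [one_div, inv_pow]
      field_simp
    rw [h2]
    push_cast
    rw [div_eq_mul_inv, div_eq_mul_inv, mul_left_comm (4 * (Real.pi : ℂ)), mul_inv ((2 : ℂ) ^ n)]
    ring
  rw [piece, annKernel, h1, smul_smul, ← pow_succ']
  simp only [truncKernel]
  have : (2 : ℂ) ^ n ≠ 0 := pow_ne_zero _ two_ne_zero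
  push_cast
  field_simp
  ring

lemma annKernel_eq_zero {κ : ℝ} {z : E3} (h : 2 < ‖z‖) : annKernel κ z = 0 := by
  rw [annKernel, cut_eq_zero h.le, cut_eq_zero]
  · simp
  · rw [norm_smul]
    norm_num
    linarith

lemma contDiff_annKernel_joint : ContDiff ℝ ∞ fun p : ℝ × E3 => annKernel p.1 p.2 := by
  rw [contDiff_iff_contDiffAt]
  rintro ⟨κ, x⟩
  by_cases hx : x = 0
  · subst hx
    have hU : {p : ℝ × E3 | ‖(2 : ℝ) • p.2‖ < 1} ∈ 𝓝 (κ, (0 : E3)) :=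
      (isOpen_lt (by fun_prop) continuous_const).mem_nhds (by simp)
    have : (fun p : ℝ × E3 => annKernel p.1 p.2) =ᶠ[𝓝 (κ, (0 : E3))] fun _ => 0 := by
      filter_upwards [hU] with p hp
      have h1 : ‖(2 : ℝ) • p.2‖ ≤ 1 := le_of_lt hp
      have h2 : ‖p.2‖ ≤ 1 := by
        rw [norm_smul] at h1
        norm_num at h1
        linarith [norm_nonneg p.2]
      simp [annKernel, cut_eq_one h1, cut_eq_one h2]
    exact contDiffAt_const.congr_of_eventuallyEq this
  · have h : ContDiffAt ℝ ∞ (fun p : ℝ × E3 => (‖p.2‖ : ℂ)) (κ, x) :=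
      (contDiffAt_norm_complex hx).comp (κ, x) contDiffAt_snd
    have h' : ContDiffAt ℝ ∞ (fun p : ℝ × E3 => (p.1 : ℂ)) (κ, x) :=
      Complex.ofRealCLM.contDiff.contDiffAt.comp _ contDiffAt_fst
    refine ContDiffAt.mul ?_ ?_
    · refine Complex.ofRealCLM.contDiff.contDiffAt.comp _ ?_
      exact ((contDiff_cut.comp contDiff_snd).sub
        (contDiff_cut.comp (contDiff_snd.const_smul _))).contDiffAt
    · unfold helm
      simp only [div_eq_mul_inv]
      refine (((contDiffAt_const.mul h').mul h).cexp).mul ((contDiffAt_const.mul h).inv ?_)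
      have : ‖x‖ ≠ 0 := norm_ne_zero_iff.2 hx
      have := Real.pi_ne_zero
      norm_cast
      positivity

lemma contDiff_annKernel (κ : ℝ) : ContDiff ℝ ∞ (annKernel κ) :=
  ContDiff.comp (g := fun p : ℝ × E3 => annKernel p.1 p.2) (f := fun z : E3 => (κ, z))
    contDiff_annKernel_joint (contDiff_const.prodMk contDiff_id)

lemma exists_joint_pderList {Ψ : ℝ × E3 → ℂ} (hΨ : ContDiff ℝ ∞ Ψ) (l : List (Fin 3)) :
    ∃ G : ℝ × E3 → ℂ, ContDiff ℝ ∞ G ∧ ∀ κ, pderList l (fun z => Ψ (κ, z)) = fun z => G (κ, z) := by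
  induction l with
  | nil => exact ⟨Ψ, hΨ, fun _ => rfl⟩
  | cons i l ih =>
    obtain ⟨G, hG, h⟩ := ih
    refine ⟨fun p => fderiv ℝ G p (0, e3 i),
      (hG.fderiv_right (by simp)).clm_apply contDiff_const, fun κ => ?_⟩
    rw [pderList_cons, h]
    funext z
    have h1 : HasFDerivAt G (fderiv ℝ G (κ, z)) (κ, z) :=
      (hG.differentiable (by simp) _).hasFDerivAt
    have h2 := h1.comp z (hasFDerivAt_prodMk_right κ z)
    unfold pder
    have h3 : fderiv ℝ (fun z => G (κ, z)) z = _ := h2.fderiv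
    rw [h3]
    simp

lemma exists_bound_pderList_annKernel (k : ℝ) (l : List (Fin 3)) :
    ∃ B, ∀ κ ∈ Icc 0 k, ∀ z, ‖pderList l (annKernel κ) z‖ ≤ B := by
  obtain ⟨G, hG, h⟩ := exists_joint_pderList contDiff_annKernel_joint l
  obtain ⟨B, hB⟩ := ((isCompact_Icc (a := (0 : ℝ)) (b := k)).prod
    (isCompact_closedBall (0 : E3) 2)).exists_bound_of_continuousOn hG.continuous.continuousOn
  refine ⟨max B 0, fun κ hκ z => ?_⟩
  by_cases hz : ‖z‖ ≤ 2
  · have := hB (κ, z) ⟨hκ, by simpa using hz⟩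
    have h' : pderList l (annKernel κ) = _ := h κ
    rw [h']
    exact this.trans (le_max_left _ _)
  · rw [pderList_eq_zero_of_support (fun x hx => annKernel_eq_zero hx) l z (not_le.1 hz)]
    simp

lemma pderList_scale {ψ : E3 → ℂ} (hψ : ContDiff ℝ ∞ ψ) (c : ℂ) (t : ℝ) (l : List (Fin 3)) :
    pderList l (fun x => c * ψ (t • x)) =
      fun x => c * (t : ℂ) ^ l.length * pderList l ψ (t • x) := by
  induction l with
  | nil => simp [pderList]
  | cons i l ih =>
    rw [pderList_cons, ih]
    funext x
    have hs := contDiff_infty_pderList hψ l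
    have hd : Differentiable ℝ fun x => pderList l ψ (t • x) :=
      (hs.differentiable (by simp)).comp (by fun_prop)
    rw [pder_const_mul (hd x)]
    have : pder i (fun x => pderList l ψ (t • x)) x = t * pder i (pderList l ψ) (t • x) := by
      unfold pder
      have h1 := ((hs.differentiable (by simp) (t • x)).hasFDerivAt).comp x
        ((hasFDerivAt_id x).const_smul t)
      have h2 : fderiv ℝ (fun x => pderList l ψ (t • x)) x = _ := h1.fderiv
      rw [h2]
      simp
    rw [this, pderList_cons, List.length_cons]
    ring

lemma piece_succ_support {k : ℝ} {n : ℕ} {x : E3} (h : 2 * (1 / 2 : ℝ) ^ n < ‖x‖) :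
    piece k (n + 1) x = 0 := by
  rw [piece_succ_eq, annKernel_eq_zero, mul_zero]
  rw [norm_smul, norm_pow, Real.norm_ofNat]
  rw [one_div, inv_pow] at h
  have h2 : (0 : ℝ) < 2 ^ n := by positivity
  calc (2 : ℝ) = 2 ^ n * (2 * (2 ^ n)⁻¹) := by field_simp
    _ < 2 ^ n * ‖x‖ := by gcongr

lemma contDiff_piece (k : ℝ) (n : ℕ) : ContDiff ℝ ∞ (piece k n) := by
  cases n with
  | zero => exact contDiff_truncKernel k 0
  | succ n => exact (contDiff_truncKernel k _).sub (contDiff_truncKernel k _)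

lemma smoothBdd_piece (k : ℝ) (n : ℕ) : SmoothBdd (piece k n) := by
  cases n with
  | zero => exact smoothBdd_truncKernel_zero k
  | succ n =>
    exact smoothBdd_of_compact_support (contDiff_piece k _) fun x hx => piece_succ_support hx

lemma exists_bound_pderList_piece_succ {k : ℝ} (hk : 0 ≤ k) (l : List (Fin 3)) :
    ∃ B, 0 ≤ B ∧ ∀ n z, ‖pderList l (piece k (n + 1)) z‖ ≤ B * (2 ^ n) ^ (l.length + 1) := by
  obtain ⟨B, hB⟩ := exists_bound_pderList_annKernel k l
  refine ⟨B, (norm_nonneg _).trans (hB 0 ⟨le_rfl, hk⟩ 0), fun n z => ?_⟩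
  have h1 : piece k (n + 1) = fun x => (2 : ℂ) ^ n * annKernel (k * (1 / 2) ^ n) ((2 : ℝ) ^ n • x) :=
    funext (piece_succ_eq k n)
  rw [h1, pderList_scale (contDiff_annKernel _)]
  simp only [norm_mul, norm_pow, Complex.norm_ofNat, Complex.ofReal_pow, Complex.ofReal_ofNat]
  rw [mul_comm, pow_succ']
  refine mul_le_mul_of_nonneg_right (hB _ ⟨by positivity, ?_⟩ _) (by positivity)
  exact mul_le_of_le_one_right hk (pow_le_one₀ (by norm_num) (by norm_num))

/-! ### Termwise differentiation and Hölder continuity of multiscale sums -/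

lemma hasFDerivAt_tsum_of_pder_bound {f : ℕ → E3 → ℂ} (hf : ∀ n, Differentiable ℝ (f n))
    {u : ℕ → ℝ} (hu : Summable u) (hb : ∀ n i x, ‖pder i (f n) x‖ ≤ u n)
    (h0 : ∀ x, Summable fun n => f n x) (x : E3) :
    HasFDerivAt (fun y => ∑' n, f n y) (∑' n, fderiv ℝ (f n) x) x := by
  refine hasFDerivAt_tsum (u := fun n => 3 * u n) (hu.mul_left 3)
    (fun n y => (hf n y).hasFDerivAt) (fun n y => ?_) (h0 0) x
  refine (norm_fderiv_le_sum_pder (f n) y).trans ?_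
  refine (Finset.sum_le_sum fun i _ => hb n i y).trans ?_
  simp

lemma pder_tsum {f : ℕ → E3 → ℂ} (hf : ∀ n, Differentiable ℝ (f n))
    {u : ℕ → ℝ} (hu : Summable u) (hb : ∀ n i x, ‖pder i (f n) x‖ ≤ u n)
    (h0 : ∀ x, Summable fun n => f n x) (i : Fin 3) :
    pder i (fun y => ∑' n, f n y) = fun x => ∑' n, pder i (f n) x := by
  funext x
  have hs : Summable fun n => fderiv ℝ (f n) x := by
    refine Summable.of_norm_bounded (g := fun n => 3 * u n) (hu.mul_left 3) fun n => ?_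
    refine (norm_fderiv_le_sum_pder (f n) x).trans ?_
    refine (Finset.sum_le_sum fun i _ => hb n i x).trans ?_
    simp
  have h := (hasFDerivAt_tsum_of_pder_bound hf hu hb h0 x).fderiv
  unfold pder
  rw [h]
  exact ((ContinuousLinearMap.apply ℝ ℂ (e3 i)).map_tsum hs)

lemma half_rpow_bounds {α : ℝ} (hα : α ∈ Ioo (0 : ℝ) 1) :
    1 / 2 < (1 / 2 : ℝ) ^ α ∧ (1 / 2 : ℝ) ^ α < 1 := by
  constructor
  · have := Real.rpow_lt_rpow_of_exponent_gt (x := (1 / 2 : ℝ)) (by norm_num) (by norm_num) hα.2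
    simpa using this
  · exact Real.rpow_lt_one (by norm_num) (by norm_num) hα.1

lemma summable_of_geometric_bound {f : ℕ → ℂ} {K s : ℝ} (hs0 : 0 ≤ s) (hs1 : s < 1)
    (h : ∀ n, ‖f n‖ ≤ K * s ^ n) : Summable f :=
  Summable.of_norm_bounded ((summable_geometric_of_lt_one hs0 hs1).mul_left K) h

lemma norm_tsum_le_of_geometric_bound {f : ℕ → ℂ} {K s : ℝ} (hs0 : 0 ≤ s) (hs1 : s < 1)
    (h : ∀ n, ‖f n‖ ≤ K * s ^ n) : ‖∑' n, f n‖ ≤ K * (1 - s)⁻¹ :=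
  tsum_of_norm_bounded ((hasSum_geometric_of_lt_one hs0 hs1).mul_left K) h

lemma holder_tsum {α : ℝ} (hα : α ∈ Ioo (0 : ℝ) 1) :
    ∃ C, 0 ≤ C ∧ ∀ (f : ℕ → E3 → ℂ) (K : ℝ), (∀ n, Differentiable ℝ (f n)) →
      (∀ n x, ‖f n x‖ ≤ K * ((1 / 2 : ℝ) ^ α) ^ n) →
      (∀ n i x, ‖pder i (f n) x‖ ≤ K * (2 * (1 / 2 : ℝ) ^ α) ^ n) →
      ∀ x y, ‖∑' n, f n x - ∑' n, f n y‖ ≤ C * K * ‖x - y‖ ^ α := by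
  obtain ⟨hs1, hs2⟩ := half_rpow_bounds hα
  set s : ℝ := (1 / 2 : ℝ) ^ α with hs
  have hs0 : 0 < s := by linarith
  have h1s : 0 < 1 - s := by linarith
  have h2s : 0 < 2 * s - 1 := by linarith
  refine ⟨(3 * (2 * s - 1)⁻¹ + 2 * (1 - s)⁻¹) * s⁻¹, by positivity, fun f K hf hb hd x y => ?_⟩
  have hK : 0 ≤ K := by simpa using (norm_nonneg _).trans (hb 0 0)
  by_cases hxy : x = y
  · subst hxy
    simp [Real.zero_rpow hα.1.ne']
  have hh : 0 < ‖x - y‖ := norm_pos_iff.2 (sub_ne_zero.2 hxy)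
  set h := ‖x - y‖
  have hsx : Summable fun n => f n x := summable_of_geometric_bound hs0.le hs2 (hb · x)
  have hsy : Summable fun n => f n y := summable_of_geometric_bound hs0.le hs2 (hb · y)
  have hsi : 1 ≤ s⁻¹ := (one_le_inv₀ hs0).2 hs2.le
  by_cases hh1 : 1 ≤ h
  · have e1 := norm_tsum_le_of_geometric_bound hs0.le hs2 (hb · x)
    have e2 := norm_tsum_le_of_geometric_bound hs0.le hs2 (hb · y)
    have e3 : 1 ≤ h ^ α := Real.one_le_rpow hh1 hα.1.le
    have e4 : 0 ≤ K * (1 - s)⁻¹ := by positivity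
    have e5 : 0 ≤ 3 * (2 * s - 1)⁻¹ := by positivity
    calc ‖∑' n, f n x - ∑' n, f n y‖ ≤ 2 * (1 - s)⁻¹ * K := by
          refine (norm_sub_le _ _).trans ?_
          linarith
      _ ≤ (3 * (2 * s - 1)⁻¹ + 2 * (1 - s)⁻¹) * K := by gcongr; linarith
      _ ≤ (3 * (2 * s - 1)⁻¹ + 2 * (1 - s)⁻¹) * K * (s⁻¹ * h ^ α) := by
          refine le_mul_of_one_le_right (by positivity) ?_
          nlinarith
      _ = _ := by ring
  · obtain ⟨N, hN1, hN2⟩ := exists_nat_pow_near_of_lt_one hh (not_le.1 hh1).le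
      (show (0 : ℝ) < 1 / 2 by norm_num) (by norm_num)
    have hsN : s ^ N ≤ s⁻¹ * h ^ α := by
      have e1 : s ^ (N + 1) = ((1 / 2 : ℝ) ^ (N + 1)) ^ α := by
        rw [hs, ← Real.rpow_natCast, ← Real.rpow_natCast, ← Real.rpow_mul (by norm_num),
          ← Real.rpow_mul (by norm_num), mul_comm]
      have e2 : s ^ (N + 1) ≤ h ^ α := by
        rw [e1]
        exact Real.rpow_le_rpow (by positivity) hN1.le hα.1.le
      calc s ^ N = s⁻¹ * s ^ (N + 1) := by rw [pow_succ]; field_simp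
        _ ≤ _ := by gcongr
    rw [← hsx.tsum_sub hsy, ← (hsx.sub hsy).sum_add_tsum_nat_add N]
    have p1 : ‖∑ n ∈ Finset.range N, (f n x - f n y)‖ ≤ 3 * (2 * s - 1)⁻¹ * K * s ^ N := by
      calc ‖∑ n ∈ Finset.range N, (f n x - f n y)‖
          ≤ ∑ n ∈ Finset.range N, 3 * (K * (2 * s) ^ n) * h :=
            (norm_sum_le _ _).trans (Finset.sum_le_sum fun n _ =>
              dist_le_of_pder_bound (hf n) (hd n) x y)
        _ = 3 * K * h * ∑ n ∈ Finset.range N, (2 * s) ^ n := by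
            rw [Finset.mul_sum]
            refine Finset.sum_congr rfl fun n _ => by ring
        _ = 3 * K * h * (((2 * s) ^ N - 1) * (2 * s - 1)⁻¹) := by
            rw [geom_sum_eq (by linarith), div_eq_mul_inv]
        _ ≤ 3 * K * (1 / 2) ^ N * ((2 * s) ^ N * (2 * s - 1)⁻¹) := by
            gcongr
            · have : 1 ≤ (2 * s) ^ N := one_le_pow₀ (by linarith)
              have : 0 ≤ (2 * s) ^ N - 1 := by linarith
              positivity
            · linarith
        _ = _ := by
            rw [mul_pow]
            have : (1 / 2 : ℝ) ^ N * 2 ^ N = 1 := by rw [← mul_pow]; norm_num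
            linear_combination (3 * K * s ^ N * (2 * s - 1)⁻¹) * this
    have p2 : ‖∑' n, (f (n + N) x - f (n + N) y)‖ ≤ 2 * (1 - s)⁻¹ * K * s ^ N := by
      have := norm_tsum_le_of_geometric_bound (f := fun n => f (n + N) x - f (n + N) y)
        (K := 2 * K * s ^ N) hs0.le hs2 (fun n => by
          refine (norm_sub_le _ _).trans ?_
          have q1 := hb (n + N) x
          have q2 := hb (n + N) y
          rw [pow_add] at q1 q2
          linarith)
      linarith
    calc _ ≤ 3 * (2 * s - 1)⁻¹ * K * s ^ N + 2 * (1 - s)⁻¹ * K * s ^ N :=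
          (norm_add_le _ _).trans (add_le_add p1 p2)
      _ = (3 * (2 * s - 1)⁻¹ + 2 * (1 - s)⁻¹) * K * s ^ N := by ring
      _ ≤ (3 * (2 * s - 1)⁻¹ + 2 * (1 - s)⁻¹) * K * (s⁻¹ * h ^ α) := by gcongr
      _ = _ := by ring

/-! ### Local integrability of the kernel -/

lemma integrable_inv_norm_ball (R : ℝ) :
    Integrable fun z : E3 => (if ‖z‖ ≤ R then ‖z‖⁻¹ else 0) := by
  have h := integrable_fun_norm_addHaar (volume : Measure E3)
    (f := fun r : ℝ => if r ≤ R then r⁻¹ else 0)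
  rw [h, finrank_euclideanSpace_fin]
  have h2 : IntegrableOn (fun r : ℝ => r) (Ioc 0 R) :=
    (continuous_id.integrableOn_Icc (a := 0) (b := R)).mono_set Ioc_subset_Icc_self
  have h3 := (integrable_indicator_iff measurableSet_Ioc).2 h2
  refine (h3.integrableOn (s := Ioi 0)).congr_fun (fun r hr => ?_) measurableSet_Ioi
  have hr : 0 < r := hr
  by_cases hrR : r ≤ R
  · simp only [indicator, mem_Ioc, hr, hrR, and_self, if_true, smul_eq_mul]
    field_simp
  · simp [indicator, hrR]

lemma IsSource.integrable_inv_norm_mul {M A : ℝ} {F : E3 → ℂ} (hF : IsSource M A F) (x : E3) :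
    Integrable fun y => ‖x - y‖⁻¹ * ‖F y‖ := by
  have h := ((integrable_inv_norm_ball (‖x‖ + M)).comp_sub_left x).const_mul A
  refine h.mono' ?_ (Eventually.of_forall fun y => ?_)
  · exact (Measurable.aestronglyMeasurable (by fun_prop)).mul hF.meas.norm
  · rw [norm_mul, norm_inv, norm_norm, norm_norm]
    by_cases hy : M < ‖y‖
    · rw [hF.supp y hy, norm_zero, mul_zero]
      refine mul_nonneg hF.nonneg ?_
      split_ifs <;> positivity
    · have : ‖x - y‖ ≤ ‖x‖ + M := (norm_sub_le _ _).trans (by linarith [not_lt.1 hy])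
      rw [if_pos this, mul_comm A]
      gcongr
      exact hF.bound y

lemma measurable_helm (k : ℝ) : Measurable (helm k) := by
  unfold helm
  fun_prop

lemma IsSource.integrable_helm_mul {M A : ℝ} {F : E3 → ℂ} (hF : IsSource M A F) (k : ℝ) (x : E3) :
    Integrable fun y => helm k (x - y) * F y := by
  refine (hF.integrable_inv_norm_mul x).mono' ?_ (Eventually.of_forall fun y => ?_)
  · exact ((measurable_helm k).comp (by fun_prop)).aestronglyMeasurable.mul hF.meas
  · rw [norm_mul]
    gcongr
    exact norm_helm_le k _

lemma cut_mem_Icc (x : E3) : cut x ∈ Icc (0 : ℝ) 1 :=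
  ⟨Real.smoothTransition.nonneg _, Real.smoothTransition.le_one _⟩

lemma norm_truncKernel_le (k : ℝ) (n : ℕ) (z : E3) : ‖truncKernel k n z‖ ≤ ‖z‖⁻¹ := by
  rw [truncKernel, norm_mul, Complex.norm_real]
  obtain ⟨h0, h1⟩ := cut_mem_Icc ((2 : ℝ) ^ n • z)
  rw [Real.norm_of_nonneg (by linarith)]
  refine (mul_le_of_le_one_left (norm_nonneg _) (by linarith)).trans (norm_helm_le k z)

lemma tendsto_truncKernel (k : ℝ) {z : E3} (hz : z ≠ 0) :
    Tendsto (fun n => truncKernel k n z) atTop (𝓝 (helm k z)) := by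
  have hz' : 0 < ‖z‖ := norm_pos_iff.2 hz
  obtain ⟨N, hN⟩ := pow_unbounded_of_one_lt (2 / ‖z‖) (one_lt_two (α := ℝ))
  refine tendsto_const_nhds.congr' ?_
  filter_upwards [eventually_ge_atTop N] with n hn
  rw [truncKernel, cut_eq_zero]
  · simp
  · rw [norm_smul, norm_pow, Real.norm_ofNat]
    have : (2 : ℝ) ^ N ≤ 2 ^ n := pow_le_pow_right₀ (by norm_num) hn
    rw [div_lt_iff₀ hz'] at hN
    nlinarith

lemma IsSource.tendsto_conv_truncKernel {M A : ℝ} {F : E3 → ℂ} (hF : IsSource M A F) (k : ℝ)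
    (x : E3) : Tendsto (fun n => conv (truncKernel k n) F x) atTop (𝓝 (conv (helm k) F x)) := by
  refine tendsto_integral_of_dominated_convergence (fun y => ‖x - y‖⁻¹ * ‖F y‖) (fun n => ?_)
    (hF.integrable_inv_norm_mul x) (fun n => Eventually.of_forall fun y => ?_) ?_
  · exact ((contDiff_truncKernel k n).continuous.comp (by fun_prop)).aestronglyMeasurable.mul
      hF.meas
  · rw [norm_mul]
    gcongr
    exact norm_truncKernel_le k n _
  · have : ∀ᵐ y : E3, y ≠ x := by
      rw [ae_iff]
      simp
    filter_upwards [this] with y hy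
    exact (tendsto_truncKernel k (sub_ne_zero.2 (Ne.symm hy))).mul_const _

lemma IsSource.conv_truncKernel {M A : ℝ} {F : E3 → ℂ} (hF : IsSource M A F) (k : ℝ) (n : ℕ)
    (x : E3) : conv (truncKernel k n) F x = ∑ j ∈ Finset.range (n + 1), conv (piece k j) F x := by
  have hi : ∀ j, Integrable fun y => piece k j (x - y) * F y := fun j => by
    obtain ⟨B, hB⟩ := (smoothBdd_piece k j).exists_bound
    exact integrable_kernel_mul (contDiff_piece k j).continuous hB hF.integrable x
  simp only [conv]
  rw [← integral_finsetSum _ fun j _ => hi j]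
  refine integral_congr_ae (Eventually.of_forall fun y => ?_)
  simp only
  rw [← Finset.sum_mul, sum_piece]

/-! ### Bounds for the dyadic pieces of the potential -/

lemma exists_bound_conv_piece {k M : ℝ} (hk : 0 ≤ k) (hM : 0 ≤ M) (l : List (Fin 3)) :
    ∃ C, 0 ≤ C ∧ ∀ F A, IsSource M A F → ∀ n x,
      ‖conv (pderList l (piece k n)) F x‖ ≤ C * A * (2 ^ l.length / 4) ^ n := by
  obtain ⟨B₀, hB₀⟩ := (smoothBdd_piece k 0).bdd l
  obtain ⟨B, hB0, hB⟩ := exists_bound_pderList_piece_succ hk l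
  have hB00 : 0 ≤ B₀ := (norm_nonneg _).trans (hB₀ 0)
  have hv := ballVol_nonneg
  refine ⟨B₀ * (M ^ 3 * ballVol) + 32 * B * ballVol, by positivity, fun F A hF n x => ?_⟩
  have hA := hF.nonneg
  cases n with
  | zero =>
    refine (norm_conv_le hM hF hB₀ x).trans ?_
    have : 0 ≤ 32 * B * ballVol * A := by positivity
    simp only [pow_zero, mul_one]
    linarith
  | succ n =>
    refine (norm_conv_le_of_support (r := 2 * (1 / 2 : ℝ) ^ n) (by positivity) hF (hB n)
      (pderList_eq_zero_of_support (fun z hz => piece_succ_support hz) l) x).trans ?_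
    have e1 : B * (2 ^ n) ^ (l.length + 1) * A * ((2 * (1 / 2 : ℝ) ^ n) ^ 3 * ballVol) =
        8 * B * ballVol * A * (2 ^ l.length / 4) ^ n := by
      have h8 : ((1 / 2 : ℝ) ^ n) ^ 3 * (2 ^ n) = (1 / 4) ^ n := by
        rw [← pow_mul, mul_comm n 3, pow_mul, ← mul_pow]
        norm_num
      rw [div_eq_mul_one_div (2 ^ l.length) 4, mul_pow (2 ^ l.length), ← h8, ← pow_mul 2 l.length n,
        mul_comm l.length n, pow_mul]
      ring
    rw [e1]
    have e2 : (2 ^ l.length / 4 : ℝ) ^ n ≤ 4 * (2 ^ l.length / 4) ^ (n + 1) := by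
      rw [pow_succ]
      have : (1 : ℝ) ≤ 2 ^ l.length := one_le_pow₀ (by norm_num)
      have h0 : (0 : ℝ) ≤ (2 ^ l.length / 4) ^ n := by positivity
      nlinarith
    have e3 : 0 ≤ B₀ * (M ^ 3 * ballVol) * A * (2 ^ l.length / 4) ^ (n + 1) := by positivity
    have e4 : 0 ≤ 8 * B * ballVol * A := by positivity
    nlinarith [mul_le_mul_of_nonneg_left e2 e4]

lemma exists_holder_bound_conv_piece {k M α : ℝ} (hk : 0 ≤ k) (hM : 0 ≤ M)
    (hα : 0 < α) (i : Fin 3) (l : List (Fin 3)) :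
    ∃ C, 0 ≤ C ∧ ∀ F A H, IsSource M A F → 0 ≤ H →
      (∀ x y, ‖F x - F y‖ ≤ H * ‖x - y‖ ^ α) → ∀ n x,
      ‖conv (pderList (i :: l) (piece k n)) F x‖ ≤
        C * (A + H) * (2 ^ (i :: l).length / 4 * (1 / 2) ^ α) ^ n := by
  obtain ⟨B₀, hB₀⟩ := (smoothBdd_piece k 0).bdd (i :: l)
  obtain ⟨B, hB0, hB⟩ := exists_bound_pderList_piece_succ hk (i :: l)
  have hB00 : 0 ≤ B₀ := (norm_nonneg _).trans (hB₀ 0)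
  have hv := ballVol_nonneg
  set q := (i :: l).length
  set s : ℝ := (1 / 2) ^ α with hs
  have hs0 : 0 < s := by positivity
  refine ⟨B₀ * (M ^ 3 * ballVol) + 32 * s⁻¹ * 2 ^ α * B * ballVol, by positivity,
    fun F A H hF hH hHol n x => ?_⟩
  have hA := hF.nonneg
  cases n with
  | zero =>
    refine (norm_conv_le hM hF hB₀ x).trans ?_
    have h1 : 0 ≤ 32 * s⁻¹ * 2 ^ α * B * ballVol * (A + H) := by positivity
    have h2 : 0 ≤ B₀ * (M ^ 3 * ballVol) * H := by positivity
    simp only [pow_zero, mul_one]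
    linarith
  | succ n =>
    have hsm := smoothBdd_piece k (n + 1)
    have hsup := fun z (hz : 2 * (1 / 2 : ℝ) ^ n < ‖z‖) => piece_succ_support (k := k) hz
    have h0 : ∫ z, pderList (i :: l) (piece k (n + 1)) z = 0 := by
      rw [pderList_cons]
      exact integral_pder_eq_zero ((hsm.pderList l).smooth.of_le (by norm_cast))
        (pderList_eq_zero_of_support hsup l) i
    have h := norm_conv_sub_le_of_support (r := 2 * (1 / 2 : ℝ) ^ n) (by positivity) hα hF
      (hsm.pderList (i :: l)).smooth.continuous hHol hH (hB n)
      (pderList_eq_zero_of_support hsup (i :: l)) x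
    rw [h0, zero_mul, sub_zero] at h
    refine h.trans ?_
    have e0 : (2 * (1 / 2 : ℝ) ^ n) ^ α = 2 ^ α * s ^ n := by
      rw [Real.mul_rpow (by norm_num) (by positivity), hs, ← Real.rpow_natCast,
        ← Real.rpow_natCast, ← Real.rpow_mul (by norm_num), ← Real.rpow_mul (by norm_num),
        mul_comm α]
    have e1 : B * (2 ^ n) ^ (q + 1) * (H * (2 * (1 / 2 : ℝ) ^ n) ^ α) *
        ((2 * (1 / 2 : ℝ) ^ n) ^ 3 * ballVol) =
        8 * 2 ^ α * B * ballVol * H * (2 ^ q / 4 * s) ^ n := by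
      have h8 : ((1 / 2 : ℝ) ^ n) ^ 3 * (2 ^ n) = (1 / 4) ^ n := by
        rw [← pow_mul, mul_comm n 3, pow_mul, ← mul_pow]
        norm_num
      rw [e0, div_eq_mul_one_div (2 ^ q) 4, mul_pow _ s, mul_pow (2 ^ q), ← h8, ← pow_mul 2 q n,
        mul_comm q n, pow_mul]
      ring
    rw [e1]
    have e2 : (2 ^ q / 4 * s : ℝ) ^ n ≤ 4 * s⁻¹ * (2 ^ q / 4 * s) ^ (n + 1) := by
      have h1 : (1 : ℝ) ≤ 2 ^ q := one_le_pow₀ (by norm_num)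
      have h0 : (0 : ℝ) ≤ (2 ^ q / 4 * s) ^ n := by positivity
      have : 4 * s⁻¹ * (2 ^ q / 4 * s) ^ (n + 1) = 2 ^ q * (2 ^ q / 4 * s) ^ n := by
        rw [pow_succ]
        field_simp
      rw [this]
      exact le_mul_of_one_le_left h0 h1
    have e3 : 0 ≤ B₀ * (M ^ 3 * ballVol) * (A + H) * (2 ^ q / 4 * s) ^ (n + 1) := by positivity
    have e5 : 0 ≤ 32 * s⁻¹ * 2 ^ α * B * ballVol * A * (2 ^ q / 4 * s) ^ (n + 1) := by positivity
    have e4 : 0 ≤ 8 * 2 ^ α * B * ballVol * H := by positivity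
    nlinarith [mul_le_mul_of_nonneg_left e2 e4]

/-! ### The volume potential -/

section potential

variable {k M A : ℝ} {F : E3 → ℂ}

lemma IsSource.summable_conv_piece (hF : IsSource M A F) (hk : 0 ≤ k) (hM : 0 ≤ M) (x : E3) :
    Summable fun n => conv (piece k n) F x := by
  obtain ⟨C, _, hC⟩ := exists_bound_conv_piece hk hM []
  exact summable_of_geometric_bound (by norm_num) (by norm_num) fun n => hC F A hF n x

lemma IsSource.potential_eq_tsum (hF : IsSource M A F) (hk : 0 ≤ k) (hM : 0 ≤ M) :
    conv (helm k) F = fun x => ∑' n, conv (piece k n) F x := by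
  funext x
  have h1 := ((hF.summable_conv_piece hk hM x).hasSum.tendsto_sum_nat).comp (tendsto_add_atTop_nat 1)
  refine tendsto_nhds_unique (hF.tendsto_conv_truncKernel k x) (h1.congr fun n => ?_)
  exact (hF.conv_truncKernel k n x).symm

lemma exists_bound_potential (hk : 0 ≤ k) (hM : 0 ≤ M) :
    ∃ C, 0 ≤ C ∧ ∀ F A, IsSource M A F →
      Differentiable ℝ (conv (helm k) F) ∧
      (∀ i, pder i (conv (helm k) F) = fun x => ∑' n, conv (pderList [i] (piece k n)) F x) ∧
      (∀ x, ‖conv (helm k) F x‖ ≤ C * A) ∧ ∀ i x, ‖pder i (conv (helm k) F) x‖ ≤ C * A := by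
  obtain ⟨C₀, hC₀, h0⟩ := exists_bound_conv_piece hk hM []
  choose C hC h using fun i : Fin 3 => exists_bound_conv_piece hk hM [i]
  have hCsum : 0 ≤ ∑ i, C i := Finset.sum_nonneg fun i _ => hC i
  refine ⟨2 * (C₀ + ∑ i, C i), by positivity, fun F A hF => ?_⟩
  have hA := hF.nonneg
  have hle : ∀ i, C i * A ≤ (∑ i, C i) * A := fun i =>
    mul_le_mul_of_nonneg_right (Finset.single_le_sum (fun i _ => hC i) (Finset.mem_univ i)) hA
  have hd : ∀ n, Differentiable ℝ (conv (piece k n) F) := fun n =>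
    (smoothBdd_piece k n).differentiable_conv hF.integrable
  have hb : ∀ i n x, ‖conv (pderList [i] (piece k n)) F x‖ ≤ C i * A * (1 / 2) ^ n := by
    intro i n x
    have := h i F A hF n x
    norm_num at this ⊢
    exact this
  have hb' : ∀ n i x, ‖pder i (conv (piece k n) F) x‖ ≤ (∑ i, C i) * A * (1 / 2) ^ n := by
    intro n i x
    rw [(smoothBdd_piece k n).pder_conv hF.integrable]
    refine (hb i n x).trans ?_
    exact mul_le_mul_of_nonneg_right (hle i) (by positivity)
  have hsum : Summable fun n : ℕ => (∑ i, C i) * A * (1 / 2 : ℝ) ^ n :=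
    (summable_geometric_of_lt_one (by norm_num) (by norm_num)).mul_left _
  have hp : ∀ i, pder i (conv (helm k) F) = fun x => ∑' n, conv (pderList [i] (piece k n)) F x := by
    intro i
    rw [hF.potential_eq_tsum hk hM, pder_tsum hd hsum hb' (hF.summable_conv_piece hk hM)]
    funext x
    refine tsum_congr fun n => ?_
    rw [(smoothBdd_piece k n).pder_conv hF.integrable]
    rfl
  refine ⟨?_, hp, fun x => ?_, fun i x => ?_⟩
  · rw [hF.potential_eq_tsum hk hM]
    exact fun x => (hasFDerivAt_tsum_of_pder_bound hd hsum hb'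
      (hF.summable_conv_piece hk hM) x).differentiableAt
  · rw [hF.potential_eq_tsum hk hM]
    refine (norm_tsum_le_of_geometric_bound (s := 1 / 4) (by norm_num) (by norm_num)
      fun n => by simpa [pderList] using h0 F A hF n x).trans ?_
    have : 0 ≤ (∑ i, C i) * A := by positivity
    have : 0 ≤ C₀ * A := by positivity
    norm_num
    linarith
  · rw [hp]
    refine (norm_tsum_le_of_geometric_bound (s := 1 / 2) (by norm_num) (by norm_num)
      (hb i · x)).trans ?_
    have : 0 ≤ C₀ * A := by positivity
    have := hle i
    norm_num
    linarith

lemma exists_lipschitz_potential (hk : 0 ≤ k) (hM : 0 ≤ M) :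
    ∃ C, 0 ≤ C ∧ ∀ F A, IsSource M A F → (∀ x, ‖conv (helm k) F x‖ ≤ C * A) ∧
      ∀ x y, ‖conv (helm k) F x - conv (helm k) F y‖ ≤ C * A * ‖x - y‖ := by
  obtain ⟨C, hC, h⟩ := exists_bound_potential hk hM
  refine ⟨3 * C, by positivity, fun F A hF => ?_⟩
  obtain ⟨hd, _, h0, h1⟩ := h F A hF
  have hA := hF.nonneg
  refine ⟨fun x => (h0 x).trans ?_, fun x y => ?_⟩
  · nlinarith [mul_nonneg hC hA]
  · rw [mul_assoc 3 C A]
    exact dist_le_of_pder_bound hd h1 x y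

lemma holder_of_bound_of_lipschitz {α : ℝ} (hα : α ∈ Ioo (0 : ℝ) 1) {f : E3 → ℂ} {B : ℝ}
    (h0 : ∀ x, ‖f x‖ ≤ B) (h1 : ∀ x y, ‖f x - f y‖ ≤ B * ‖x - y‖) (x y : E3) :
    ‖f x - f y‖ ≤ 2 * B * ‖x - y‖ ^ α := by
  have hB : 0 ≤ B := (norm_nonneg _).trans (h0 0)
  by_cases h : ‖x - y‖ ≤ 1
  · refine (h1 x y).trans ?_
    have : ‖x - y‖ ≤ ‖x - y‖ ^ α := by
      by_cases hz : ‖x - y‖ = 0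
      · rw [hz, Real.zero_rpow hα.1.ne']
      · have := Real.rpow_le_rpow_of_exponent_ge (lt_of_le_of_ne (norm_nonneg _) (Ne.symm hz)) h
          hα.2.le
        simpa using this
    nlinarith [mul_le_mul_of_nonneg_left this hB, mul_nonneg hB (norm_nonneg (x - y))]
  · have : 1 ≤ ‖x - y‖ ^ α := Real.one_le_rpow (not_le.1 h).le hα.1.le
    refine (norm_sub_le _ _).trans ?_
    nlinarith [h0 x, h0 y]

/-- Hölder estimates for the volume potential. -/
lemma exists_schauder_potential {α : ℝ} (hα : α ∈ Ioo (0 : ℝ) 1) (hk : 0 ≤ k) (hM : 0 ≤ M) :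
    ∃ C, 0 ≤ C ∧ ∀ F A H, IsSource M A F → 0 ≤ H →
      (∀ x y, ‖F x - F y‖ ≤ H * ‖x - y‖ ^ α) →
      ContDiff ℝ 2 (conv (helm k) F) ∧
      (∀ i j, pder i (pder j (conv (helm k) F)) =
        fun x => ∑' n, conv (pderList [i, j] (piece k n)) F x) ∧
      (∀ i j x, Summable fun n => conv (pderList [i, j] (piece k n)) F x) ∧
      ∀ l : List (Fin 3), l.length ≤ 2 →
        (∀ x, ‖pderList l (conv (helm k) F) x‖ ≤ C * (A + H)) ∧
        ∀ x y, ‖pderList l (conv (helm k) F) x - pderList l (conv (helm k) F) y‖ ≤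
          C * (A + H) * ‖x - y‖ ^ α := by
  obtain ⟨hs1, hs2⟩ := half_rpow_bounds hα
  set s : ℝ := (1 / 2 : ℝ) ^ α with hs
  have hs0 : 0 < s := by linarith
  obtain ⟨C₁, hC₁, h1⟩ := exists_bound_potential hk hM
  choose C hC h using fun i j : Fin 3 => exists_holder_bound_conv_piece hk hM hα.1 i [j]
  choose D hD h' using fun m i j : Fin 3 => exists_holder_bound_conv_piece hk hM hα.1 m [i, j]
  obtain ⟨E, hE, hhol⟩ := holder_tsum hα
  set K : ℝ := ∑ i, ∑ j, C i j + ∑ m, ∑ i, ∑ j, D m i j with hKdef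
  have hCnn : 0 ≤ ∑ i, ∑ j, C i j :=
    Finset.sum_nonneg fun i _ => Finset.sum_nonneg fun j _ => hC i j
  have hDnn : 0 ≤ ∑ m, ∑ i, ∑ j, D m i j :=
    Finset.sum_nonneg fun m _ => Finset.sum_nonneg fun i _ => Finset.sum_nonneg fun j _ => hD m i j
  have hK0 : 0 ≤ K := by positivity
  have hCK : ∀ i j, C i j ≤ K := fun i j => by
    have a1 : C i j ≤ ∑ j, C i j := Finset.single_le_sum (fun j _ => hC i j) (Finset.mem_univ j)
    have a2 : ∑ j, C i j ≤ ∑ i, ∑ j, C i j := Finset.single_le_sum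
      (f := fun i => ∑ j, C i j) (fun i _ => Finset.sum_nonneg fun j _ => hC i j)
      (Finset.mem_univ i)
    linarith
  have hDK : ∀ m i j, D m i j ≤ K := fun m i j => by
    have a1 : D m i j ≤ ∑ j, D m i j :=
      Finset.single_le_sum (fun j _ => hD m i j) (Finset.mem_univ j)
    have a2 : ∑ j, D m i j ≤ ∑ i, ∑ j, D m i j := Finset.single_le_sum
      (f := fun i => ∑ j, D m i j) (fun i _ => Finset.sum_nonneg fun j _ => hD m i j)
      (Finset.mem_univ i)
    have a3 : ∑ i, ∑ j, D m i j ≤ ∑ m, ∑ i, ∑ j, D m i j := Finset.single_le_sum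
      (f := fun m => ∑ i, ∑ j, D m i j)
      (fun m _ => Finset.sum_nonneg fun i _ => Finset.sum_nonneg fun j _ => hD m i j)
      (Finset.mem_univ m)
    linarith
  have hsi : 0 < (1 - s)⁻¹ := inv_pos.2 (by linarith)
  set L : ℝ := K * (1 - s)⁻¹ with hL
  have hL0 : 0 ≤ L := by positivity
  refine ⟨2 * (3 * C₁ + 3 * L) + E * K, by positivity, fun F A H hF hH hHol => ?_⟩
  obtain ⟨hd0, hp, hb0, hb1⟩ := h1 F A hF
  have hA := hF.nonneg
  have hAH : 0 ≤ A + H := by positivity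
  have hsm := fun n l => (smoothBdd_piece k n).pderList l
  have hd2 : ∀ l n, Differentiable ℝ (conv (pderList l (piece k n)) F) := fun l n =>
    (hsm n l).differentiable_conv hF.integrable
  have hpc : ∀ m l n, pder m (conv (pderList l (piece k n)) F) =
      conv (pderList (m :: l) (piece k n)) F := fun m l n =>
    (hsm n l).pder_conv hF.integrable m
  have hb2 : ∀ i j n x, ‖conv (pderList [i, j] (piece k n)) F x‖ ≤ K * (A + H) * s ^ n := by
    intro i j n x
    have := h i j F A H hF hH hHol n x
    have e : (2 ^ [i, j].length / 4 * s : ℝ) = s := by norm_num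
    rw [← hs, e] at this
    refine this.trans ?_
    gcongr
    exact hCK i j
  have hb3 : ∀ i j n m x, ‖pder m (conv (pderList [i, j] (piece k n)) F) x‖ ≤
      K * (A + H) * (2 * s) ^ n := by
    intro i j n m x
    rw [hpc]
    have := h' m i j F A H hF hH hHol n x
    have e : (2 ^ [m, i, j].length / 4 * s : ℝ) = 2 * s := by norm_num
    rw [← hs, e] at this
    refine this.trans ?_
    gcongr
    exact hDK m i j
  have hsum1 : ∀ j x, Summable fun n => conv (pderList [j] (piece k n)) F x := by
    intro j x
    obtain ⟨C', _, hC'⟩ := exists_bound_conv_piece hk hM [j]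
    exact summable_of_geometric_bound (by norm_num) (by norm_num) fun n => hC' F A hF n x
  have hsum2 : ∀ i j x, Summable fun n => conv (pderList [i, j] (piece k n)) F x := fun i j x =>
    summable_of_geometric_bound hs0.le hs2 (hb2 i j · x)
  have hgeo : Summable fun n : ℕ => K * (A + H) * s ^ n :=
    (summable_geometric_of_lt_one hs0.le hs2).mul_left _
  have hbp : ∀ j n i x, ‖pder i (conv (pderList [j] (piece k n)) F) x‖ ≤ K * (A + H) * s ^ n := by
    intro j n i x
    rw [hpc]
    exact hb2 i j n x
  have hd1 : ∀ j, Differentiable ℝ (pder j (conv (helm k) F)) := by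
    intro j
    rw [hp j]
    exact fun x => (hasFDerivAt_tsum_of_pder_bound (hd2 [j]) hgeo (hbp j)
      (hsum1 j) x).differentiableAt
  have hpp : ∀ i j, pder i (pder j (conv (helm k) F)) =
      fun x => ∑' n, conv (pderList [i, j] (piece k n)) F x := by
    intro i j
    rw [hp j, pder_tsum (hd2 [j]) hgeo (hbp j) (hsum1 j)]
    funext x
    exact tsum_congr fun n => by rw [hpc]
  have hB2 : ∀ i j x, ‖pder i (pder j (conv (helm k) F)) x‖ ≤ L * (A + H) := by
    intro i j x
    rw [hpp]
    refine (norm_tsum_le_of_geometric_bound hs0.le hs2 (hb2 i j · x)).trans (le_of_eq ?_)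
    rw [hL]
    ring
  have hH2 : ∀ i j x y, ‖pder i (pder j (conv (helm k) F)) x -
      pder i (pder j (conv (helm k) F)) y‖ ≤ E * K * (A + H) * ‖x - y‖ ^ α := by
    intro i j x y
    rw [hpp]
    refine (hhol _ _ (hd2 [i, j]) (hb2 i j) (hb3 i j) x y).trans (le_of_eq ?_)
    ring
  have hc2 : ∀ i j, Continuous (pder i (pder j (conv (helm k) F))) := by
    intro i j
    rw [hpp i j]
    exact continuous_tsum (fun n => (hd2 [i, j] n).continuous) hgeo (hb2 i j)
  have hcd : ContDiff ℝ 2 (conv (helm k) F) := by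
    refine contDiff_succ_of_pder (n := 1) hd0 fun j => ?_
    refine contDiff_succ_of_pder (n := 0) (hd1 j) fun i => ?_
    exact contDiff_zero.2 (hc2 i j)
  have key : ∀ {f : E3 → ℂ} {B : ℝ}, (∀ x, ‖f x‖ ≤ B) → (∀ x y, ‖f x - f y‖ ≤ B * ‖x - y‖) →
      B ≤ (3 * C₁ + 3 * L) * (A + H) →
      (∀ x, ‖f x‖ ≤ (2 * (3 * C₁ + 3 * L) + E * K) * (A + H)) ∧
      ∀ x y, ‖f x - f y‖ ≤ (2 * (3 * C₁ + 3 * L) + E * K) * (A + H) * ‖x - y‖ ^ α := by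
    intro f B hf0 hf1 hB
    have hle : 2 * B ≤ (2 * (3 * C₁ + 3 * L) + E * K) * (A + H) := by
      have : 0 ≤ E * K * (A + H) := by positivity
      nlinarith
    refine ⟨fun x => ?_, fun x y => ?_⟩
    · have := (norm_nonneg _).trans (hf0 x)
      linarith [hf0 x]
    · refine (holder_of_bound_of_lipschitz hα hf0 hf1 x y).trans ?_
      gcongr
  have c1 : C₁ * A ≤ C₁ * (A + H) := by gcongr; linarith
  have c2 : 0 ≤ L * (A + H) := by positivity
  have c3 : 0 ≤ C₁ * A := by positivity
  have c4 : 0 ≤ C₁ * (A + H) := by positivity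
  refine ⟨hcd, hpp, hsum2, fun l hl => ?_⟩
  match l, hl with
  | [], _ =>
    refine key (B := 3 * (C₁ * A)) (fun x => (hb0 x).trans (by linarith)) ?_ (by linarith)
    exact dist_le_of_pder_bound hd0 hb1
  | [j], _ =>
    refine key (B := C₁ * A + 3 * (L * (A + H))) (fun x => (hb1 j x).trans (by linarith))
      (fun x y => ?_) (by linarith)
    refine (dist_le_of_pder_bound (hd1 j) (fun i x => hB2 i j x) x y).trans ?_
    gcongr
    linarith
  | [i, j], _ =>
    have c5 : 0 ≤ E * K * (A + H) := by positivity
    refine ⟨fun x => (hB2 i j x).trans (by nlinarith), fun x y => (hH2 i j x y).trans ?_⟩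
    gcongr
    nlinarith

end potential

/-! ### The Helmholtz equation for the volume potential -/

lemma lap_radial {h h₁ h₂ : ℝ → ℂ} (hh : ∀ r, 0 < r → HasDerivAt h (h₁ r) r)
    (hh₁ : ∀ r, 0 < r → HasDerivAt h₁ (h₂ r) r) {x : E3} (hx : x ≠ 0) :
    lap (fun y => h ‖y‖ * (‖y‖ : ℂ)⁻¹) x = h₂ ‖x‖ * (‖x‖ : ℂ)⁻¹ := by
  have hU : IsOpen {y : E3 | y ≠ 0} := isOpen_ne
  have hinv : ∀ r : ℝ, 0 < r → HasDerivAt (fun t : ℝ => (t : ℂ)⁻¹) (-((r : ℂ)⁻¹ * (r : ℂ)⁻¹)) r :=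
    fun r hr => hasDerivAt_inv_ofReal hr.ne'
  set g₁ : ℝ → ℂ := fun r => h₁ r * ((r : ℂ)⁻¹ * (r : ℂ)⁻¹) -
    h r * ((r : ℂ)⁻¹ * ((r : ℂ)⁻¹ * (r : ℂ)⁻¹)) with hg₁
  have d1 : ∀ i, EqOn (pder i fun y => h ‖y‖ * (‖y‖ : ℂ)⁻¹) (fun y => g₁ ‖y‖ * (y i : ℂ))
      {y : E3 | y ≠ 0} := by
    intro i y hy
    have hr : 0 < ‖y‖ := norm_pos_iff.2 hy
    rw [pder_comp_norm (g := fun r => h r * (r : ℂ)⁻¹) hy ((hh _ hr).mul (hinv _ hr))]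
    simp only [hg₁]
    ring
  have d2 : ∀ r : ℝ, 0 < r → HasDerivAt g₁
      (h₂ r * ((r : ℂ)⁻¹ * (r : ℂ)⁻¹) - 3 * h₁ r * ((r : ℂ)⁻¹ * ((r : ℂ)⁻¹ * (r : ℂ)⁻¹)) +
        3 * h r * ((r : ℂ)⁻¹ * ((r : ℂ)⁻¹ * ((r : ℂ)⁻¹ * (r : ℂ)⁻¹)))) r := by
    intro r hr
    have := ((hh₁ r hr).mul ((hinv r hr).mul (hinv r hr))).sub
      ((hh r hr).mul ((hinv r hr).mul ((hinv r hr).mul (hinv r hr))))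
    refine HasDerivAt.congr_deriv this ?_
    simp only [Pi.mul_apply]
    ring
  have hr : 0 < ‖x‖ := norm_pos_iff.2 hx
  have hrc : (‖x‖ : ℂ) ≠ 0 := by exact_mod_cast hr.ne'
  have hsq : ((x 0 : ℝ) : ℂ) ^ 2 + ((x 1 : ℝ) : ℂ) ^ 2 + ((x 2 : ℝ) : ℂ) ^ 2 = (‖x‖ : ℂ) ^ 2 := by
    have := EuclideanSpace.real_norm_sq_eq x
    rw [Fin.sum_univ_three] at this
    exact_mod_cast this.symm
  have d3 : ∀ i, pder i (pder i fun y => h ‖y‖ * (‖y‖ : ℂ)⁻¹) x =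
      (h₂ ‖x‖ * ((‖x‖ : ℂ)⁻¹ * (‖x‖ : ℂ)⁻¹) -
        3 * h₁ ‖x‖ * ((‖x‖ : ℂ)⁻¹ * ((‖x‖ : ℂ)⁻¹ * (‖x‖ : ℂ)⁻¹)) +
        3 * h ‖x‖ * ((‖x‖ : ℂ)⁻¹ * ((‖x‖ : ℂ)⁻¹ * ((‖x‖ : ℂ)⁻¹ * (‖x‖ : ℂ)⁻¹)))) *
        (‖x‖ : ℂ)⁻¹ * (x i : ℂ) ^ 2 + g₁ ‖x‖ := by
    intro i
    rw [pder_congr hU (d1 i) i hx,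
      pder_mul (hasFDerivAt_comp_norm hx (d2 _ hr)).differentiableAt
        (hasFDerivAt_coord i x).differentiableAt, pder_coord, pder_comp_norm hx (d2 _ hr)]
    simp
    ring
  rw [lap, Fin.sum_univ_three, d3, d3, d3]
  have : ∀ c g a b d : ℂ, c * a + g + (c * b + g) + (c * d + g) = c * (a + b + d) + 3 * g := by
    intros; ring
  rw [this, hsq, hg₁]
  field_simp
  ring

/-- the radial profile of `1 - cut`. -/
def cutProfile (t : ℝ) : ℝ := 1 - Real.smoothTransition (2 - t ^ 2)

lemma contDiff_cutProfile : ContDiff ℝ ∞ cutProfile :=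
  contDiff_const.sub (Real.smoothTransition.contDiff.comp (contDiff_const.sub (contDiff_id.pow 2)))

lemma cutProfile_zero : cutProfile 0 = 0 := by
  rw [cutProfile, Real.smoothTransition.one_of_one_le (by norm_num), sub_self]

lemma cutProfile_eq_one {t : ℝ} (h : 2 ≤ t ^ 2) : cutProfile t = 1 := by
  rw [cutProfile, Real.smoothTransition.zero_of_nonpos (by linarith), sub_zero]

lemma cutProfile_deriv_eq_zero {t : ℝ} (h : 2 < t ^ 2) :
    deriv cutProfile t = 0 ∧ deriv (deriv cutProfile) t = 0 := by
  have hU : IsOpen {s : ℝ | 2 < s ^ 2} := isOpen_lt continuous_const (by fun_prop)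
  have h1 : ∀ s : ℝ, 2 < s ^ 2 → deriv cutProfile s = 0 := by
    intro s hs
    have : cutProfile =ᶠ[𝓝 s] fun _ => 1 := by
      filter_upwards [hU.mem_nhds hs] with r hr
      exact cutProfile_eq_one (le_of_lt hr)
    rw [this.deriv_eq]
    simp
  refine ⟨h1 t h, ?_⟩
  have : deriv cutProfile =ᶠ[𝓝 t] fun _ => 0 := by
    filter_upwards [hU.mem_nhds h] with r hr
    exact h1 r hr
  rw [this.deriv_eq]
  simp

lemma contDiff_deriv_cutProfile : ContDiff ℝ ∞ (deriv cutProfile) :=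
  (contDiff_infty_iff_deriv.1 contDiff_cutProfile).2

lemma exists_bound_cutProfile_deriv :
    ∃ D, 0 ≤ D ∧ ∀ t, |deriv cutProfile t| ≤ D ∧ |deriv (deriv cutProfile) t| ≤ D := by
  have c1 : Continuous (deriv cutProfile) := contDiff_deriv_cutProfile.continuous
  have c2 : Continuous (deriv (deriv cutProfile)) :=
    (contDiff_infty_iff_deriv.1 contDiff_deriv_cutProfile).2.continuous
  obtain ⟨B, hB⟩ := (isCompact_Icc (a := (-2 : ℝ)) (b := 2)).exists_bound_of_continuousOn
    c1.continuousOn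
  obtain ⟨C, hC⟩ := (isCompact_Icc (a := (-2 : ℝ)) (b := 2)).exists_bound_of_continuousOn
    c2.continuousOn
  refine ⟨max (max B C) 0, le_max_right _ _, fun t => ?_⟩
  by_cases ht : t ∈ Icc (-2 : ℝ) 2
  · exact ⟨(hB t ht).trans ((le_max_left _ _).trans (le_max_left _ _)),
      (hC t ht).trans ((le_max_right _ _).trans (le_max_left _ _))⟩
  · have : 2 < t ^ 2 := by
      by_contra! h
      exact ht ⟨by nlinarith, by nlinarith⟩
    obtain ⟨h1, h2⟩ := cutProfile_deriv_eq_zero this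
    simp [h1, h2]

/-- spherical wave profile. -/
def waveProfile (k r : ℝ) : ℂ := Complex.exp (-Complex.I * k * r) * (4 * Real.pi : ℂ)⁻¹

lemma hasDerivAt_waveProfile (k r : ℝ) :
    HasDerivAt (waveProfile k) (-Complex.I * k * waveProfile k r) r := by
  have := (hasDerivAt_exp_ofReal k r).mul_const (4 * Real.pi : ℂ)⁻¹
  refine HasDerivAt.congr_deriv this ?_
  rw [waveProfile]
  ring

lemma norm_waveProfile_le (k r : ℝ) : ‖waveProfile k r‖ ≤ 1 := by
  rw [waveProfile, norm_mul, norm_exp_neg_I_mul, one_mul, norm_inv]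
  apply inv_le_one_of_one_le₀
  rw [norm_mul, Complex.norm_real, Real.norm_of_nonneg Real.pi_pos.le]
  norm_num
  nlinarith [Real.pi_gt_three]

/-- radial profile of `truncKernel` and its derivatives. -/
def truncProfile (k c r : ℝ) : ℂ := (cutProfile (c * r) : ℂ) * waveProfile k r

def truncProfile₁ (k c r : ℝ) : ℂ :=
  ((c * deriv cutProfile (c * r) : ℝ) - Complex.I * k * (cutProfile (c * r) : ℂ)) * waveProfile k r

/-- the profile of the defect of the truncated kernel in the Helmholtz equation. -/
def defectProfile (k c r : ℝ) : ℂ :=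
  ((c ^ 2 * deriv (deriv cutProfile) (c * r) : ℝ) -
    2 * Complex.I * k * (c * deriv cutProfile (c * r) : ℝ)) * waveProfile k r

lemma hasDerivAt_cutProfile_mul (c r : ℝ) :
    HasDerivAt (fun r : ℝ => ((cutProfile (c * r) : ℝ) : ℂ))
      ((c * deriv cutProfile (c * r) : ℝ) : ℂ) r := by
  have h1 : HasDerivAt cutProfile (deriv cutProfile (c * r)) (c * r) :=
    (contDiff_cutProfile.differentiable (by simp) _).hasDerivAt
  have h2 := h1.comp r ((hasDerivAt_id r).const_mul c)
  have h3 := h2.ofReal_comp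
  refine HasDerivAt.congr_deriv h3 ?_
  simp [mul_comm]

lemma hasDerivAt_deriv_cutProfile_mul (c r : ℝ) :
    HasDerivAt (fun r : ℝ => ((c * deriv cutProfile (c * r) : ℝ) : ℂ))
      ((c ^ 2 * deriv (deriv cutProfile) (c * r) : ℝ) : ℂ) r := by
  have h1 : HasDerivAt (deriv cutProfile) (deriv (deriv cutProfile) (c * r)) (c * r) :=
    (contDiff_deriv_cutProfile.differentiable (by simp) _).hasDerivAt
  have h2 := (h1.comp r ((hasDerivAt_id r).const_mul c)).const_mul c
  have h3 := h2.ofReal_comp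
  refine HasDerivAt.congr_deriv h3 ?_
  simp
  ring

lemma hasDerivAt_truncProfile (k c r : ℝ) :
    HasDerivAt (truncProfile k c) (truncProfile₁ k c r) r := by
  have := (hasDerivAt_cutProfile_mul c r).mul (hasDerivAt_waveProfile k r)
  refine HasDerivAt.congr_deriv this ?_
  rw [truncProfile₁]
  ring

lemma hasDerivAt_truncProfile₁ (k c r : ℝ) :
    HasDerivAt (truncProfile₁ k c) (defectProfile k c r - k ^ 2 * truncProfile k c r) r := by
  have := ((hasDerivAt_deriv_cutProfile_mul c r).sub
    ((hasDerivAt_cutProfile_mul c r).const_mul (Complex.I * k))).mul (hasDerivAt_waveProfile k r)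
  refine HasDerivAt.congr_deriv this ?_
  rw [defectProfile, truncProfile]
  simp only [Pi.sub_apply]
  linear_combination ((k : ℂ) ^ 2 * cutProfile (c * r) * waveProfile k r) * Complex.I_sq

lemma truncKernel_eq_profile (k : ℝ) (n : ℕ) :
    truncKernel k n = fun x => truncProfile k (2 ^ n) ‖x‖ * (‖x‖ : ℂ)⁻¹ := by
  funext x
  have : 1 - cut ((2 : ℝ) ^ n • x) = cutProfile (2 ^ n * ‖x‖) := by
    rw [cut, cutProfile, norm_smul, norm_pow, Real.norm_ofNat]
  rw [truncKernel, this, truncProfile, waveProfile, helm, div_eq_mul_inv, mul_inv]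
  ring

lemma lap_truncKernel_add (k : ℝ) (n : ℕ) {x : E3} (hx : x ≠ 0) :
    lap (truncKernel k n) x + k ^ 2 * truncKernel k n x =
      defectProfile k (2 ^ n) ‖x‖ * (‖x‖ : ℂ)⁻¹ := by
  rw [truncKernel_eq_profile, lap_radial (fun r _ => hasDerivAt_truncProfile k _ r)
    (fun r _ => hasDerivAt_truncProfile₁ k _ r) hx]
  ring

lemma exists_bound_defectProfile {k : ℝ} (hk : 0 ≤ k) :
    ∃ D, 0 ≤ D ∧ ∀ c r, 1 ≤ c → ‖defectProfile k c r‖ ≤ D * c ^ 2 := by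
  obtain ⟨D, hD, h⟩ := exists_bound_cutProfile_deriv
  refine ⟨D + 2 * k * D, by positivity, fun c r hc => ?_⟩
  obtain ⟨h1, h2⟩ := h (c * r)
  have hc0 : 0 ≤ c := by linarith
  rw [defectProfile, norm_mul]
  refine (mul_le_of_le_one_right (norm_nonneg _) (norm_waveProfile_le k r)).trans ?_
  refine (norm_sub_le _ _).trans ?_
  rw [norm_mul, norm_mul, norm_mul, Complex.norm_real, Complex.norm_real, Complex.norm_real,
    Complex.norm_I, norm_mul, norm_mul, Real.norm_of_nonneg hk, Real.norm_of_nonneg hc0, norm_pow,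
    Real.norm_of_nonneg hc0, Real.norm_eq_abs, Real.norm_eq_abs]
  norm_num
  have e1 : c ^ 2 * |deriv (deriv cutProfile) (c * r)| ≤ c ^ 2 * D := by gcongr
  have e2 : 2 * k * (c * |deriv cutProfile (c * r)|) ≤ 2 * k * (c ^ 2 * D) := by
    gcongr
    nlinarith
  linarith

lemma defectProfile_eq_zero {k c r : ℝ} (h : 2 < c * r) : defectProfile k c r = 0 := by
  obtain ⟨h1, h2⟩ := cutProfile_deriv_eq_zero (t := c * r) (by nlinarith)
  simp [defectProfile, h1, h2]

/-- the defect of the truncated kernel in the Helmholtz equation. -/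
def defect (k : ℝ) (n : ℕ) (x : E3) : ℂ := lap (truncKernel k n) x + k ^ 2 * truncKernel k n x

lemma defect_eq_zero {k : ℝ} {n : ℕ} {x : E3} (h : 2 * (1 / 2 : ℝ) ^ n < ‖x‖) :
    defect k n x = 0 := by
  have hx : x ≠ 0 := norm_pos_iff.1 (lt_of_le_of_lt (by positivity) h)
  rw [defect, lap_truncKernel_add k n hx, defectProfile_eq_zero, zero_mul]
  rw [one_div, inv_pow] at h
  have h2 : (0 : ℝ) < 2 ^ n := by positivity
  calc (2 : ℝ) = 2 ^ n * (2 * (2 ^ n)⁻¹) := by field_simp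
    _ < 2 ^ n * ‖x‖ := by gcongr

lemma exists_bound_defect {k : ℝ} (hk : 0 ≤ k) :
    ∃ D, 0 ≤ D ∧ ∀ n x, ‖defect k n x‖ ≤ D * (2 ^ n) ^ 3 := by
  obtain ⟨D, hD, h⟩ := exists_bound_defectProfile hk
  refine ⟨D, hD, fun n x => ?_⟩
  have h2 : (0 : ℝ) < 2 ^ n := by positivity
  by_cases hx : 2 ^ n * ‖x‖ < 1
  · have hU : IsOpen {y : E3 | 2 ^ n * ‖y‖ < 1} := isOpen_lt (by fun_prop) continuous_const
    have h0 : EqOn (truncKernel k n) (fun _ => 0) {y : E3 | 2 ^ n * ‖y‖ < 1} := fun y hy => by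
      have hy : 2 ^ n * ‖y‖ < 1 := hy
      rw [truncKernel, cut_eq_one]
      · simp
      · rw [norm_smul, norm_pow, Real.norm_ofNat]
        exact hy.le
    have h1 : ∀ i, pder i (pder i (truncKernel k n)) x = 0 := fun i => by
      have := pderList_congr hU h0 [i, i] (show x ∈ {y : E3 | 2 ^ n * ‖y‖ < 1} from hx)
      rw [pderList_zero] at this
      exact this
    rw [defect, lap, h0 hx]
    simp only [h1]
    simp
    positivity
  · have hx := not_lt.1 hx
    have hx0 : x ≠ 0 := by
      rintro rfl
      simp at hx
      norm_num at hx
    have hr : 0 < ‖x‖ := norm_pos_iff.2 hx0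
    rw [defect, lap_truncKernel_add k n hx0, norm_mul, norm_inv, Complex.norm_real, norm_norm]
    have h3 : ‖x‖⁻¹ ≤ 2 ^ n := by
      rw [inv_le_iff_one_le_mul₀ hr]
      exact hx
    calc _ ≤ D * (2 ^ n) ^ 2 * 2 ^ n :=
          mul_le_mul (h _ _ (one_le_pow₀ (by norm_num))) h3 (by positivity) (by positivity)
      _ = _ := by ring

lemma continuous_defect (k : ℝ) (n : ℕ) : Continuous (defect k n) := by
  unfold defect lap
  refine Continuous.add ?_ ((contDiff_truncKernel k n).continuous.const_mul _)
  exact continuous_finsetSum _ fun i _ =>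
    (contDiff_infty_pder (contDiff_infty_pder (contDiff_truncKernel k n) i) i).continuous

lemma integral_defect (k : ℝ) (n : ℕ) :
    ∫ x, defect k n x = 4 * Real.pi * ∫ r in (0 : ℝ)..2 * (1 / 2) ^ n,
      (r : ℂ) * defectProfile k (2 ^ n) r := by
  have h1 : ∫ x, defect k n x = ∫ x : E3, (fun r : ℝ => defectProfile k (2 ^ n) r * (r : ℂ)⁻¹) ‖x‖ := by
    refine integral_congr_ae ?_
    have : ∀ᵐ y : E3, y ≠ 0 := by
      rw [ae_iff]
      simp
    filter_upwards [this] with y hy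
    exact lap_truncKernel_add k n hy
  have hvol : (volume : Measure E3).real (Metric.ball 0 1) = 4 / 3 * Real.pi := by
    rw [measureReal_def, EuclideanSpace.volume_ball_fin_three]
    simp
    rw [ENNReal.toReal_ofReal (by positivity)]
    ring
  rw [h1, integral_fun_norm_addHaar volume
    (fun r : ℝ => defectProfile k (2 ^ n) r * (r : ℂ)⁻¹), finrank_euclideanSpace_fin, hvol,
    intervalIntegral.integral_of_le (by positivity)]
  have h2 : ∫ y in Ioi (0 : ℝ), y ^ (3 - 1) • (defectProfile k (2 ^ n) y * (y : ℂ)⁻¹) =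
      ∫ y in Ioi (0 : ℝ), (Ioc (0 : ℝ) (2 * (1 / 2) ^ n)).indicator
        (fun r : ℝ => (r : ℂ) * defectProfile k (2 ^ n) r) y := by
    refine setIntegral_congr_fun measurableSet_Ioi fun y hy => ?_
    have hy : 0 < y := hy
    have hyc : (y : ℂ) ≠ 0 := by exact_mod_cast hy.ne'
    by_cases hy2 : y ≤ 2 * (1 / 2) ^ n
    · have hmem : y ∈ Ioc (0 : ℝ) (2 * (1 / 2) ^ n) := ⟨hy, hy2⟩
      rw [indicator_of_mem hmem]
      simp only [Complex.real_smul]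
      push_cast
      field_simp
    · rw [indicator_of_notMem (fun h => hy2 h.2)]
      rw [defectProfile_eq_zero]
      · simp
      rw [not_le, one_div, inv_pow] at hy2
      have h2 : (0 : ℝ) < 2 ^ n := by positivity
      calc (2 : ℝ) = 2 ^ n * (2 * (2 ^ n)⁻¹) := by field_simp
        _ < 2 ^ n * y := by gcongr
  rw [h2, setIntegral_indicator measurableSet_Ioc,
    inter_eq_right.2 (show Ioc (0 : ℝ) (2 * (1 / 2) ^ n) ⊆ Ioi 0 from fun y hy => hy.1), nsmul_eq_mul, Complex.real_smul]
  push_cast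
  ring

lemma tendsto_integral_defect (k : ℝ) :
    Tendsto (fun n => ∫ x, defect k n x) atTop (𝓝 (-1)) := by
  have hcp : Continuous fun p : ℝ => waveProfile k p :=
    continuous_iff_continuousAt.2 fun r => (hasDerivAt_waveProfile k r).continuousAt
  have hr : Tendsto (fun n : ℕ => (2 : ℝ) * (1 / 2) ^ n) atTop (𝓝 0) := by
    have := (tendsto_pow_atTop_nhds_zero_of_lt_one (r := (1 / 2 : ℝ)) (by norm_num)
      (by norm_num)).const_mul 2
    simpa using this
  have key : ∀ n : ℕ, ∫ r in (0 : ℝ)..2 * (1 / 2) ^ n, (r : ℂ) * defectProfile k (2 ^ n) r =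
      (((2 * (1 / 2) ^ n : ℝ) : ℂ) * (-Complex.I * k) - 1) * waveProfile k (2 * (1 / 2) ^ n) +
      k ^ 2 * ∫ r in (0 : ℝ)..2 * (1 / 2) ^ n, (r : ℂ) * truncProfile k (2 ^ n) r := by
    intro n
    have hct : Continuous (truncProfile k (2 ^ n)) := continuous_iff_continuousAt.2 fun r =>
      (hasDerivAt_truncProfile k (2 ^ n) r).continuousAt
    have hcd : Continuous (defectProfile k (2 ^ n)) := by
      unfold defectProfile
      have c1 := contDiff_deriv_cutProfile.continuous
      have c2 := (contDiff_infty_iff_deriv.1 contDiff_deriv_cutProfile).2.continuous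
      fun_prop
    have i1 : IntervalIntegrable (fun r : ℝ => (r : ℂ) * defectProfile k (2 ^ n) r) volume 0
        (2 * (1 / 2) ^ n) := Continuous.intervalIntegrable (by fun_prop) _ _
    have i2 : IntervalIntegrable (fun r : ℝ => (r : ℂ) * truncProfile k (2 ^ n) r) volume 0
        (2 * (1 / 2) ^ n) := Continuous.intervalIntegrable (by fun_prop) _ _
    have hd : ∀ r : ℝ, HasDerivAt
        (fun r : ℝ => (r : ℂ) * truncProfile₁ k (2 ^ n) r - truncProfile k (2 ^ n) r)
        ((r : ℂ) * defectProfile k (2 ^ n) r - k ^ 2 * ((r : ℂ) * truncProfile k (2 ^ n) r)) r := by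
      intro r
      have h1 : HasDerivAt (fun r : ℝ => (r : ℂ)) 1 r := (hasDerivAt_id r).ofReal_comp
      have := (h1.mul (hasDerivAt_truncProfile₁ k (2 ^ n) r)).sub
        (hasDerivAt_truncProfile k (2 ^ n) r)
      refine HasDerivAt.congr_deriv this ?_
      ring
    have h := intervalIntegral.integral_eq_sub_of_hasDerivAt (fun r _ => hd r)
      (i1.sub (i2.const_mul ((k : ℂ) ^ 2)))
    rw [intervalIntegral.integral_sub i1 (i2.const_mul _),
      intervalIntegral.integral_const_mul] at h
    rw [sub_eq_iff_eq_add.1 h]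
    have e : (2 : ℝ) ^ n * (2 * (1 / 2) ^ n) = 2 := by
      rw [one_div, inv_pow]
      field_simp
    have e1 : truncProfile k (2 ^ n) (2 * (1 / 2) ^ n) = waveProfile k (2 * (1 / 2) ^ n) := by
      rw [truncProfile, e, cutProfile_eq_one (by norm_num)]
      simp
    have e2 : truncProfile₁ k (2 ^ n) (2 * (1 / 2) ^ n) =
        -Complex.I * k * waveProfile k (2 * (1 / 2) ^ n) := by
      rw [truncProfile₁, e, cutProfile_eq_one (by norm_num),
        (cutProfile_deriv_eq_zero (t := 2) (by norm_num)).1]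
      simp
    have e3 : truncProfile k (2 ^ n) 0 = 0 := by
      rw [truncProfile, mul_zero, cutProfile_zero]
      simp
    rw [e1, e2, e3]
    simp only [Complex.ofReal_zero, zero_mul, sub_zero]
    ring
  have hsmall : Tendsto (fun n : ℕ => ∫ r in (0 : ℝ)..2 * (1 / 2) ^ n,
      (r : ℂ) * truncProfile k (2 ^ n) r) atTop (𝓝 0) := by
    rw [tendsto_zero_iff_norm_tendsto_zero]
    refine squeeze_zero (fun n => norm_nonneg _) (fun n => ?_)
      (g := fun n => 2 * (2 * (1 / 2 : ℝ) ^ n)) (by simpa using hr.const_mul 2)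
    have := intervalIntegral.norm_integral_le_of_norm_le_const (a := 0) (b := 2 * (1 / 2 : ℝ) ^ n)
      (f := fun r : ℝ => (r : ℂ) * truncProfile k (2 ^ n) r) (C := 2) (fun r hr => ?_)
    · rw [sub_zero, abs_of_nonneg (by positivity)] at this
      exact this
    · rw [uIoc_of_le (by positivity)] at hr
      have hle : (2 : ℝ) * (1 / 2) ^ n ≤ 2 := by
        have : (1 / 2 : ℝ) ^ n ≤ 1 := pow_le_one₀ (by norm_num) (by norm_num)
        linarith
      have h1 : ‖truncProfile k (2 ^ n) r‖ ≤ 1 := by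
        rw [truncProfile, norm_mul, Complex.norm_real]
        have a0 := Real.smoothTransition.nonneg (2 - (2 ^ n * r) ^ 2)
        have a1 := Real.smoothTransition.le_one (2 - (2 ^ n * r) ^ 2)
        refine mul_le_one₀ ?_ (norm_nonneg _) (norm_waveProfile_le k r)
        rw [cutProfile, Real.norm_of_nonneg (by linarith)]
        linarith
      rw [norm_mul, Complex.norm_real, Real.norm_of_nonneg hr.1.le]
      have := hr.2
      calc r * _ ≤ 2 * 1 := by gcongr; linarith
        _ = 2 := by norm_num
  have hrc : Tendsto (fun n : ℕ => ((2 * (1 / 2) ^ n : ℝ) : ℂ)) atTop (𝓝 0) := by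
    have := (Complex.continuous_ofReal.tendsto 0).comp hr
    simpa [Function.comp_def] using this
  have hlim := (((hrc.mul_const (-Complex.I * k)).sub_const 1).mul
    ((hcp.tendsto 0).comp hr)).add (hsmall.const_mul ((k : ℂ) ^ 2))
  have hlim2 := hlim.const_mul (4 * Real.pi : ℂ)
  have hval : 4 * (Real.pi : ℂ) * ((0 * (-Complex.I * k) - 1) * waveProfile k 0 + k ^ 2 * 0) = -1 := by
    have : (Real.pi : ℂ) ≠ 0 := by exact_mod_cast Real.pi_ne_zero
    simp [waveProfile]
    field_simp
  rw [hval] at hlim2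
  refine hlim2.congr fun n => ?_
  rw [integral_defect, key]
  rfl

lemma pderList_add {f g : E3 → ℂ} (hf : ContDiff ℝ ∞ f) (hg : ContDiff ℝ ∞ g)
    (l : List (Fin 3)) :
    pderList l (fun x => f x + g x) = fun x => pderList l f x + pderList l g x := by
  induction l with
  | nil => rfl
  | cons i l ih =>
    rw [pderList_cons, ih]
    funext x
    exact pder_add ((contDiff_infty_pderList hf l).differentiable (by simp) x)
      ((contDiff_infty_pderList hg l).differentiable (by simp) x) i

lemma SmoothBdd.add {f g : E3 → ℂ} (hf : SmoothBdd f) (hg : SmoothBdd g) :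
    SmoothBdd fun x => f x + g x := by
  refine ⟨hf.smooth.add hg.smooth, fun l => ?_⟩
  obtain ⟨B, hB⟩ := hf.bdd l
  obtain ⟨C, hC⟩ := hg.bdd l
  refine ⟨B + C, fun x => ?_⟩
  rw [pderList_add hf.smooth hg.smooth]
  exact (norm_add_le _ _).trans (add_le_add (hB x) (hC x))

lemma truncKernel_succ (k : ℝ) (n : ℕ) :
    truncKernel k (n + 1) = fun x => truncKernel k n x + piece k (n + 1) x := by
  funext x
  simp [piece]

lemma smoothBdd_truncKernel (k : ℝ) (n : ℕ) : SmoothBdd (truncKernel k n) := by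
  induction n with
  | zero => exact smoothBdd_truncKernel_zero k
  | succ n ih =>
    rw [truncKernel_succ]
    exact ih.add (smoothBdd_piece k _)

lemma conv_pderList_truncKernel {F : E3 → ℂ} (hF : Integrable F) (k : ℝ) (l : List (Fin 3))
    (n : ℕ) (x : E3) : conv (pderList l (truncKernel k n)) F x =
      ∑ j ∈ Finset.range (n + 1), conv (pderList l (piece k j)) F x := by
  induction n with
  | zero => simp [piece]
  | succ n ih =>
    rw [Finset.sum_range_succ, ← ih, truncKernel_succ,
      pderList_add (contDiff_truncKernel k n) (contDiff_piece k _)]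
    obtain ⟨B, hB⟩ := (smoothBdd_truncKernel k n).bdd l
    obtain ⟨C, hC⟩ := (smoothBdd_piece k (n + 1)).bdd l
    unfold conv
    rw [← integral_add
      (integrable_kernel_mul ((smoothBdd_truncKernel k n).pderList l).smooth.continuous hB hF x)
      (integrable_kernel_mul ((smoothBdd_piece k (n + 1)).pderList l).smooth.continuous hC hF x)]
    simp only [add_mul]

lemma conv_defect {F : E3 → ℂ} (hF : Integrable F) (k : ℝ) (n : ℕ) (x : E3) :
    conv (defect k n) F x =
      ∑ i : Fin 3, conv (pderList [i, i] (truncKernel k n)) F x +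
        k ^ 2 * conv (truncKernel k n) F x := by
  have hi : ∀ l, Integrable fun y => pderList l (truncKernel k n) (x - y) * F y := fun l => by
    obtain ⟨B, hB⟩ := (smoothBdd_truncKernel k n).bdd l
    exact integrable_kernel_mul ((smoothBdd_truncKernel k n).pderList l).smooth.continuous hB hF x
  have h0 : Integrable fun y => truncKernel k n (x - y) * F y := hi []
  unfold conv
  rw [← integral_const_mul, ← integral_finsetSum _ fun i _ => hi [i, i],
    ← integral_add (integrable_finsetSum _ fun i _ => hi [i, i]) (h0.const_mul _)]
  refine integral_congr_ae (Eventually.of_forall fun y => ?_)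
  simp only [defect, lap, add_mul, Finset.sum_mul, mul_assoc]
  rfl

/-- the volume potential of a Hölder source solves the Helmholtz equation. -/
lemma helmholtz_potential {k M A H α : ℝ} {F : E3 → ℂ} (hα : α ∈ Ioo (0 : ℝ) 1) (hk : 0 ≤ k)
    (hM : 0 ≤ M) (hF : IsSource M A F) (hH : 0 ≤ H)
    (hHol : ∀ x y, ‖F x - F y‖ ≤ H * ‖x - y‖ ^ α) (x : E3) :
    lap (conv (helm k) F) x + k ^ 2 * conv (helm k) F x = -F x := by
  obtain ⟨C, hC, h⟩ := exists_schauder_potential hα hk hM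
  obtain ⟨-, hpp, hsum, -⟩ := h F A H hF hH hHol
  have t1 : Tendsto (fun n => conv (defect k n) F x) atTop
      (𝓝 (lap (conv (helm k) F) x + k ^ 2 * conv (helm k) F x)) := by
    have a1 : ∀ i : Fin 3, Tendsto (fun n => conv (pderList [i, i] (truncKernel k n)) F x) atTop
        (𝓝 (pder i (pder i (conv (helm k) F)) x)) := by
      intro i
      rw [hpp i i]
      refine (((hsum i i x).hasSum.tendsto_sum_nat).comp (tendsto_add_atTop_nat 1)).congr
        fun n => ?_
      rw [conv_pderList_truncKernel hF.integrable]
      rfl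
    refine ((tendsto_finsetSum _ fun i _ => a1 i).add
      ((hF.tendsto_conv_truncKernel k x).const_mul _)).congr fun n => ?_
    rw [conv_defect hF.integrable]
  have t2 : Tendsto (fun n => conv (defect k n) F x) atTop (𝓝 (-F x)) := by
    obtain ⟨D, hD, hDb⟩ := exists_bound_defect hk
    obtain ⟨hs1, hs2⟩ := half_rpow_bounds hα
    have b1 : Tendsto (fun n => conv (defect k n) F x - (∫ z, defect k n z) * F x) atTop (𝓝 0) := by
      rw [tendsto_zero_iff_norm_tendsto_zero]
      refine squeeze_zero (fun n => norm_nonneg _) (fun n => norm_conv_sub_le_of_support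
        (r := 2 * (1 / 2 : ℝ) ^ n) (by positivity) hα.1 hF (continuous_defect k n) hHol hH (hDb n)
        (fun z hz => defect_eq_zero hz) x) ?_
      have g : Tendsto (fun n : ℕ => D * H * 2 ^ α * 8 * ballVol * ((1 / 2 : ℝ) ^ α) ^ n) atTop
          (𝓝 0) := by
        have := (tendsto_pow_atTop_nhds_zero_of_lt_one (by linarith) hs2).const_mul
          (D * H * 2 ^ α * 8 * ballVol)
        simpa using this
      refine g.congr fun n => ?_
      have e0 : (2 * (1 / 2 : ℝ) ^ n) ^ α = 2 ^ α * ((1 / 2 : ℝ) ^ α) ^ n := by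
        rw [Real.mul_rpow (by norm_num) (by positivity), ← Real.rpow_natCast,
          ← Real.rpow_natCast, ← Real.rpow_mul (by norm_num), ← Real.rpow_mul (by norm_num),
          mul_comm α]
      have e8 : ((1 / 2 : ℝ) ^ n) ^ 3 * (2 ^ n) ^ 3 = 1 := by
        rw [← mul_pow, ← mul_pow]
        norm_num
      rw [e0]
      linear_combination (-(D * H * 2 ^ α * 8 * ballVol * ((1 / 2 : ℝ) ^ α) ^ n)) * e8
    have b2 := b1.add ((tendsto_integral_defect k).mul_const (F x))
    simpa using b2
  exact tendsto_nhds_unique t1 t2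

/-- splitting off the first coordinate of `ℝ³`. -/
def splitFirst : E3 ≃ᵐ ℝ × EuclideanSpace ℝ (Fin 2) :=
  ((MeasurableEquiv.toLp 2 (Fin 3 → ℝ)).symm.trans
    (MeasurableEquiv.piFinSuccAbove (fun _ => ℝ) 0)).trans
    (MeasurableEquiv.prodCongr (MeasurableEquiv.refl ℝ) (MeasurableEquiv.toLp 2 (Fin 2 → ℝ)))

lemma measurePreserving_splitFirst :
    MeasurePreserving splitFirst volume (volume.prod volume) := by
  refine MeasurePreserving.trans (μb := volume) (MeasurePreserving.trans (μb := volume)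
    (EuclideanSpace.volume_preserving_symm_measurableEquiv_toLp (Fin 3))
    (volume_preserving_piFinSuccAbove (fun _ => ℝ) 0)) ?_
  exact (MeasurePreserving.id volume).prod
    (EuclideanSpace.volume_preserving_symm_measurableEquiv_toLp (Fin 2)).symm

lemma splitFirst_fst (ξ : E3) : (splitFirst ξ).1 = ξ 0 := rfl

lemma norm_sq_splitFirst (ξ : E3) : (splitFirst ξ).1 ^ 2 + ‖(splitFirst ξ).2‖ ^ 2 = ‖ξ‖ ^ 2 := by
  rw [EuclideanSpace.norm_sq_eq, EuclideanSpace.norm_sq_eq, Fin.sum_univ_three, Fin.sum_univ_two]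
  simp only [Real.norm_eq_abs, sq_abs]
  have h0 : (splitFirst ξ).2 0 = ξ 1 := rfl
  have h1 : (splitFirst ξ).2 1 = ξ 2 := rfl
  rw [h0, h1, splitFirst_fst]
  ring

lemma integral_ball_coord {R : ℝ} (hR : 0 < R) {φ : ℝ → ℂ} (hφ : Continuous φ) :
    ∫ ξ in Metric.ball (0 : E3) R, φ (ξ 0) =
      ∫ s in -R..R, (Real.pi * (R ^ 2 - s ^ 2) : ℂ) * φ s := by
  set G : ℝ × EuclideanSpace ℝ (Fin 2) → ℂ :=
    {p : ℝ × EuclideanSpace ℝ (Fin 2) | p.1 ^ 2 + ‖p.2‖ ^ 2 < R ^ 2}.indicator fun p => φ p.1 with hG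
  have hGc : ∀ ξ, G (splitFirst ξ) = (Metric.ball (0 : E3) R).indicator (fun ξ => φ (ξ 0)) ξ := by
    intro ξ
    rw [hG]
    by_cases h : ‖ξ‖ < R
    · rw [indicator_of_mem, indicator_of_mem]
      · rfl
      · simpa using h
      · change (splitFirst ξ).1 ^ 2 + ‖(splitFirst ξ).2‖ ^ 2 < R ^ 2
        rw [norm_sq_splitFirst]
        gcongr
    · rw [indicator_of_notMem, indicator_of_notMem]
      · simpa using h
      · change ¬ ((splitFirst ξ).1 ^ 2 + ‖(splitFirst ξ).2‖ ^ 2 < R ^ 2)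
        rw [norm_sq_splitFirst, not_lt]
        rw [not_lt] at h
        gcongr
  have hint : Integrable ((Metric.ball (0 : E3) R).indicator (fun ξ : E3 => φ (ξ 0))) := by
    rw [integrable_indicator_iff measurableSet_ball]
    have : ContinuousOn (fun ξ : E3 => φ (ξ 0)) (Metric.closedBall 0 R) := by fun_prop
    exact (this.integrableOn_compact (isCompact_closedBall _ _)).mono_set Metric.ball_subset_closedBall
  have hGint : Integrable G (volume.prod volume) := by
    rw [← measurePreserving_splitFirst.integrable_comp_emb splitFirst.measurableEmbedding]
    exact hint.congr (Eventually.of_forall fun ξ => (hGc ξ).symm)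
  have hslice : ∀ s : ℝ, ∫ η, G (s, η) =
      (Ioc (-R) R).indicator (fun s : ℝ => (Real.pi * (R ^ 2 - s ^ 2) : ℂ) * φ s) s := by
    intro s
    by_cases hs : s ^ 2 < R ^ 2
    · have hs2 := abs_lt.1 (abs_lt_of_sq_lt_sq hs hR.le)
      have hmem : s ∈ Ioc (-R) R := ⟨hs2.1, hs2.2.le⟩
      rw [indicator_of_mem hmem]
      have h1 : (fun η => G (s, η)) =
          (Metric.ball (0 : EuclideanSpace ℝ (Fin 2)) (√(R ^ 2 - s ^ 2))).indicator fun _ => φ s := by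
        funext η
        have : (s, η) ∈ {p : ℝ × EuclideanSpace ℝ (Fin 2) | p.1 ^ 2 + ‖p.2‖ ^ 2 < R ^ 2} ↔
            η ∈ Metric.ball (0 : EuclideanSpace ℝ (Fin 2)) (√(R ^ 2 - s ^ 2)) := by
          rw [mem_ball_zero_iff, Real.lt_sqrt (norm_nonneg _)]
          change s ^ 2 + ‖η‖ ^ 2 < R ^ 2 ↔ _
          exact ⟨fun h => by linarith, fun h => by linarith⟩
        rw [hG]
        by_cases h : η ∈ Metric.ball (0 : EuclideanSpace ℝ (Fin 2)) (√(R ^ 2 - s ^ 2))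
        · rw [indicator_of_mem h, indicator_of_mem (this.2 h)]
        · rw [indicator_of_notMem h, indicator_of_notMem (fun h' => h (this.1 h'))]
      rw [h1, integral_indicator_const _ measurableSet_ball, measureReal_def,
        EuclideanSpace.volume_ball_fin_two, ← ENNReal.ofReal_pow (Real.sqrt_nonneg _),
        Real.sq_sqrt (by linarith), ENNReal.toReal_mul, ENNReal.toReal_ofReal (by linarith),
        ENNReal.toReal_ofReal Real.pi_pos.le, Complex.real_smul]
      push_cast
      ring
    · have h1 : (fun η => G (s, η)) = 0 := by
        funext η
        refine indicator_of_notMem ?_ _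
        change ¬ (s ^ 2 + ‖η‖ ^ 2 < R ^ 2)
        have := sq_nonneg ‖η‖
        linarith
      have h2 : ∫ η, G (s, η) = 0 := by
        rw [h1]
        exact integral_zero _ _
      rw [h2]
      by_cases hs2 : s ∈ Ioc (-R) R
      · rw [indicator_of_mem hs2]
        have : s = R := by
          obtain ⟨ha, hb⟩ := hs2
          nlinarith
        rw [this]
        simp
      · rw [indicator_of_notMem hs2]
  calc ∫ ξ in Metric.ball (0 : E3) R, φ (ξ 0)
      = ∫ ξ, G (splitFirst ξ) := by
        rw [← integral_indicator measurableSet_ball]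
        exact integral_congr_ae (Eventually.of_forall fun ξ => (hGc ξ).symm)
    _ = ∫ p, G p ∂(volume.prod volume) :=
        measurePreserving_splitFirst.integral_comp splitFirst.measurableEmbedding G
    _ = ∫ s, ∫ η, G (s, η) := integral_prod _ hGint
    _ = _ := by
        simp_rw [hslice]
        rw [integral_indicator measurableSet_Ioc, intervalIntegral.integral_of_le (by linarith)]

lemma exists_linearIsometryEquiv_axis (z : E3) :
    ∃ Q : E3 ≃ₗᵢ[ℝ] E3, ∀ ξ, inner ℝ (Q ξ) z = ‖z‖ * ξ 0 := by
  have hn : ‖‖z‖ • e3 0‖ = ‖z‖ := by rw [norm_smul, norm_e3]; simp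
  refine ⟨(Submodule.span ℝ {z - ‖z‖ • e3 0})ᗮ.reflection, fun ξ => ?_⟩
  have h1 := Submodule.reflection_sub (F := E3) (v := z) (w := ‖z‖ • e3 0) hn.symm
  have h3 := congrArg (Submodule.span ℝ {z - ‖z‖ • e3 0})ᗮ.reflection h1
  rw [Submodule.reflection_reflection] at h3
  calc inner ℝ ((Submodule.span ℝ {z - ‖z‖ • e3 0})ᗮ.reflection ξ) z
      = inner ℝ ((Submodule.span ℝ {z - ‖z‖ • e3 0})ᗮ.reflection ξ)
        ((Submodule.span ℝ {z - ‖z‖ • e3 0})ᗮ.reflection (‖z‖ • e3 0)) := by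
        rw [← h3]
    _ = inner ℝ ξ (‖z‖ • e3 0) := LinearIsometryEquiv.inner_map_map _ _ _
    _ = _ := by
      rw [inner_smul_right, e3, EuclideanSpace.inner_single_right]
      simp

lemma integral_ball_exp_inner {R : ℝ} (hR : 0 < R) (z : E3) :
    ∫ ξ in Metric.ball (0 : E3) R, Complex.exp (Complex.I * (inner ℝ ξ z : ℝ)) =
      ∫ s in -R..R, (Real.pi * (R ^ 2 - s ^ 2) : ℂ) * Complex.exp (Complex.I * (‖z‖ * s : ℝ)) := by
  obtain ⟨Q, hQ⟩ := exists_linearIsometryEquiv_axis z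
  rw [← integral_ball_coord hR (φ := fun s => Complex.exp (Complex.I * (‖z‖ * s : ℝ))) (by fun_prop)]
  rw [← integral_indicator measurableSet_ball, ← integral_indicator measurableSet_ball,
    ← Q.measurePreserving.integral_comp Q.toHomeomorph.measurableEmbedding]
  congr 1
  funext ξ
  by_cases h : ‖ξ‖ < R
  · rw [indicator_of_mem (by simpa using h), indicator_of_mem (by simpa using h), hQ]
  · rw [indicator_of_notMem (by simpa using h), indicator_of_notMem (by simpa using h)]

lemma integral_ball_polar {R : ℝ} (hR : 0 < R) {φ : E3 → ℂ} (hφ : Continuous φ) :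
    ∫ ξ in Metric.ball (0 : E3) R, φ ξ =
      ∫ r in (0 : ℝ)..R, (r : ℂ) ^ 2 *
        ∫ w : Metric.sphere (0 : E3) 1, φ (r • (w : E3)) ∂(volume : Measure E3).toSphere := by
  set G : Metric.sphere (0 : E3) 1 × Ioi (0 : ℝ) → ℂ := fun p =>
    if (p.2 : ℝ) < R then φ ((p.2 : ℝ) • (p.1 : E3)) else 0 with hG
  have hmp := (volume : Measure E3).measurePreserving_homeomorphUnitSphereProd
  have hemb := (homeomorphUnitSphereProd E3).measurableEmbedding
  have hGc : ∀ ξ : ({(0)}ᶜ : Set E3), G (homeomorphUnitSphereProd E3 ξ) =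
      (Metric.ball (0 : E3) R).indicator φ ξ := by
    intro ξ
    have hξ : (ξ : E3) ≠ 0 := ξ.2
    rw [hG]
    simp only [homeomorphUnitSphereProd_apply_snd_coe, homeomorphUnitSphereProd_apply_fst_coe]
    rw [smul_inv_smul₀ (norm_ne_zero_iff.2 hξ)]
    by_cases h : ‖(ξ : E3)‖ < R
    · rw [if_pos h, indicator_of_mem (by simpa using h)]
    · rw [if_neg h, indicator_of_notMem (by simpa using h)]
  have hint : Integrable ((Metric.ball (0 : E3) R).indicator φ) := by
    rw [integrable_indicator_iff measurableSet_ball]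
    exact (hφ.continuousOn.integrableOn_compact (isCompact_closedBall _ _)).mono_set
      Metric.ball_subset_closedBall
  have hGint : Integrable G ((volume : Measure E3).toSphere.prod
      (.volumeIoiPow (Module.finrank ℝ E3 - 1))) := by
    rw [← hmp.integrable_comp_emb hemb]
    have h1 : Integrable (fun ξ : ({(0)}ᶜ : Set E3) => (Metric.ball (0 : E3) R).indicator φ ξ)
        ((volume : Measure E3).comap (↑)) :=
      (integrableOn_iff_comap_subtypeVal (measurableSet_singleton _).compl).1 hint.integrableOn
    exact h1.congr (Eventually.of_forall fun ξ => (hGc ξ).symm)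
  have hinner : ∀ r : Ioi (0 : ℝ), ∫ w, G (w, r) ∂(volume : Measure E3).toSphere =
      (Iio R).indicator (fun r : ℝ => ∫ w : Metric.sphere (0 : E3) 1, φ (r • (w : E3))
        ∂(volume : Measure E3).toSphere) r := by
    intro r
    rw [hG]
    by_cases h : (r : ℝ) < R
    · simp only [h, if_true]
      rw [indicator_of_mem (mem_Iio.2 h)]
    · simp only [h, if_false, integral_zero]
      rw [indicator_of_notMem (mt mem_Iio.1 h)]
  calc ∫ ξ in Metric.ball (0 : E3) R, φ ξ
      = ∫ ξ : ({(0)}ᶜ : Set E3), (Metric.ball (0 : E3) R).indicator φ ξ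
          ∂((volume : Measure E3).comap (↑)) := by
        rw [integral_subtype_comap (measurableSet_singleton _).compl,
          restrict_compl_singleton, integral_indicator measurableSet_ball]
    _ = ∫ ξ : ({(0)}ᶜ : Set E3), G (homeomorphUnitSphereProd E3 ξ)
          ∂((volume : Measure E3).comap (↑)) :=
        integral_congr_ae (Eventually.of_forall fun ξ => (hGc ξ).symm)
    _ = ∫ p, G p ∂((volume : Measure E3).toSphere.prod
          (.volumeIoiPow (Module.finrank ℝ E3 - 1))) := hmp.integral_comp hemb G
    _ = ∫ r, ∫ w, G (w, r) ∂(volume : Measure E3).toSphere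
          ∂(.volumeIoiPow (Module.finrank ℝ E3 - 1)) := integral_prod_symm _ hGint
    _ = _ := by
      simp_rw [hinner]
      simp only [Measure.volumeIoiPow, ENNReal.ofReal]
      rw [integral_withDensity_eq_integral_smul
        ((measurable_subtype_coe.pow_const _).real_toNNReal),
        integral_subtype_comap measurableSet_Ioi fun a : ℝ ↦
          Real.toNNReal (a ^ (Module.finrank ℝ E3 - 1)) • (Iio R).indicator (fun r : ℝ =>
            ∫ w : Metric.sphere (0 : E3) 1, φ (r • (w : E3))
              ∂(volume : Measure E3).toSphere) a,
        intervalIntegral.integral_of_le hR.le, integral_Ioc_eq_integral_Ioo]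
      have : ∀ a : ℝ, a ∈ Ioi (0 : ℝ) → Real.toNNReal (a ^ (Module.finrank ℝ E3 - 1)) •
          (Iio R).indicator (fun r : ℝ => ∫ w : Metric.sphere (0 : E3) 1, φ (r • (w : E3))
              ∂(volume : Measure E3).toSphere) a =
          (Iio R).indicator (fun r : ℝ => (r : ℂ) ^ 2 * ∫ w : Metric.sphere (0 : E3) 1,
            φ (r • (w : E3)) ∂(volume : Measure E3).toSphere) a := by
        intro a ha
        by_cases h : a < R
        · rw [indicator_of_mem (mem_Iio.2 h), indicator_of_mem (mem_Iio.2 h), NNReal.smul_def,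
            Real.coe_toNNReal _ (pow_nonneg (le_of_lt ha) _), Complex.real_smul,
            finrank_euclideanSpace_fin]
          push_cast
          rfl
        · rw [indicator_of_notMem (mt mem_Iio.1 h), indicator_of_notMem (mt mem_Iio.1 h), smul_zero]
      rw [setIntegral_congr_fun measurableSet_Ioi this, setIntegral_indicator measurableSet_Iio,
        Ioi_inter_Iio]

lemma hasDerivAt_integral_sub_sq {φ : ℝ → ℂ} (hφ : Continuous φ) (R : ℝ) :
    HasDerivAt (fun R : ℝ => ∫ s in -R..R, (Real.pi * (R ^ 2 - s ^ 2) : ℂ) * φ s)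
      (2 * Real.pi * R * ∫ s in -R..R, φ s) R := by
  have key : ∀ ψ : ℝ → ℂ, Continuous ψ →
      HasDerivAt (fun R : ℝ => ∫ s in -R..R, ψ s) (ψ R + ψ (-R)) R := by
    intro ψ hψ
    have h0 : ∀ b : ℝ, HasDerivAt (fun R : ℝ => ∫ s in (0 : ℝ)..R, ψ s) (ψ b) b := fun b =>
      intervalIntegral.integral_hasDerivAt_right (hψ.intervalIntegrable _ _)
        (hψ.stronglyMeasurableAtFilter _ _) hψ.continuousAt
    have h1 := (h0 R).sub ((h0 (-R)).scomp R (hasDerivAt_neg R))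
    have heq : (fun R : ℝ => ∫ s in -R..R, ψ s) = (fun R : ℝ => ∫ s in (0 : ℝ)..R, ψ s) -
        (fun R : ℝ => ∫ s in (0 : ℝ)..R, ψ s) ∘ Neg.neg := by
      funext r
      simp only [Pi.sub_apply, Function.comp]
      rw [intervalIntegral.integral_interval_sub_left (hψ.intervalIntegrable _ _)
        (hψ.intervalIntegrable _ _)]
    rw [heq]
    refine h1.congr_deriv ?_
    rw [neg_smul, one_smul, sub_neg_eq_add]
  have hsplit : (fun R : ℝ => ∫ s in -R..R, (Real.pi * (R ^ 2 - s ^ 2) : ℂ) * φ s) =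
      fun R : ℝ => (Real.pi : ℂ) * ((R : ℂ) ^ 2 * ∫ s in -R..R, φ s) -
        Real.pi * ∫ s in -R..R, (s : ℂ) ^ 2 * φ s := by
    funext r
    rw [← intervalIntegral.integral_const_mul, ← intervalIntegral.integral_const_mul,
      ← intervalIntegral.integral_const_mul, ← intervalIntegral.integral_sub]
    · congr 1
      funext s
      ring
    · exact Continuous.intervalIntegrable (by fun_prop) _ _
    · exact Continuous.intervalIntegrable (by fun_prop) _ _
  rw [hsplit]
  have hsq : HasDerivAt (fun R : ℝ => (R : ℂ) ^ 2) (2 * R) R := by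
    have := (hasDerivAt_pow 2 R).ofReal_comp
    simpa using this
  have h1 := ((hsq.mul (key φ hφ)).const_mul (Real.pi : ℂ)).sub
    ((key (fun s => (s : ℂ) ^ 2 * φ s) (by fun_prop)).const_mul (Real.pi : ℂ))
  refine h1.congr_deriv ?_
  push_cast
  ring

lemma continuous_sphere_integral {φ : E3 → ℂ} (hφ : Continuous φ) :
    Continuous fun r : ℝ => ∫ w : Metric.sphere (0 : E3) 1, φ (r • (w : E3))
      ∂(volume : Measure E3).toSphere := by
  have := continuous_parametric_integral_of_continuous (μ := (volume : Measure E3).toSphere)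
    (f := fun (r : ℝ) (w : Metric.sphere (0 : E3) 1) => φ (r • (w : E3))) (by fun_prop)
    (isCompact_univ)
  simpa using this

lemma integral_sphere_exp_inner {k : ℝ} (hk : 0 < k) {z : E3} (hz : z ≠ 0) :
    ∫ w : Metric.sphere (0 : E3) 1, Complex.exp (Complex.I * (inner ℝ (k • (w : E3)) z : ℝ))
      ∂(volume : Measure E3).toSphere = 4 * Real.pi * Real.sin (k * ‖z‖) / (k * ‖z‖) := by
  set φ : E3 → ℂ := fun ξ => Complex.exp (Complex.I * (inner ℝ ξ z : ℝ)) with hφ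
  have hφc : Continuous φ := by
    rw [hφ]
    fun_prop
  set g : ℝ → ℂ := fun r => ∫ w : Metric.sphere (0 : E3) 1, φ (r • (w : E3))
      ∂(volume : Measure E3).toSphere with hg
  have hgc : Continuous g := continuous_sphere_integral hφc
  have hd1 : HasDerivAt (fun R : ℝ => ∫ r in (0 : ℝ)..R, (r : ℂ) ^ 2 * g r) ((k : ℂ) ^ 2 * g k) k := by
    have hc : Continuous fun r : ℝ => (r : ℂ) ^ 2 * g r := by fun_prop
    exact intervalIntegral.integral_hasDerivAt_right (hc.intervalIntegrable _ _)
        (hc.stronglyMeasurableAtFilter _ _) hc.continuousAt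
  have hd2 := hasDerivAt_integral_sub_sq (φ := fun s => Complex.exp (Complex.I * (‖z‖ * s : ℝ)))
    (by fun_prop) k
  have heq : (fun R : ℝ => ∫ r in (0 : ℝ)..R, (r : ℂ) ^ 2 * g r) =ᶠ[𝓝 k] fun R : ℝ =>
      ∫ s in -R..R, (Real.pi * (R ^ 2 - s ^ 2) : ℂ) * Complex.exp (Complex.I * (‖z‖ * s : ℝ)) := by
    filter_upwards [lt_mem_nhds hk] with R hR
    rw [← integral_ball_exp_inner hR, integral_ball_polar hR hφc]
  have huniq := (hd2.congr_of_eventuallyEq heq).unique hd1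
  have hzn : (‖z‖ : ℂ) ≠ 0 := by exact_mod_cast norm_ne_zero_iff.2 hz
  have hkc : (k : ℂ) ≠ 0 := by exact_mod_cast hk.ne'
  have hexp : ∫ s in -k..k, Complex.exp (Complex.I * (‖z‖ * s : ℝ)) =
      2 * Real.sin (k * ‖z‖) / ‖z‖ := by
    have h1 : (fun s : ℝ => Complex.exp (Complex.I * (‖z‖ * s : ℝ))) =
        fun s : ℝ => Complex.exp ((Complex.I * ‖z‖) * s) := by
      funext s
      push_cast
      rw [mul_assoc]
    rw [h1, integral_exp_mul_complex (mul_ne_zero Complex.I_ne_zero hzn), Complex.ofReal_sin,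
      Complex.sin]
    have hI := Complex.I_sq
    push_cast
    field_simp
    rw [show Complex.I * (‖z‖ : ℂ) * k = k * ‖z‖ * Complex.I by ring, hI]
    ring
  rw [hexp] at huniq
  change g k = _
  have h2 : (k : ℂ) ^ 2 * g k = (k : ℂ) ^ 2 *
      (4 * Real.pi * Real.sin (k * ‖z‖) / (k * ‖z‖)) := by
    rw [← huniq]
    field_simp
    ring
  exact mul_left_cancel₀ (pow_ne_zero 2 hkc) h2

/-- the surface measure of the unit sphere. -/
abbrev surf : Measure (Metric.sphere (0 : E3) 1) := (volume : Measure E3).toSphere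

/-- plane wave with wave vector `k w`. -/
def pw (k : ℝ) (w : Metric.sphere (0 : E3) 1) (z : E3) : ℂ :=
  Complex.exp (Complex.I * (inner ℝ (k • (w : E3)) z : ℝ))

lemma norm_pw (k : ℝ) (w : Metric.sphere (0 : E3) 1) (z : E3) : ‖pw k w z‖ = 1 := by
  rw [pw, mul_comm, Complex.norm_exp_ofReal_mul_I]

lemma pw_sub (k : ℝ) (w : Metric.sphere (0 : E3) 1) (x y : E3) :
    pw k w (x - y) = pw k w x * (starRingEnd ℂ) (pw k w y) := by
  simp only [pw]
  rw [← Complex.exp_conj, ← Complex.exp_add, inner_sub_right]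
  congr 1
  simp only [map_mul, Complex.conj_I, Complex.conj_ofReal]
  push_cast
  ring

lemma continuous_pw (k : ℝ) :
    Continuous fun p : E3 × Metric.sphere (0 : E3) 1 => pw k p.2 p.1 := by
  unfold pw
  fun_prop

lemma continuous_pw_left (k : ℝ) (z : E3) :
    Continuous fun w : Metric.sphere (0 : E3) 1 => pw k w z := by
  unfold pw
  fun_prop

lemma continuous_pw_right (k : ℝ) (w : Metric.sphere (0 : E3) 1) :
    Continuous fun z : E3 => pw k w z := by
  unfold pw
  fun_prop

lemma helm_neg (k : ℝ) (z : E3) : helm (-k) z = (starRingEnd ℂ) (helm k z) := by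
  simp only [helm]
  rw [map_div₀, ← Complex.exp_conj]
  have h4 : (starRingEnd ℂ) (4 : ℂ) = 4 := Complex.conj_ofNat 4
  simp [h4]

lemma helm_sub_helm_neg {k : ℝ} (hk : 0 < k) {z : E3} (hz : z ≠ 0) :
    helm k z - helm (-k) z = (-(Complex.I * k / (8 * Real.pi ^ 2))) * ∫ w, pw k w z ∂surf := by
  have hzn : (‖z‖ : ℂ) ≠ 0 := by exact_mod_cast norm_ne_zero_iff.2 hz
  have hkc : (k : ℂ) ≠ 0 := by exact_mod_cast hk.ne'
  have hpi : (Real.pi : ℂ) ≠ 0 := by exact_mod_cast Real.pi_ne_zero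
  have h := integral_sphere_exp_inner hk hz
  unfold pw
  rw [h, Complex.ofReal_sin, Complex.sin]
  simp only [helm]
  push_cast
  rw [show -Complex.I * (k : ℂ) * ‖z‖ = -(k * ‖z‖) * Complex.I by ring,
    show -Complex.I * -(k : ℂ) * ‖z‖ = (k * ‖z‖) * Complex.I by ring]
  have hI := Complex.I_sq
  field_simp
  rw [hI]
  ring

/-- the Fourier transform of a source on the sphere of radius `k`. -/
def sphereFourier (k : ℝ) (f : E3 → ℂ) (w : Metric.sphere (0 : E3) 1) : ℂ :=
  ∫ y, (starRingEnd ℂ) (pw k w y) * f y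

lemma continuous_sphereFourier {M A : ℝ} {f : E3 → ℂ} (hf : IsSource M A f) (k : ℝ) :
    Continuous (sphereFourier k f) := by
  refine continuous_of_dominated (bound := fun y => ‖f y‖) (fun w => ?_) (fun w => ?_)
    hf.integrable.norm ?_
  · exact (Complex.continuous_conj.comp (continuous_pw_right k w)).aestronglyMeasurable.mul hf.meas
  · refine Eventually.of_forall fun y => ?_
    rw [norm_mul, RCLike.norm_conj, norm_pw, one_mul]
  · refine Eventually.of_forall fun y => ?_
    exact (Complex.continuous_conj.comp (continuous_pw_left k y)).mul continuous_const

lemma integrable_pw_mul {M A : ℝ} {f : E3 → ℂ} (hf : IsSource M A f) (k : ℝ)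
    {g : Metric.sphere (0 : E3) 1 → ℂ} (hg : Continuous g) :
    Integrable (fun p : E3 × Metric.sphere (0 : E3) 1 => g p.2 * (pw k p.2 p.1 * f p.1))
      (volume.prod surf) := by
  have h1 : Integrable (fun p : E3 × Metric.sphere (0 : E3) 1 => f p.1) (volume.prod surf) :=
    hf.integrable.comp_fst _
  obtain ⟨C, hC⟩ := isCompact_univ.exists_bound_of_continuousOn hg.continuousOn
  have h2 := h1.bdd_mul (f := fun p : E3 × Metric.sphere (0 : E3) 1 => g p.2 * pw k p.2 p.1) (c := C)
    ((hg.comp continuous_snd).mul (continuous_pw k)).aestronglyMeasurable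
    (Eventually.of_forall fun p => by
      rw [norm_mul, norm_pw, mul_one]
      exact hC _ (mem_univ _))
  refine h2.congr (Eventually.of_forall fun p => ?_)
  simp only [mul_assoc]

lemma IsSource.conj {M A : ℝ} {f : E3 → ℂ} (hf : IsSource M A f) :
    IsSource M A fun x => (starRingEnd ℂ) (f x) where
  meas := Complex.continuous_conj.comp_aestronglyMeasurable hf.meas
  bound x := by
    rw [RCLike.norm_conj]
    exact hf.bound x
  supp x hx := by rw [hf.supp x hx, map_zero]

lemma conv_helm_sub {M A : ℝ} {f : E3 → ℂ} (hf : IsSource M A f) {k : ℝ} (hk : 0 < k) (x : E3) :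
    conv (helm k) f x - conv (helm (-k)) f x = (-(Complex.I * k / (8 * Real.pi ^ 2))) *
      ∫ w, pw k w x * sphereFourier k f w ∂surf := by
  have h0 : ∀ᵐ y : E3, y ≠ x := by
    rw [ae_iff]
    simp
  simp only [conv]
  rw [← integral_sub (hf.integrable_helm_mul k x) (hf.integrable_helm_mul (-k) x)]
  have h1 : ∫ y, helm k (x - y) * f y - helm (-k) (x - y) * f y =
      ∫ y, (-(Complex.I * k / (8 * Real.pi ^ 2))) *
        ∫ w, pw k w x * ((starRingEnd ℂ) (pw k w y) * f y) ∂surf := by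
    refine integral_congr_ae ?_
    filter_upwards [h0] with y hy
    rw [← sub_mul, helm_sub_helm_neg hk (sub_ne_zero.2 hy.symm), mul_assoc, ← integral_mul_const]
    simp only [pw_sub, mul_assoc]
  rw [h1, integral_const_mul]
  congr 1
  have hint : Integrable (Function.uncurry fun (y : E3) (w : Metric.sphere (0 : E3) 1) =>
      pw k w x * ((starRingEnd ℂ) (pw k w y) * f y)) (volume.prod surf) := by
    have h2 := integrable_pw_mul hf.conj k (g := fun w => (starRingEnd ℂ) (pw k w x))
      (Complex.continuous_conj.comp (continuous_pw_left k x))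
    refine (Complex.conjCLE.toContinuousLinearMap.integrable_comp h2).congr
      (Eventually.of_forall fun p => ?_)
    simp [Function.uncurry]
  rw [integral_integral_swap hint]
  congr 1
  funext w
  rw [integral_const_mul]
  rfl

lemma integral_conj_mul_conv_helm_sub {M A : ℝ} {f : E3 → ℂ} (hf : IsSource M A f) {k : ℝ} :
    ∫ x, (starRingEnd ℂ) (f x) * ∫ w, pw k w x * sphereFourier k f w ∂surf =
      ((∫ w, ‖sphereFourier k f w‖ ^ 2 ∂surf : ℝ) : ℂ) := by
  have hint : Integrable (Function.uncurry fun (x : E3) (w : Metric.sphere (0 : E3) 1) =>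
      (starRingEnd ℂ) (f x) * (pw k w x * sphereFourier k f w)) (volume.prod surf) := by
    refine (integrable_pw_mul hf.conj k (continuous_sphereFourier hf k)).congr
      (Eventually.of_forall fun p => ?_)
    simp only [Function.uncurry]
    ring
  calc ∫ x, (starRingEnd ℂ) (f x) * ∫ w, pw k w x * sphereFourier k f w ∂surf
      = ∫ x, ∫ w, (starRingEnd ℂ) (f x) * (pw k w x * sphereFourier k f w) ∂surf := by
        simp only [integral_const_mul]
    _ = ∫ w, ∫ x, (starRingEnd ℂ) (f x) * (pw k w x * sphereFourier k f w) ∂volume ∂surf :=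
        integral_integral_swap hint
    _ = ∫ w, ((‖sphereFourier k f w‖ ^ 2 : ℝ) : ℂ) ∂surf := by
        congr 1
        funext w
        have h1 : ∀ x, (starRingEnd ℂ) (f x) * (pw k w x * sphereFourier k f w) =
          sphereFourier k f w * (starRingEnd ℂ) ((starRingEnd ℂ) (pw k w x) * f x) := by
          intro x
          rw [map_mul, Complex.conj_conj]
          ring
        simp only [h1]
        rw [integral_const_mul, integral_conj]
        change sphereFourier k f w * (starRingEnd ℂ) (sphereFourier k f w) = _
        rw [Complex.mul_conj, Complex.normSq_eq_norm_sq]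
    _ = _ := integral_ofReal

lemma integrable_prod_helm {M A : ℝ} {f g : E3 → ℂ} (hf : IsSource M A f) (hg : IsSource M A g)
    (k : ℝ) :
    Integrable (fun p : E3 × E3 => g p.1 * (helm k (p.1 - p.2) * f p.2)) (volume.prod volume) := by
  set hb : E3 → ℂ := (Metric.ball (0 : E3) (2 * M + 1)).indicator (helm k) with hhb
  have h1 : Integrable hb := by
    rw [hhb, integrable_indicator_iff measurableSet_ball]
    refine (integrable_inv_norm_ball (2 * M + 1)).integrableOn.mono'
      (measurable_helm k).aestronglyMeasurable ?_
    filter_upwards [ae_restrict_mem measurableSet_ball] with z hz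
    rw [if_pos (mem_ball_zero_iff.1 hz).le]
    exact norm_helm_le k z
  have h2 : Integrable (fun p : E3 × E3 => f p.2 * hb (p.1 - p.2)) (volume.prod volume) :=
    hf.integrable.convolution_integrand (ContinuousLinearMap.mul ℂ ℂ) h1
  have h3 := h2.bdd_mul (f := fun p : E3 × E3 => g p.1) (c := A) hg.meas.comp_fst
    (Eventually.of_forall fun p => hg.bound _)
  refine h3.congr (Eventually.of_forall fun p => ?_)
  simp only
  by_cases h4 : M < ‖p.1‖
  · rw [hg.supp _ h4, zero_mul, zero_mul]
  by_cases h5 : M < ‖p.2‖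
  · rw [hf.supp _ h5, zero_mul, mul_zero, mul_zero, mul_zero]
  have hmem : p.1 - p.2 ∈ Metric.ball (0 : E3) (2 * M + 1) := by
    rw [mem_ball_zero_iff]
    have := norm_sub_le p.1 p.2
    linarith
  rw [hhb, indicator_of_mem hmem]
  ring

lemma integral_conj_mul_conv_helm_neg {M A : ℝ} {f : E3 → ℂ} (hf : IsSource M A f) (k : ℝ) :
    ∫ x, (starRingEnd ℂ) (f x) * conv (helm (-k)) f x =
      (starRingEnd ℂ) (∫ x, (starRingEnd ℂ) (f x) * conv (helm k) f x) := by
  rw [← integral_conj]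
  simp only [conv, ← integral_const_mul]
  rw [integral_integral_swap (integrable_prod_helm hf hf.conj (-k))]
  congr 1
  funext y
  rw [← integral_conj]
  congr 1
  funext x
  rw [map_mul, map_mul, Complex.conj_conj, helm_neg, ← neg_sub, ← helm_neg, ← helm_neg]
  simp only [helm, norm_neg]
  ring

/-- If the energy flux of a source vanishes, then its outgoing and incoming potentials agree. -/
lemma conv_helm_eq_conv_helm_neg {M A : ℝ} {f : E3 → ℂ} (hf : IsSource M A f) {k : ℝ} (hk : 0 < k)
    (h : (∫ x, (starRingEnd ℂ) (f x) * conv (helm k) f x).im = 0) (x : E3) :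
    conv (helm k) f x = conv (helm (-k)) f x := by
  have hi : ∀ κ, Integrable fun x => (starRingEnd ℂ) (f x) * conv (helm κ) f x := by
    intro κ
    have := (integrable_prod_helm hf hf.conj κ).integral_prod_left
    simpa only [conv, integral_const_mul] using this
  have h1 : ∫ x, (starRingEnd ℂ) (f x) * (conv (helm k) f x - conv (helm (-k)) f x) = 0 := by
    simp only [mul_sub]
    rw [integral_sub (hi _) (hi _), integral_conj_mul_conv_helm_neg hf]
    rw [Complex.sub_conj, h]
    simp
  have hc : (-(Complex.I * k / (8 * Real.pi ^ 2)) : ℂ) ≠ 0 := by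
    have hkc : (k : ℂ) ≠ 0 := by exact_mod_cast hk.ne'
    have hpi : (Real.pi : ℂ) ≠ 0 := by exact_mod_cast Real.pi_ne_zero
    refine neg_ne_zero.2 (div_ne_zero (mul_ne_zero Complex.I_ne_zero hkc) ?_)
    exact mul_ne_zero (by norm_num) (pow_ne_zero _ hpi)
  simp only [conv_helm_sub hf hk] at h1
  have h2 : ∀ x, (starRingEnd ℂ) (f x) * (-(Complex.I * k / (8 * Real.pi ^ 2)) *
      ∫ w, pw k w x * sphereFourier k f w ∂surf) = -(Complex.I * k / (8 * Real.pi ^ 2)) *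
      ((starRingEnd ℂ) (f x) * ∫ w, pw k w x * sphereFourier k f w ∂surf) := fun x => by ring
  simp only [h2] at h1
  rw [integral_const_mul, integral_conj_mul_conv_helm_sub hf] at h1
  have h3 := Complex.ofReal_eq_zero.1 ((mul_eq_zero.1 h1).resolve_left hc)
  have hcont := continuous_sphereFourier hf k
  have hint : Integrable (fun w => ‖sphereFourier k f w‖ ^ 2) surf := by
    obtain ⟨C, hC⟩ := isCompact_univ.exists_bound_of_continuousOn
      (f := fun w => ‖sphereFourier k f w‖ ^ 2) (hcont.norm.pow 2).continuousOn
    exact (integrable_const C).mono' (hcont.norm.pow 2).aestronglyMeasurable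
      (Eventually.of_forall fun w => hC w (mem_univ _))
  rw [integral_eq_zero_iff_of_nonneg (fun w => by positivity) hint] at h3
  rw [← sub_eq_zero, conv_helm_sub hf hk]
  have h4 : ∫ w, pw k w x * sphereFourier k f w ∂surf = 0 := by
    rw [← integral_zero (Metric.sphere (0 : E3) 1) ℂ (μ := surf)]
    refine integral_congr_ae ?_
    filter_upwards [h3] with w hw
    have : sphereFourier k f w = 0 := by simpa using hw
    rw [this, mul_zero]
  rw [h4, mul_zero]

lemma differentiableOn_integral_mul_source {M A C δ : ℝ} {f : E3 → ℂ} (hf : IsSource M A f)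
    {G : ℂ → E3 → ℂ} (hmeas : ∀ t, Measurable (G t))
    (hdiff : ∀ y, ‖y‖ ≤ M → DifferentiableOn ℂ (fun t => G t y) (Metric.ball 0 δ))
    (hbound : ∀ y, ‖y‖ ≤ M → ∀ t ∈ Metric.ball (0 : ℂ) δ, ‖G t y‖ ≤ C) :
    DifferentiableOn ℂ (fun t => ∫ y, G t y * f y) (Metric.ball 0 δ) := by
  intro t₀ ht₀
  obtain ⟨ε, hε, hsub⟩ := Metric.isOpen_iff.1 Metric.isOpen_ball t₀ ht₀
  have hfm : ∀ t, AEStronglyMeasurable (fun y => G t y * f y) volume := fun t =>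
    (hmeas t).aestronglyMeasurable.mul hf.meas
  have hder : ∀ y, ∀ t ∈ Metric.ball (0 : ℂ) δ,
      HasDerivAt (fun t => G t y * f y) (deriv (fun t => G t y * f y) t) t := by
    intro y t ht
    refine DifferentiableAt.hasDerivAt ?_
    by_cases hy : ‖y‖ ≤ M
    · exact ((hdiff y hy).differentiableAt (Metric.isOpen_ball.mem_nhds ht)).mul_const _
    · simp [hf.supp y (not_le.1 hy)]
  have hbd : ∀ y, ∀ t ∈ Metric.ball (0 : ℂ) δ, ‖G t y * f y‖ ≤ C * ‖f y‖ := by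
    intro y t ht
    by_cases hy : ‖y‖ ≤ M
    · rw [norm_mul]
      gcongr
      exact hbound y hy t ht
    · simp [hf.supp y (not_le.1 hy)]
  have key := hasDerivAt_integral_of_dominated_loc_of_deriv_le (μ := (volume : Measure E3))
    (F := fun t y => G t y * f y)
    (F' := fun t y => deriv (fun t => G t y * f y) t) (x₀ := t₀) (s := Metric.ball t₀ (ε / 2))
    (bound := fun y => C * ‖f y‖ / (ε / 2)) (Metric.ball_mem_nhds t₀ (by positivity))
    (Eventually.of_forall hfm)
    ((hf.integrable.norm.const_mul C).mono' (hfm t₀) (Eventually.of_forall fun y => hbd y t₀ ht₀))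
    ?_ (Eventually.of_forall fun y t ht => ?_)
    ((hf.integrable.norm.const_mul C).div_const _)
    (Eventually.of_forall fun y t ht => hder y t
      (hsub (Metric.ball_subset_ball (by linarith) ht)))
  · exact key.2.differentiableAt.differentiableWithinAt
  · have hseq : Tendsto (fun n : ℕ => ((1 : ℂ) / ((n : ℂ) + 1))) atTop (𝓝[≠] 0) := by
      rw [tendsto_nhdsWithin_iff]
      refine ⟨?_, Eventually.of_forall fun n => ?_⟩
      · exact tendsto_one_div_add_atTop_nhds_zero_nat
      · have : (n : ℂ) + 1 ≠ 0 := by exact_mod_cast Nat.succ_ne_zero n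
        simpa using this
    refine aestronglyMeasurable_of_tendsto_ae atTop
      (f := fun (n : ℕ) y => ((1 : ℂ) / ((n : ℂ) + 1))⁻¹ •
        (G (t₀ + (1 : ℂ) / ((n : ℂ) + 1)) y * f y - G t₀ y * f y))
      (fun n => ((hfm (t₀ + (1 : ℂ) / ((n : ℂ) + 1))).sub (hfm t₀)).const_smul
        (((1 : ℂ) / ((n : ℂ) + 1))⁻¹)) (Eventually.of_forall fun y => ?_)
    exact ((hder y t₀ ht₀).tendsto_slope_zero).comp hseq
  · refine Complex.norm_deriv_le_of_forall_mem_sphere_norm_le (by positivity) ?_ ?_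
    · refine DifferentiableOn.diffContOnCl ?_
      rw [closure_ball _ (by positivity)]
      intro s hs
      refine (hder y s (hsub ?_)).differentiableAt.differentiableWithinAt
      rw [mem_closedBall_iff_norm] at hs
      rw [mem_ball_iff_norm] at ht ⊢
      calc ‖s - t₀‖ = ‖(s - t) + (t - t₀)‖ := by ring_nf
        _ ≤ _ := norm_add_le _ _
        _ < ε := by linarith
    · intro s hs
      refine hbd y s (hsub ?_)
      rw [mem_sphere_iff_norm] at hs
      rw [mem_ball_iff_norm] at ht ⊢
      calc ‖s - t₀‖ = ‖(s - t) + (t - t₀)‖ := by ring_nf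
        _ ≤ _ := norm_add_le _ _
        _ < ε := by linarith

/-- relative increment of the squared distance along a ray, at inverse distance `t`. -/
def rayInc (e y : E3) (t : ℂ) : ℂ := -2 * t * (inner ℝ e y : ℝ) + t ^ 2 * (‖y‖ ^ 2 : ℝ)

/-- relative distance along a ray. -/
def rayDist (e y : E3) (t : ℂ) : ℂ := Complex.exp (Complex.log (1 + rayInc e y t) / 2)

/-- path difference along a ray. -/
def rayPhase (e y : E3) (t : ℂ) : ℂ :=
  (-2 * (inner ℝ e y : ℝ) + t * (‖y‖ ^ 2 : ℝ)) / (rayDist e y t + 1)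

/-- amplitude of the fundamental solution along a ray. -/
def rayKernel (e : E3) (κ : ℝ) (t : ℂ) (y : E3) : ℂ :=
  Complex.exp (-Complex.I * κ * rayPhase e y t) / (4 * Real.pi * rayDist e y t)

lemma measurable_rayKernel (e : E3) (κ : ℝ) (t : ℂ) : Measurable (rayKernel e κ t) := by
  unfold rayKernel rayPhase rayDist rayInc
  fun_prop

lemma norm_rayInc_le {e y : E3} (he : ‖e‖ = 1) {M : ℝ} (hy : ‖y‖ ≤ M) {t : ℂ}
    (ht : t ∈ Metric.ball (0 : ℂ) (1 / (4 * (M + 1)))) : ‖rayInc e y t‖ ≤ 3 / 4 := by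
  have hM : 0 ≤ M := (norm_nonneg y).trans hy
  rw [mem_ball_zero_iff, lt_div_iff₀ (by positivity)] at ht
  have hin : |inner ℝ e y| ≤ ‖y‖ := by
    have := abs_real_inner_le_norm e y
    rwa [he, one_mul] at this
  have h1 : ‖t‖ * ‖y‖ ≤ 1 / 4 := by
    have : ‖t‖ * ‖y‖ ≤ ‖t‖ * (M + 1) := by gcongr; linarith
    linarith
  calc ‖rayInc e y t‖ ≤ ‖-2 * t * (inner ℝ e y : ℝ)‖ + ‖t ^ 2 * (‖y‖ ^ 2 : ℝ)‖ := norm_add_le _ _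
    _ = 2 * ‖t‖ * |inner ℝ e y| + (‖t‖ * ‖y‖) ^ 2 := by
      simp [mul_pow]
    _ ≤ 2 * ‖t‖ * ‖y‖ + (1 / 4) ^ 2 := by gcongr
    _ ≤ 3 / 4 := by linarith

lemma one_add_rayInc_mem_slitPlane {e y : E3} {M : ℝ} {t : ℂ} (he : ‖e‖ = 1) (hy : ‖y‖ ≤ M)
    (ht : t ∈ Metric.ball (0 : ℂ) (1 / (4 * (M + 1)))) :
    1 + rayInc e y t ∈ Complex.slitPlane := by
  refine Complex.mem_slitPlane_of_norm_lt_one ?_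
  have := norm_rayInc_le he hy ht
  linarith

lemma rayDist_sq {e y : E3} {M : ℝ} {t : ℂ} (he : ‖e‖ = 1) (hy : ‖y‖ ≤ M)
    (ht : t ∈ Metric.ball (0 : ℂ) (1 / (4 * (M + 1)))) :
    rayDist e y t ^ 2 = 1 + rayInc e y t := by
  rw [rayDist, ← Complex.exp_nat_mul]
  push_cast
  rw [mul_div_cancel₀ _ (two_ne_zero)]
  exact Complex.exp_log (Complex.slitPlane_ne_zero (one_add_rayInc_mem_slitPlane he hy ht))

lemma one_half_le_norm_rayDist {e y : E3} {M : ℝ} {t : ℂ} (he : ‖e‖ = 1) (hy : ‖y‖ ≤ M)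
    (ht : t ∈ Metric.ball (0 : ℂ) (1 / (4 * (M + 1)))) :
    1 / 2 ≤ ‖rayDist e y t‖ := by
  have h1 : 1 / 4 ≤ ‖1 + rayInc e y t‖ := by
    have h2 := norm_rayInc_le he hy ht
    have h3 := norm_sub_norm_le (1 : ℂ) (-rayInc e y t)
    rw [norm_neg, norm_one, sub_neg_eq_add] at h3
    linarith
  rw [← rayDist_sq he hy ht, norm_pow] at h1
  nlinarith [norm_nonneg (rayDist e y t)]

lemma rayDist_re_nonneg (e y : E3) (t : ℂ) : 0 ≤ (rayDist e y t).re := by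
  rw [rayDist, Complex.exp_re]
  refine mul_nonneg (Real.exp_pos _).le (Real.cos_nonneg_of_neg_pi_div_two_le_of_le ?_ ?_)
  · have h := Complex.neg_pi_lt_arg (1 + rayInc e y t)
    rw [← Complex.log_im] at h
    have : (Complex.log (1 + rayInc e y t) / 2).im = (Complex.log (1 + rayInc e y t)).im / 2 := by
      simp
    rw [this]
    linarith
  · have h := Complex.arg_le_pi (1 + rayInc e y t)
    rw [← Complex.log_im] at h
    have : (Complex.log (1 + rayInc e y t) / 2).im = (Complex.log (1 + rayInc e y t)).im / 2 := by
      simp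
    rw [this]
    linarith

lemma one_le_norm_rayDist_add_one (e y : E3) (t : ℂ) : 1 ≤ ‖rayDist e y t + 1‖ := by
  have h1 := Complex.re_le_norm (rayDist e y t + 1)
  have h2 := rayDist_re_nonneg e y t
  rw [Complex.add_re, Complex.one_re] at h1
  linarith

lemma rayDist_add_one_ne_zero (e y : E3) (t : ℂ) : rayDist e y t + 1 ≠ 0 := by
  intro h
  have := one_le_norm_rayDist_add_one e y t
  rw [h, norm_zero] at this
  linarith

lemma rayDist_ne_zero (e y : E3) (t : ℂ) : rayDist e y t ≠ 0 := Complex.exp_ne_zero _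

lemma norm_rayKernel_le {e y : E3} (he : ‖e‖ = 1) {M : ℝ} (hy : ‖y‖ ≤ M) (κ : ℝ) {t : ℂ}
    (ht : t ∈ Metric.ball (0 : ℂ) (1 / (4 * (M + 1)))) :
    ‖rayKernel e κ t y‖ ≤ Real.exp (|κ| * (3 * M)) := by
  have hM : 0 ≤ M := (norm_nonneg y).trans hy
  have hin : |inner ℝ e y| ≤ M := by
    have := abs_real_inner_le_norm e y
    rw [he, one_mul] at this
    linarith
  have hph : ‖rayPhase e y t‖ ≤ 3 * M := by
    have ht2 := ht
    rw [mem_ball_zero_iff, lt_div_iff₀ (by positivity)] at ht2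
    rw [rayPhase, norm_div]
    refine (div_le_self (norm_nonneg _) (one_le_norm_rayDist_add_one e y t)).trans ?_
    calc ‖(-2 * (inner ℝ e y : ℝ) + t * (‖y‖ ^ 2 : ℝ) : ℂ)‖
        ≤ ‖(-2 * (inner ℝ e y : ℝ) : ℂ)‖ + ‖t * (‖y‖ ^ 2 : ℝ)‖ := norm_add_le _ _
      _ = 2 * |inner ℝ e y| + ‖t‖ * ‖y‖ ^ 2 := by simp
      _ ≤ 2 * M + ‖t‖ * M ^ 2 := by gcongr
      _ ≤ 3 * M := by nlinarith [norm_nonneg t]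
  rw [rayKernel, norm_div]
  have h4 : 1 ≤ ‖(4 * Real.pi * rayDist e y t : ℂ)‖ := by
    rw [norm_mul, norm_mul, Complex.norm_real, Real.norm_of_nonneg Real.pi_pos.le]
    have h5 := one_half_le_norm_rayDist he hy ht
    have h6 := Real.pi_gt_three
    norm_num
    nlinarith
  refine (div_le_self (norm_nonneg _) h4).trans ?_
  rw [Complex.norm_exp]
  gcongr
  calc (-Complex.I * κ * rayPhase e y t).re ≤ ‖-Complex.I * κ * rayPhase e y t‖ :=
        Complex.re_le_norm _
    _ = |κ| * ‖rayPhase e y t‖ := by simp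
    _ ≤ _ := by gcongr

lemma differentiableOn_rayKernel {e y : E3} (he : ‖e‖ = 1) {M : ℝ} (hy : ‖y‖ ≤ M) (κ : ℝ) :
    DifferentiableOn ℂ (fun t => rayKernel e κ t y) (Metric.ball 0 (1 / (4 * (M + 1)))) := by
  have h1 : DifferentiableOn ℂ (fun t => rayDist e y t) (Metric.ball 0 (1 / (4 * (M + 1)))) := by
    unfold rayDist
    refine ((DifferentiableOn.clog ?_ fun t ht =>
      one_add_rayInc_mem_slitPlane he hy ht).div_const 2).cexp
    unfold rayInc
    fun_prop
  have h2 : DifferentiableOn ℂ (fun t => rayPhase e y t) (Metric.ball 0 (1 / (4 * (M + 1)))) := by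
    unfold rayPhase
    exact DifferentiableOn.div (by fun_prop) (h1.add_const _)
      fun t _ => rayDist_add_one_ne_zero e y t
  unfold rayKernel
  refine DifferentiableOn.div (h2.const_mul _).cexp (h1.const_mul _) fun t _ => ?_
  refine mul_ne_zero (mul_ne_zero (by norm_num) ?_) (rayDist_ne_zero e y t)
  exact_mod_cast Real.pi_ne_zero

/-- amplitude of a potential along a ray, as a function of the inverse distance. -/
def rayAmp (e : E3) (κ : ℝ) (f : E3 → ℂ) (t : ℂ) : ℂ := ∫ y, rayKernel e κ t y * f y

lemma helm_ray {e y : E3} (he : ‖e‖ = 1) {M : ℝ} (hy : ‖y‖ ≤ M) (κ : ℝ) {s : ℝ} (hs : 0 < s)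
    (hs2 : (s : ℂ) ∈ Metric.ball (0 : ℂ) (1 / (4 * (M + 1)))) :
    helm κ (s⁻¹ • e - y) = s * Complex.exp (-Complex.I * κ / s) * rayKernel e κ s y := by
  have hsc : (s : ℂ) ≠ 0 := by exact_mod_cast hs.ne'
  set a : ℝ := s * ‖s⁻¹ • e - y‖ with ha
  have hnorm : a ^ 2 = 1 + (-2 * s * inner ℝ e y + s ^ 2 * ‖y‖ ^ 2) := by
    rw [ha, mul_pow, norm_sub_sq_real, norm_smul, he, inner_smul_left]
    simp only [norm_inv, Real.norm_of_nonneg hs.le, conj_trivial]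
    field_simp
    ring
  have hinc : 1 + rayInc e y s = ((a ^ 2 : ℝ) : ℂ) := by
    rw [hnorm, rayInc]
    push_cast
    ring
  have ha0 : 0 < a := by
    refine lt_of_le_of_ne (by positivity) fun h => ?_
    have h1 := Complex.slitPlane_ne_zero (one_add_rayInc_mem_slitPlane he hy hs2)
    rw [hinc, ← h] at h1
    simp at h1
  have hdist : rayDist e y s = a := by
    rw [rayDist, hinc, ← Complex.ofReal_log (by positivity), Real.log_pow]
    push_cast
    rw [mul_div_cancel_left₀ _ (two_ne_zero), ← Complex.ofReal_exp, Real.exp_log ha0]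
  have hph : (s : ℂ) * rayPhase e y s = a - 1 := by
    have h1 : (a : ℂ) + 1 ≠ 0 := by
      rw [← hdist]
      exact rayDist_add_one_ne_zero e y s
    rw [rayPhase, hdist, mul_div_assoc', div_eq_iff h1]
    have h2 : ((a ^ 2 : ℝ) : ℂ) - 1 = rayInc e y s := by rw [← hinc]; ring
    rw [rayInc] at h2
    push_cast at h2 ⊢
    linear_combination -h2
  have hac : (a : ℂ) ≠ 0 := by exact_mod_cast ha0.ne'
  have hxy : (‖s⁻¹ • e - y‖ : ℂ) = a / s := by
    rw [ha]
    push_cast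
    field_simp
  have hph2 : rayPhase e y s = (a - 1) / s := by
    rw [← hph]
    field_simp
  rw [helm, rayKernel, hdist, hxy, hph2]
  have hexp : -Complex.I * κ * (a / s) = -Complex.I * κ / s + -Complex.I * κ * ((a - 1) / s) := by
    field_simp
    ring
  rw [hexp, Complex.exp_add]
  field_simp

lemma conv_helm_ray {M A : ℝ} {f : E3 → ℂ} (hf : IsSource M A f) {e : E3} (he : ‖e‖ = 1) (κ : ℝ)
    {s : ℝ} (hs : 0 < s) (hs2 : (s : ℂ) ∈ Metric.ball (0 : ℂ) (1 / (4 * (M + 1)))) :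
    conv (helm κ) f (s⁻¹ • e) = s * Complex.exp (-Complex.I * κ / s) * rayAmp e κ f s := by
  rw [conv, rayAmp, ← integral_const_mul]
  congr 1
  funext y
  by_cases hy : ‖y‖ ≤ M
  · rw [helm_ray he hy κ hs hs2]
    ring
  · rw [hf.supp y (not_le.1 hy)]
    ring

lemma norm_rayAmp_le {M A : ℝ} {f : E3 → ℂ} (hf : IsSource M A f) {e : E3} (he : ‖e‖ = 1) (κ : ℝ)
    {t : ℂ} (ht : t ∈ Metric.ball (0 : ℂ) (1 / (4 * (M + 1)))) :
    ‖rayAmp e κ f t‖ ≤ ∫ y, Real.exp (|κ| * (3 * M)) * ‖f y‖ := by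
  refine norm_integral_le_of_norm_le (hf.integrable.norm.const_mul _)
    (Eventually.of_forall fun y => ?_)
  rw [norm_mul]
  by_cases hy : ‖y‖ ≤ M
  · gcongr
    exact norm_rayKernel_le he hy κ ht
  · simp [hf.supp y (not_le.1 hy)]

lemma differentiableOn_rayAmp {M A : ℝ} {f : E3 → ℂ} (hf : IsSource M A f) {e : E3} (he : ‖e‖ = 1)
    (κ : ℝ) : DifferentiableOn ℂ (rayAmp e κ f) (Metric.ball 0 (1 / (4 * (M + 1)))) :=
  differentiableOn_integral_mul_source hf (measurable_rayKernel e κ)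
    (fun _ hy => differentiableOn_rayKernel he hy κ) fun _ hy _ ht => norm_rayKernel_le he hy κ ht

/-- an analytic function which is exponentially small along a ray vanishes. -/
lemma eventually_eq_zero_of_exp_small {g : ℂ → ℂ} (hg : AnalyticAt ℂ g 0) {c C δ : ℝ} (hc : 0 < c)
    (hδ : 0 < δ)
    (h : ∀ σ : ℝ, σ ∈ Ioo 0 δ → ‖g (-Complex.I * σ)‖ ≤ C * Real.exp (-c / σ)) :
    ∀ᶠ z in 𝓝 0, g z = 0 := by
  by_contra hne
  obtain ⟨n, q, hq, hq0, hqe⟩ := hg.exists_eventuallyEq_pow_smul_nonzero_iff.2 hne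
  have hlim : Tendsto (fun σ : ℝ => -Complex.I * σ) (𝓝[>] 0) (𝓝 0) := by
    have : Continuous fun σ : ℝ => -Complex.I * σ := by fun_prop
    have h1 := this.tendsto 0
    simp only [Complex.ofReal_zero, mul_zero] at h1
    exact h1.mono_left nhdsWithin_le_nhds
  have hq1 : Tendsto (fun σ : ℝ => ‖q (-Complex.I * σ)‖) (𝓝[>] 0) (𝓝 ‖q 0‖) :=
    (hq.continuousAt.tendsto.comp hlim).norm
  have hzero : Tendsto (fun σ : ℝ => C * ((σ⁻¹) ^ n * Real.exp (-c * σ⁻¹))) (𝓝[>] 0) (𝓝 0) := by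
    have h1 : Tendsto (fun u : ℝ => C * (u ^ n * Real.exp (-c * u))) atTop (𝓝 (C * 0)) :=
      ((tendsto_rpow_mul_exp_neg_mul_atTop_nhds_zero n c hc).congr fun u => by
        rw [Real.rpow_natCast]).const_mul C
    rw [mul_zero] at h1
    exact h1.comp tendsto_inv_nhdsGT_zero
  have hle : ∀ᶠ σ : ℝ in 𝓝[>] 0,
      ‖q (-Complex.I * σ)‖ ≤ C * ((σ⁻¹) ^ n * Real.exp (-c * σ⁻¹)) := by
    filter_upwards [hlim.eventually hqe, Ioo_mem_nhdsGT hδ] with σ h1 h2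
    have h3 := h σ h2
    have hσ : 0 < σ := h2.1
    rw [h1, sub_zero, norm_smul, norm_pow, norm_mul, norm_neg, Complex.norm_I, one_mul,
      Complex.norm_real, Real.norm_of_nonneg hσ.le] at h3
    rw [← div_eq_mul_inv, inv_pow]
    calc ‖q (-Complex.I * σ)‖ = (σ ^ n)⁻¹ * (σ ^ n * ‖q (-Complex.I * σ)‖) := by
          field_simp
      _ ≤ (σ ^ n)⁻¹ * (C * Real.exp (-c / σ)) := by gcongr
      _ = _ := by ring
  have := le_of_tendsto_of_tendsto hq1 hzero hle
  exact hq0 (norm_le_zero_iff.1 this)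

lemma conv_helm_eq_zero_of_large {M A : ℝ} {f : E3 → ℂ} (hf : IsSource M A f) (hM : 0 ≤ M) {k : ℝ}
    (hk : 0 < k) (h : ∀ x, conv (helm k) f x = conv (helm (-k)) f x) {x : E3}
    (hx : 4 * (M + 1) < ‖x‖) : conv (helm k) f x = 0 := by
  have hx0 : 0 < ‖x‖ := lt_trans (by positivity) hx
  set e : E3 := ‖x‖⁻¹ • x with hedef
  have he : ‖e‖ = 1 := by
    rw [hedef, norm_smul, norm_inv, norm_norm, inv_mul_cancel₀ hx0.ne']
  set δ : ℝ := 1 / (4 * (M + 1)) with hδdef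
  have hδ : 0 < δ := by positivity
  have hB : ∀ κ, AnalyticOnNhd ℂ (rayAmp e κ f) (Metric.ball 0 δ) := fun κ =>
    (differentiableOn_rayAmp hf he κ).analyticOnNhd Metric.isOpen_ball
  set U : Set ℂ := Metric.ball 0 δ ∩ {t | 0 < t.re - t.im} with hU
  have hU0 : ∀ t ∈ U, t ≠ 0 := by
    rintro t ht rfl
    have := ht.2
    simp at this
  have hUpre : IsPreconnected U := by
    refine Convex.isPreconnected ((convex_ball _ _).inter ?_)
    have hlin : IsLinearMap ℝ fun t : ℂ => t.re - t.im :=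
      (Complex.reCLM - Complex.imCLM).toLinearMap.isLinear
    exact convex_halfSpace_gt hlin 0
  have hE : AnalyticOnNhd ℂ (fun t : ℂ => Complex.exp (2 * Complex.I * k / t) * rayAmp e (-k) f t) U := by
    intro t ht
    refine AnalyticAt.mul ?_ (hB (-k) t ht.1)
    exact (analyticAt_const.div analyticAt_id (hU0 t ht)).cexp
  have hreal : ∀ s : ℝ, s ∈ Ioo 0 δ →
      rayAmp e k f s = Complex.exp (2 * Complex.I * k / s) * rayAmp e (-k) f s := by
    intro s hs
    have hsc : (s : ℂ) ≠ 0 := by exact_mod_cast hs.1.ne'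
    have hmem : (s : ℂ) ∈ Metric.ball (0 : ℂ) δ := by
      rw [mem_ball_zero_iff, Complex.norm_real, Real.norm_of_nonneg hs.1.le]
      exact hs.2
    have h1 := h (s⁻¹ • e)
    rw [conv_helm_ray hf he k hs.1 hmem, conv_helm_ray hf he (-k) hs.1 hmem, mul_assoc, mul_assoc]
      at h1
    have h2 := mul_left_cancel₀ hsc h1
    have h3 : Complex.exp (2 * Complex.I * k / s) =
        Complex.exp (Complex.I * k / s) * Complex.exp (Complex.I * k / s) := by
      rw [← Complex.exp_add]
      ring_nf
    have h4 : Complex.exp (Complex.I * k / s) * Complex.exp (-Complex.I * k / s) = 1 := by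
      rw [← Complex.exp_add]
      ring_nf
      exact Complex.exp_zero
    have h5 : -Complex.I * ((-k : ℝ) : ℂ) / s = Complex.I * k / s := by
      push_cast
      ring
    rw [h5] at h2
    calc rayAmp e k f s = Complex.exp (Complex.I * k / s) *
          (Complex.exp (-Complex.I * k / s) * rayAmp e k f s) := by
          rw [← mul_assoc, h4, one_mul]
      _ = _ := by rw [h2, h3, mul_assoc]
  have hδ2 : ((δ / 2 : ℝ) : ℂ) ∈ U := by
    refine ⟨?_, ?_⟩
    · rw [mem_ball_zero_iff, Complex.norm_real, Real.norm_of_nonneg (by positivity)]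
      linarith
    · change 0 < ((δ / 2 : ℝ) : ℂ).re - ((δ / 2 : ℝ) : ℂ).im
      rw [Complex.ofReal_re, Complex.ofReal_im]
      linarith
  have hfreq : ∃ᶠ z in 𝓝[≠] ((δ / 2 : ℝ) : ℂ), rayAmp e k f z =
      Complex.exp (2 * Complex.I * k / z) * rayAmp e (-k) f z := by
    have ht : Tendsto (fun s : ℝ => (s : ℂ)) (𝓝[≠] (δ / 2)) (𝓝[≠] ((δ / 2 : ℝ) : ℂ)) := by
      refine tendsto_nhdsWithin_iff.2 ⟨?_, ?_⟩
      · exact (Complex.continuous_ofReal.tendsto _).mono_left nhdsWithin_le_nhds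
      · filter_upwards [self_mem_nhdsWithin] with s hs
        exact fun h => hs (Complex.ofReal_injective h)
    refine ht.frequently (Eventually.frequently ?_)
    filter_upwards [nhdsWithin_le_nhds (Ioo_mem_nhds (show (0 : ℝ) < δ / 2 by positivity)
      (show δ / 2 < δ by linarith))] with s hs
    exact hreal s hs
  have hEq := AnalyticOnNhd.eqOn_of_preconnected_of_frequently_eq
    ((hB k).mono inter_subset_left) hE hUpre hδ2 hfreq
  have hz := eventually_eq_zero_of_exp_small (g := rayAmp e k f) (c := 2 * k)
    (C := ∫ y, Real.exp (|-k| * (3 * M)) * ‖f y‖) (δ := δ) (hB k 0 (Metric.mem_ball_self hδ))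
    (by positivity) hδ (fun σ hσ => by
      have hmem : -Complex.I * σ ∈ Metric.ball (0 : ℂ) δ := by
        rw [mem_ball_zero_iff, norm_mul, norm_neg, Complex.norm_I, one_mul, Complex.norm_real,
          Real.norm_of_nonneg hσ.1.le]
        exact hσ.2
      have hmemU : -Complex.I * σ ∈ U := by
        refine ⟨hmem, ?_⟩
        change 0 < (-Complex.I * σ).re - (-Complex.I * σ).im
        simpa using hσ.1
      have hσc : (σ : ℂ) ≠ 0 := by exact_mod_cast hσ.1.ne'
      have h1 : 2 * Complex.I * k / (-Complex.I * σ) = ((-(2 * k) / σ : ℝ) : ℂ) := by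
        push_cast
        field_simp
      rw [hEq hmemU]
      simp only
      rw [h1, norm_mul, ← Complex.ofReal_exp, Complex.norm_real,
        Real.norm_of_nonneg (Real.exp_pos _).le, mul_comm]
      gcongr
      exact norm_rayAmp_le hf he (-k) hmem)
  have hzero := (hB k).eqOn_zero_of_preconnected_of_eventuallyEq_zero
    (convex_ball _ _).isPreconnected (Metric.mem_ball_self hδ) hz
  have hinv : ((‖x‖⁻¹ : ℝ) : ℂ) ∈ Metric.ball (0 : ℂ) δ := by
    rw [mem_ball_zero_iff, Complex.norm_real, norm_inv, norm_norm, hδdef, one_div]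
    exact inv_strictAnti₀ (by positivity) hx
  have hfin := conv_helm_ray hf he k (inv_pos.2 hx0) hinv
  rw [hzero hinv, inv_inv, hedef, smul_smul, mul_inv_cancel₀ hx0.ne', one_smul] at hfin
  rw [hfin]
  simp

lemma contDiff_conj_comp {n : WithTop ℕ∞} {f : E3 → ℂ} (hf : ContDiff ℝ n f) :
    ContDiff ℝ n fun x => (starRingEnd ℂ) (f x) :=
  Complex.conjCLE.contDiff.comp hf

lemma pder_conj {f : E3 → ℂ} {x : E3} (hf : DifferentiableAt ℝ f x) (i : Fin 3) :
    pder i (fun y => (starRingEnd ℂ) (f y)) x = (starRingEnd ℂ) (pder i f x) := by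
  have h := Complex.conjCLE.toContinuousLinearMap.hasFDerivAt.comp x hf.hasFDerivAt
  have h' : HasFDerivAt (fun y => (starRingEnd ℂ) (f y))
      (Complex.conjCLE.toContinuousLinearMap.comp (fderiv ℝ f x)) x := h
  unfold pder
  rw [h'.fderiv]
  rfl

lemma pder_comm {f : E3 → ℂ} (hf : ContDiff ℝ 2 f) (i j : Fin 3) (x : E3) :
    pder i (pder j f) x = pder j (pder i f) x := by
  have hd : DifferentiableAt ℝ (fderiv ℝ f) x :=
    (hf.fderiv_right (m := 1) (by norm_num)).differentiable (by norm_num) x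
  have key : ∀ a b : Fin 3, pder a (pder b f) x = fderiv ℝ (fderiv ℝ f) x (e3 a) (e3 b) := by
    intro a b
    have : HasFDerivAt (pder b f)
        ((ContinuousLinearMap.apply ℝ ℂ (e3 b)).comp (fderiv ℝ (fderiv ℝ f) x)) x :=
      (ContinuousLinearMap.apply ℝ ℂ (e3 b)).hasFDerivAt.comp x hd.hasFDerivAt
    rw [pder, this.fderiv]
    rfl
  rw [key, key]
  exact (hf.contDiffAt.isSymmSndFDerivAt (by simp)).eq _ _

section Carleman

variable {w : E3 → ℂ} {M : ℝ}

lemma hasCompactSupport_of_ball {G : Type*} [Zero G] {g : E3 → G} (hs : ∀ x, M < ‖x‖ → g x = 0) :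
    HasCompactSupport g :=
  HasCompactSupport.intro (isCompact_closedBall (0 : E3) M) fun x hx => hs x (by simpa using hx)

lemma pder_eq_zero_of_support (hs : ∀ x, M < ‖x‖ → w x = 0) (i : Fin 3) (x : E3) (hx : M < ‖x‖) :
    pder i w x = 0 := pderList_eq_zero_of_support hs [i] x hx

lemma integral_re_pder_eq_zero (hw : ContDiff ℝ 1 w) (hs : ∀ x, M < ‖x‖ → w x = 0) (i : Fin 3) :
    ∫ x, (pder i w x).re = 0 := by
  have hp : Continuous (pder i w) := (contDiff_pder (m := 0) (by norm_num) hw i).continuous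
  have hint : Integrable (pder i w) :=
    hp.integrable_of_hasCompactSupport (hasCompactSupport_of_ball (pder_eq_zero_of_support hs i))
  have := integral_re hint
  rw [integral_pder_eq_zero hw hs] at this
  simpa using this

lemma integral_re_mul_conj_pder (hw : ContDiff ℝ 1 w) (hs : ∀ x, M < ‖x‖ → w x = 0)
    (i : Fin 3) : ∫ x, (w x * (starRingEnd ℂ) (pder i w x)).re = 0 := by
  have hd : Differentiable ℝ w := hw.differentiable (by norm_num)
  have hI := integral_re_pder_eq_zero (w := fun x => w x * (starRingEnd ℂ) (w x)) (M := M)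
    (hw.mul (contDiff_conj_comp hw)) (fun x hx => by simp [hs x hx]) i
  have e1 : ∀ x, (pder i (fun x => w x * (starRingEnd ℂ) (w x)) x).re =
      2 * (w x * (starRingEnd ℂ) (pder i w x)).re := by
    intro x
    rw [pder_mul (hd x) ((contDiff_conj_comp hw).differentiable (by norm_num) x),
      pder_conj (hd x)]
    simp
    ring
  simp_rw [e1] at hI
  rw [integral_const_mul] at hI
  linarith

lemma integral_re_lap_mul_conj_pder (hw : ContDiff ℝ 2 w) (hs : ∀ x, M < ‖x‖ → w x = 0)
    (i : Fin 3) : ∫ x, (lap w x * (starRingEnd ℂ) (pder i w x)).re = 0 := by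
  have hw1 : ∀ j, ContDiff ℝ 1 (pder j w) := fun j => contDiff_pder (by norm_num) hw j
  have hd : ∀ j, Differentiable ℝ (pder j w) := fun j => (hw1 j).differentiable (by norm_num)
  have hc : ∀ j, Continuous (pder j w) := fun j => (hw1 j).continuous
  have hc2 : ∀ a b, Continuous (pder a (pder b w)) := fun a b =>
    (contDiff_pder (m := 0) (by norm_num) (hw1 b) a).continuous
  have hs1 : ∀ j x, M < ‖x‖ → pder j w x = 0 := fun j => pder_eq_zero_of_support hs j
  have key : ∀ j, ∫ x, (pder j (pder j w) x * (starRingEnd ℂ) (pder i w x)).re = 0 := by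
    intro j
    have h1 := integral_re_pder_eq_zero (w := fun x => pder j w x * (starRingEnd ℂ) (pder i w x))
      (M := M) ((hw1 j).mul (contDiff_conj_comp (hw1 i))) (fun x hx => by simp [hs1 j x hx]) j
    have h2 := integral_re_mul_conj_pder (hw1 j) (hs1 j) i
    have e1 : ∀ x, (pder j (fun x => pder j w x * (starRingEnd ℂ) (pder i w x)) x).re =
        (pder j (pder j w) x * (starRingEnd ℂ) (pder i w x)).re +
        (pder j w x * (starRingEnd ℂ) (pder i (pder j w) x)).re := by
      intro x
      rw [pder_mul (hd j x) ((contDiff_conj_comp (hw1 i)).differentiable (by norm_num) x),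
        pder_conj (hd i x), pder_comm hw j i, Complex.add_re]
    simp_rw [e1] at h1
    rw [integral_add, h2, add_zero] at h1
    · exact h1
    · refine Continuous.integrable_of_hasCompactSupport ?_
        (hasCompactSupport_of_ball (M := M) fun x hx => by simp [hs1 i x hx])
      exact Complex.continuous_re.comp ((hc2 j j).mul (Complex.continuous_conj.comp (hc i)))
    · refine Continuous.integrable_of_hasCompactSupport ?_
        (hasCompactSupport_of_ball (M := M) fun x hx => by simp [hs1 j x hx])
      exact Complex.continuous_re.comp ((hc j).mul (Complex.continuous_conj.comp (hc2 i j)))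
  unfold lap
  simp_rw [Finset.sum_mul, Complex.re_sum]
  rw [integral_finsetSum _ fun j _ => ?_]
  · exact Finset.sum_eq_zero fun j _ => key j
  · refine Continuous.integrable_of_hasCompactSupport ?_
      (hasCompactSupport_of_ball (M := M) fun x hx => by simp [hs1 i x hx])
    exact Complex.continuous_re.comp ((hc2 j j).mul (Complex.continuous_conj.comp (hc i)))

lemma re_mul_conj_le (a b : ℂ) : |(a * (starRingEnd ℂ) b).re| ≤ ‖a‖ * ‖b‖ := by
  refine (Complex.abs_re_le_norm _).trans ?_
  rw [norm_mul, RCLike.norm_conj]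

lemma integral_sq_norm_le_pder (hM : 0 ≤ M) (hw : ContDiff ℝ 1 w) (hs : ∀ x, M < ‖x‖ → w x = 0)
    (i : Fin 3) : ∫ x, ‖w x‖ ^ 2 ≤ 4 * M ^ 2 * ∫ x, ‖pder i w x‖ ^ 2 := by
  have hd : Differentiable ℝ w := hw.differentiable (by norm_num)
  have hp : Continuous (pder i w) := (contDiff_pder (m := 0) (by norm_num) hw i).continuous
  have hc := hw.continuous
  have hs1 : ∀ x, M < ‖x‖ → pder i w x = 0 := pder_eq_zero_of_support hs i
  have hcoord : ContDiff ℝ 1 fun x : E3 => ((x i : ℝ) : ℂ) :=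
    (Complex.ofRealCLM.comp (EuclideanSpace.proj i : E3 →L[ℝ] ℝ)).contDiff
  have hI := integral_re_pder_eq_zero
    (w := fun x : E3 => ((x i : ℝ) : ℂ) * (w x * (starRingEnd ℂ) (w x))) (M := M)
    (hcoord.mul (hw.mul (contDiff_conj_comp hw))) (fun x hx => by simp [hs x hx]) i
  have e1 : ∀ x, (pder i (fun x : E3 => ((x i : ℝ) : ℂ) * (w x * (starRingEnd ℂ) (w x))) x).re =
      ‖w x‖ ^ 2 + 2 * (x i * (w x * (starRingEnd ℂ) (pder i w x)).re) := by
    intro x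
    have hcd := (contDiff_conj_comp hw).differentiable (by norm_num) x
    rw [pder_mul (hcoord.differentiable (by norm_num) x) ((hd x).fun_mul hcd),
      pder_mul (hd x) hcd, pder_conj (hd x), pder_coord, ← Complex.normSq_eq_norm_sq,
      Complex.normSq_apply]
    simp
    ring
  simp_rw [e1] at hI
  have hi1 : Integrable fun x => ‖w x‖ ^ 2 :=
    Continuous.integrable_of_hasCompactSupport (by fun_prop)
      (hasCompactSupport_of_ball (M := M) fun x hx => by simp [hs x hx])
  have hi2 : Integrable fun x => ‖pder i w x‖ ^ 2 :=
    Continuous.integrable_of_hasCompactSupport (by fun_prop)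
      (hasCompactSupport_of_ball (M := M) fun x hx => by simp [hs1 x hx])
  have hi3 : Integrable fun x : E3 => 2 * (x i * (w x * (starRingEnd ℂ) (pder i w x)).re) := by
    refine Continuous.integrable_of_hasCompactSupport ?_
      (hasCompactSupport_of_ball (M := M) fun x hx => by simp [hs x hx])
    have : Continuous fun x => (w x * (starRingEnd ℂ) (pder i w x)).re :=
      Complex.continuous_re.comp (hc.mul (Complex.continuous_conj.comp hp))
    fun_prop
  have hpt : ∀ x : E3, -(2 * (x i * (w x * (starRingEnd ℂ) (pder i w x)).re)) ≤
      (1 / 2) * ‖w x‖ ^ 2 + 2 * M ^ 2 * ‖pder i w x‖ ^ 2 := by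
    intro x
    by_cases hx : M < ‖x‖
    · simp only [hs x hx, zero_mul, Complex.zero_re, mul_zero, neg_zero]
      positivity
    have hxi : |x i| ≤ M := (norm_coord_le x i).trans (not_lt.1 hx)
    have h1 := re_mul_conj_le (w x) (pder i w x)
    have h2 : |x i * (w x * (starRingEnd ℂ) (pder i w x)).re| ≤ M * (‖w x‖ * ‖pder i w x‖) := by
      rw [abs_mul]
      exact mul_le_mul hxi h1 (abs_nonneg _) hM
    have h3 := (abs_le.1 h2).1
    nlinarith [sq_nonneg (‖w x‖ - 2 * M * ‖pder i w x‖)]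
  have hmono := integral_mono hi3.neg ((hi1.const_mul (1 / 2)).add (hi2.const_mul (2 * M ^ 2))) hpt
  simp only [Pi.neg_apply, Pi.add_apply] at hmono
  rw [integral_neg, integral_add (hi1.const_mul _) (hi2.const_mul _),
    integral_const_mul (1 / 2 : ℝ) fun x => ‖w x‖ ^ 2, integral_const_mul (2 * M ^ 2)] at hmono
  rw [integral_add hi1 hi3] at hI
  linarith

/-- the exponential weight `exp (τ x₁)`. -/
def expWeight (τ : ℝ) (x : E3) : ℂ := Complex.exp (τ * ((x 0 : ℝ) : ℂ))

lemma contDiff_expWeight (τ : ℝ) {n : WithTop ℕ∞} : ContDiff ℝ n (expWeight τ) := by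
  have hcoord : ContDiff ℝ n fun x : E3 => ((x 0 : ℝ) : ℂ) :=
    (Complex.ofRealCLM.comp (EuclideanSpace.proj 0 : E3 →L[ℝ] ℝ)).contDiff
  exact (contDiff_const.mul hcoord).cexp

lemma expWeight_ne_zero (τ : ℝ) (x : E3) : expWeight τ x ≠ 0 := Complex.exp_ne_zero _

lemma pder_expWeight (τ : ℝ) (j : Fin 3) (x : E3) :
    pder j (expWeight τ) x = (if (0 : Fin 3) = j then (τ : ℂ) else 0) * expWeight τ x := by
  have h := ((hasFDerivAt_coord 0 x).const_mul (τ : ℂ)).cexp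
  unfold pder
  rw [show expWeight τ = fun x : E3 => Complex.exp (τ * ((x 0 : ℝ) : ℂ)) from rfl, h.fderiv]
  by_cases hj : (0 : Fin 3) = j
  · subst hj
    simp [e3]
    ring
  · simp [e3, hj]

lemma pder_expWeight_mul (τ : ℝ) {v : E3 → ℂ} (hv : Differentiable ℝ v) (j : Fin 3) :
    pder j (fun x => expWeight τ x * v x) = fun x =>
      expWeight τ x * (pder j v x + (if (0 : Fin 3) = j then (τ : ℂ) else 0) * v x) := by
  funext x
  rw [pder_mul ((contDiff_expWeight τ (n := 1)).differentiable (by norm_num) x) (hv x),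
    pder_expWeight]
  ring

lemma lap_expWeight_mul (τ : ℝ) {v : E3 → ℂ} (hv : ContDiff ℝ 2 v) (x : E3) :
    lap (fun x => expWeight τ x * v x) x = expWeight τ x * lap v x +
      2 * τ * pder 0 (fun x => expWeight τ x * v x) x - τ ^ 2 * (expWeight τ x * v x) := by
  have hd : Differentiable ℝ v := hv.differentiable (by norm_num)
  have hd1 : ∀ j, Differentiable ℝ (pder j v) := fun j =>
    (contDiff_pder (m := 1) (by norm_num) hv j).differentiable (by norm_num)
  have h2 : ∀ j, pder j (pder j (fun x => expWeight τ x * v x)) x =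
      expWeight τ x * (pder j (pder j v) x + (if (0 : Fin 3) = j then (τ : ℂ) else 0) *
        (2 * pder j v x + (if (0 : Fin 3) = j then (τ : ℂ) else 0) * v x)) := by
    intro j
    rw [pder_expWeight_mul τ hd j, pder_expWeight_mul τ ((hd1 j).fun_add (hd.const_mul _))]
    dsimp only
    rw [pder_add (hd1 j x) ((hd x).const_mul _), pder_const_mul (hd x)]
    ring
  unfold lap
  simp_rw [h2]
  rw [pder_expWeight_mul τ hd]
  simp [Fin.sum_univ_three]
  ring

theorem eq_zero_of_norm_lap_le {v : E3 → ℂ} {B : ℝ} (hM : 0 ≤ M) (hB : 0 ≤ B)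
    (hv : ContDiff ℝ 2 v) (hs : ∀ x, M < ‖x‖ → v x = 0) (h : ∀ x, ‖lap v x‖ ≤ B * ‖v x‖) (x : E3) :
    v x = 0 := by
  set τ : ℝ := B * (4 * M ^ 2 + 1) + 1 with hτ
  have hτ1 : 0 < τ := by positivity
  set w : E3 → ℂ := fun x => expWeight τ x * v x with hwdef
  have hw : ContDiff ℝ 2 w := (contDiff_expWeight τ).mul hv
  have hw1 : ContDiff ℝ 1 w := hw.of_le (by norm_num)
  have hws : ∀ x, M < ‖x‖ → w x = 0 := fun x hx => by simp [hwdef, hs x hx]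
  have hp : Continuous (pder 0 w) := (contDiff_pder (m := 0) (by norm_num) hw1 0).continuous
  have hc := hw.continuous
  have hs1 : ∀ x, M < ‖x‖ → pder 0 w x = 0 := pder_eq_zero_of_support hws 0
  have hi1 : Integrable fun x => ‖w x‖ ^ 2 :=
    Continuous.integrable_of_hasCompactSupport (by fun_prop)
      (hasCompactSupport_of_ball (M := M) fun x hx => by simp [hws x hx])
  have hi2 : Integrable fun x => ‖pder 0 w x‖ ^ 2 :=
    Continuous.integrable_of_hasCompactSupport (by fun_prop)
      (hasCompactSupport_of_ball (M := M) fun x hx => by simp [hs1 x hx])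
  have hcl : Continuous (lap w) := by
    unfold lap
    exact continuous_finsetSum _ fun j _ =>
      (contDiff_pder (m := 0) (by norm_num) (contDiff_pder (m := 1) (by norm_num) hw j) j).continuous
  have hi3 : Integrable fun x => (lap w x * (starRingEnd ℂ) (pder 0 w x)).re :=
    (Complex.continuous_re.comp (hcl.mul (Complex.continuous_conj.comp hp))).integrable_of_hasCompactSupport
      (hasCompactSupport_of_ball (M := M) fun x hx => by simp [hs1 x hx])
  have hi4 : Integrable fun x => (w x * (starRingEnd ℂ) (pder 0 w x)).re :=
    (Complex.continuous_re.comp (hc.mul (Complex.continuous_conj.comp hp))).integrable_of_hasCompactSupport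
      (hasCompactSupport_of_ball (M := M) fun x hx => by simp [hs1 x hx])
  have hpt : ∀ x, 2 * τ * ‖pder 0 w x‖ ^ 2 ≤ (lap w x * (starRingEnd ℂ) (pder 0 w x)).re +
      τ ^ 2 * (w x * (starRingEnd ℂ) (pder 0 w x)).re +
      (B / 2 * ‖w x‖ ^ 2 + B / 2 * ‖pder 0 w x‖ ^ 2) := by
    intro x
    have e := lap_expWeight_mul τ hv x
    have h1 : ‖expWeight τ x * lap v x‖ ≤ B * ‖w x‖ := by
      rw [norm_mul, hwdef]
      dsimp only
      rw [norm_mul]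
      nlinarith [h x, norm_nonneg (expWeight τ x)]
    have h2 := re_mul_conj_le (expWeight τ x * lap v x) (pder 0 w x)
    have h3 : (lap w x * (starRingEnd ℂ) (pder 0 w x)).re =
        (expWeight τ x * lap v x * (starRingEnd ℂ) (pder 0 w x)).re + 2 * τ * ‖pder 0 w x‖ ^ 2 -
          τ ^ 2 * (w x * (starRingEnd ℂ) (pder 0 w x)).re := by
      rw [show lap w x = expWeight τ x * lap v x + 2 * τ * pder 0 w x - τ ^ 2 * w x from e,
        ← Complex.normSq_eq_norm_sq, Complex.normSq_apply]
      generalize expWeight τ x * lap v x = q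
      simp [← Complex.ofReal_pow]
      ring
    have h4 := (abs_le.1 h2).1
    have h5 := mul_le_mul_of_nonneg_right h1 (norm_nonneg (pder 0 w x))
    nlinarith [mul_nonneg hB (sq_nonneg (‖w x‖ - ‖pder 0 w x‖))]
  have hmono := integral_mono (hi2.const_mul (2 * τ))
    ((hi3.add (hi4.const_mul (τ ^ 2))).add ((hi1.const_mul (B / 2)).add (hi2.const_mul (B / 2)))) hpt
  rw [integral_add' (hi3.add (hi4.const_mul (τ ^ 2)))
      ((hi1.const_mul (B / 2)).add (hi2.const_mul (B / 2))),
    integral_add' hi3 (hi4.const_mul (τ ^ 2)),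
    integral_add' (hi1.const_mul (B / 2)) (hi2.const_mul (B / 2)),
    integral_const_mul, integral_const_mul, integral_const_mul, integral_const_mul,
    integral_re_lap_mul_conj_pder hw hws, integral_re_mul_conj_pder hw1 hws] at hmono
  have hpoin := integral_sq_norm_le_pder hM hw1 hws 0
  have hp0 : 0 ≤ ∫ x, ‖pder 0 w x‖ ^ 2 := integral_nonneg fun x => by positivity
  have hw0 : 0 ≤ ∫ x, ‖w x‖ ^ 2 := integral_nonneg fun x => by positivity
  have hz : ∫ x, ‖pder 0 w x‖ ^ 2 = 0 := by
    have := mul_le_mul_of_nonneg_left hpoin hB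
    nlinarith [mul_nonneg hB hp0, mul_nonneg (mul_nonneg hB (sq_nonneg M)) hp0]
  have hwz : ∫ x, ‖w x‖ ^ 2 = 0 := by
    rw [hz, mul_zero] at hpoin
    linarith
  have hae := (integral_eq_zero_iff_of_nonneg (fun x => by positivity) hi1).1 hwz
  have hall := (Continuous.ae_eq_iff_eq volume (by fun_prop) continuous_zero).1 hae
  have hx := congrFun hall x
  simp only [Pi.zero_apply, ne_eq, OfNat.ofNat_ne_zero, not_false_eq_true, pow_eq_zero_iff,
    norm_eq_zero, hwdef, mul_eq_zero] at hx
  exact hx.resolve_left (expWeight_ne_zero τ x)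

end Carleman

/-- bounded and Lipschitz with the same constant. -/
structure BddLip (C : ℝ) (f : E3 → ℂ) : Prop where
  bound : ∀ x, ‖f x‖ ≤ C
  lip : ∀ x y, ‖f x - f y‖ ≤ C * ‖x - y‖

lemma BddLip.nonneg {C : ℝ} {f : E3 → ℂ} (h : BddLip C f) : 0 ≤ C :=
  (norm_nonneg _).trans (h.bound 0)

lemma norm_mul_sub_mul_le (a b c d : ℂ) : ‖a * b - c * d‖ ≤ ‖a - c‖ * ‖b‖ + ‖c‖ * ‖b - d‖ := by
  rw [← norm_mul, ← norm_mul]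
  refine (le_of_eq ?_).trans (norm_add_le _ _)
  congr 1
  ring

lemma BddLip.mul {C D : ℝ} {f g : E3 → ℂ} (hf : BddLip C f) (hg : BddLip D g) :
    BddLip (2 * C * D) fun x => f x * g x := by
  have hC := hf.nonneg
  have hD := hg.nonneg
  refine ⟨fun x => ?_, fun x y => ?_⟩
  · rw [norm_mul]
    have := mul_le_mul (hf.bound x) (hg.bound x) (norm_nonneg _) hC
    nlinarith [mul_nonneg hC hD]
  · refine (norm_mul_sub_mul_le _ _ _ _).trans ?_
    have h1 := mul_le_mul (hf.lip x y) (hg.bound x) (norm_nonneg _) (by positivity)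
    have h2 := mul_le_mul (hf.bound y) (hg.lip x y) (norm_nonneg _) hC
    linarith

lemma BddLip.const_mul {C : ℝ} {f : E3 → ℂ} (hf : BddLip C f) (c : ℂ) :
    BddLip (‖c‖ * C) fun x => c * f x := by
  refine ⟨fun x => ?_, fun x y => ?_⟩
  · rw [norm_mul]
    exact mul_le_mul_of_nonneg_left (hf.bound x) (norm_nonneg _)
  · rw [← mul_sub, norm_mul, mul_assoc]
    exact mul_le_mul_of_nonneg_left (hf.lip x y) (norm_nonneg _)

lemma BddLip.continuous {C : ℝ} {f : E3 → ℂ} (hf : BddLip C f) : Continuous f := by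
  have : LipschitzWith C.toNNReal f := LipschitzWith.of_dist_le_mul fun x y => by
    rw [dist_eq_norm, dist_eq_norm, Real.coe_toNNReal _ hf.nonneg]
    exact hf.lip x y
  exact this.continuous

lemma exists_bddLip_of_contDiff {β : E3 → ℝ} (h : ContDiff ℝ 1 β) (hc : HasCompactSupport β) :
    ∃ L, BddLip L fun x => (β x : ℂ) := by
  obtain ⟨C, hC⟩ := h.lipschitzWith_of_hasCompactSupport hc (by norm_num)
  obtain ⟨B, hB⟩ := hc.exists_bound_of_continuous h.continuous
  refine ⟨max B C, fun x => ?_, fun x y => ?_⟩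
  · rw [Complex.norm_real]
    exact (hB x).trans (le_max_left _ _)
  · rw [← Complex.ofReal_sub, Complex.norm_real]
    have := hC.dist_le_mul x y
    rw [dist_eq_norm, dist_eq_norm] at this
    exact this.trans (mul_le_mul_of_nonneg_right (le_max_right _ _) (norm_nonneg _))

/-- The homogeneous Lippmann–Schwinger equation with a real contrast has only the zero solution. -/
theorem eq_zero_of_lippmann_schwinger {β : E3 → ℝ} {k M L : ℝ} (hk : 0 < k) (hM : 0 ≤ M)
    (hβ : BddLip L fun x => (β x : ℂ)) (hs : ∀ x, M < ‖x‖ → β x = 0) {v : E3 → ℂ}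
    (hvc : Continuous v) (hv : ∀ x, v x = conv (helm k) (fun y => (k : ℂ) ^ 2 * β y * v y) x)
    (x : E3) : v x = 0 := by
  set F : E3 → ℂ := fun y => (k : ℂ) ^ 2 * β y * v y with hF
  have hv' : v = conv (helm k) F := funext hv
  have hFc : Continuous F := (continuous_const.mul hβ.continuous).mul hvc
  have hFs : ∀ x, M < ‖x‖ → F x = 0 := fun x hx => by simp [hF, hs x hx]
  obtain ⟨A, hA⟩ := (hasCompactSupport_of_ball hFs).exists_bound_of_continuous hFc
  have hsrc : IsSource M A F := ⟨hFc.aestronglyMeasurable, hA, hFs⟩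
  have him : (∫ x, (starRingEnd ℂ) (F x) * conv (helm k) F x).im = 0 := by
    have e : ∀ x, (starRingEnd ℂ) (F x) * conv (helm k) F x =
        ((k ^ 2 * β x * Complex.normSq (v x) : ℝ) : ℂ) := by
      intro x
      rw [← hv', Complex.ofReal_mul, Complex.normSq_eq_conj_mul_self]
      simp [hF]
      ring
    simp_rw [e]
    rw [integral_complex_ofReal, Complex.ofReal_im]
  have hneg := conv_helm_eq_conv_helm_neg hsrc hk him
  have hzero : ∀ x, 4 * (M + 1) < ‖x‖ → v x = 0 := fun x hx => by
    rw [hv']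
    exact conv_helm_eq_zero_of_large hsrc hM hk hneg hx
  obtain ⟨C, hC, hCb⟩ := exists_lipschitz_potential hk.le hM
  have hvl : BddLip (C * A) v := by
    rw [hv']
    exact ⟨(hCb F A hsrc).1, (hCb F A hsrc).2⟩
  have hFl := (hβ.const_mul ((k : ℂ) ^ 2)).mul hvl
  have hα : (1 / 2 : ℝ) ∈ Ioo (0 : ℝ) 1 := by constructor <;> norm_num
  have hHol := holder_of_bound_of_lipschitz hα hFl.bound hFl.lip
  have hH0 : 0 ≤ 2 * (2 * (‖(k : ℂ) ^ 2‖ * L) * (C * A)) := mul_nonneg (by norm_num) hFl.nonneg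
  obtain ⟨_, _, hsch⟩ := exists_schauder_potential hα hk.le hM
  have hv2 : ContDiff ℝ 2 v := by
    rw [hv']
    exact (hsch F A _ hsrc hH0 hHol).1
  have hlap : ∀ x, lap v x = -(k ^ 2 + k ^ 2 * β x) * v x := by
    intro x
    have := helmholtz_potential hα hk.le hM hsrc hH0 hHol x
    rw [← hv'] at this
    linear_combination this
  refine eq_zero_of_norm_lap_le (M := 4 * (M + 1)) (B := k ^ 2 + k ^ 2 * L) (by positivity)
    (add_nonneg (by positivity) (mul_nonneg (by positivity) hβ.nonneg)) hv2 hzero (fun x => ?_) x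
  rw [hlap, norm_mul, norm_neg]
  refine mul_le_mul_of_nonneg_right ((norm_add_le _ _).trans ?_) (norm_nonneg _)
  rw [norm_mul, norm_pow, Complex.norm_real, Real.norm_of_nonneg hk.le]
  exact add_le_add_right (mul_le_mul_of_nonneg_left (hβ.bound x) (by positivity)) _

/-- extension by zero of a function on a subset of space. -/
def zeroExt {K : Set E3} (h : K → ℂ) : E3 → ℂ := Function.extend Subtype.val h 0

lemma zeroExt_apply {K : Set E3} (h : K → ℂ) (x : K) : zeroExt h x = h x :=
  Subtype.val_injective.extend_apply h 0 x

lemma zeroExt_of_notMem {K : Set E3} (h : K → ℂ) {x : E3} (hx : x ∉ K) : zeroExt h x = 0 :=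
  Function.extend_apply' _ _ _ fun ⟨y, hy⟩ => hx (hy ▸ y.2)

lemma measurable_zeroExt {K : Set E3} (hK : MeasurableSet K) {h : K → ℂ} (hh : Continuous h) :
    Measurable (zeroExt h) :=
  (MeasurableEmbedding.subtype_coe hK).measurable_extend hh.measurable measurable_zero

lemma norm_zeroExt_le {K : Set E3} (h : K →ᵇ ℂ) (x : E3) : ‖zeroExt h x‖ ≤ ‖h‖ := by
  by_cases hx : x ∈ K
  · rw [show x = ((⟨x, hx⟩ : K) : E3) from rfl, zeroExt_apply]
    exact h.norm_coe_le_norm _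
  · rw [zeroExt_of_notMem _ hx, norm_zero]
    exact norm_nonneg _

lemma isSource_mul_zeroExt {K : Set E3} {M Q : ℝ} (hK : MeasurableSet K)
    (hKM : K ⊆ Metric.closedBall 0 M) {q : E3 → ℂ} (hq : AEStronglyMeasurable q volume)
    (hQ : ∀ x, ‖q x‖ ≤ Q) (h : K →ᵇ ℂ) : IsSource M (Q * ‖h‖) fun y => q y * zeroExt h y where
  meas := hq.mul (measurable_zeroExt hK h.continuous).aestronglyMeasurable
  bound x := by
    rw [norm_mul]
    exact mul_le_mul (hQ x) (norm_zeroExt_le h x) (norm_nonneg _) ((norm_nonneg _).trans (hQ x))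
  supp x hx := by
    rw [zeroExt_of_notMem _ fun hxK => ?_, mul_zero]
    have := hKM hxK
    rw [mem_closedBall_zero_iff] at this
    linarith

lemma conv_helm_add {M A B k : ℝ} {F G : E3 → ℂ} (hF : IsSource M A F) (hG : IsSource M B G)
    (x : E3) : conv (helm k) (fun y => F y + G y) x = conv (helm k) F x + conv (helm k) G x := by
  unfold conv
  simp_rw [mul_add]
  exact integral_add (hF.integrable_helm_mul k x) (hG.integrable_helm_mul k x)

lemma conv_const_mul (ψ F : E3 → ℂ) (c : ℂ) (x : E3) :
    conv ψ (fun y => c * F y) x = c * conv ψ F x := by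
  unfold conv
  simp_rw [mul_left_comm _ c]
  exact integral_const_mul c _

/-- The volume potentials with bounded density, as compact operators on `C(K)`. -/
lemma exists_potential_operator {k M : ℝ} (hk : 0 ≤ k) (hM : 0 ≤ M) {K : Set E3}
    (hKc : IsCompact K) (hKM : K ⊆ Metric.closedBall 0 M) :
    ∃ C, 0 ≤ C ∧ ∀ q Q, AEStronglyMeasurable q volume → (∀ x, ‖q x‖ ≤ Q) →
      ∃ T : (K →ᵇ ℂ) →L[ℂ] (K →ᵇ ℂ),
        (∀ h (x : K), T h x = conv (helm k) (fun y => q y * zeroExt h y) x) ∧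
        ‖T‖ ≤ C * Q ∧ IsCompactOperator T := by
  obtain ⟨C, hC, hpot⟩ := exists_lipschitz_potential hk hM
  have : CompactSpace K := isCompact_iff_compactSpace.1 hKc
  refine ⟨C, hC, fun q Q hq hQ => ?_⟩
  have hQ0 : 0 ≤ Q := (norm_nonneg _).trans (hQ 0)
  have hsrc := fun h : K →ᵇ ℂ => isSource_mul_zeroExt hKc.measurableSet hKM hq hQ h
  have hbl : ∀ h : K →ᵇ ℂ, BddLip (C * (Q * ‖h‖)) (conv (helm k) fun y => q y * zeroExt h y) :=
    fun h => ⟨(hpot _ _ (hsrc h)).1, (hpot _ _ (hsrc h)).2⟩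
  let L : (K →ᵇ ℂ) →ₗ[ℂ] (K →ᵇ ℂ) :=
    { toFun := fun h => BoundedContinuousFunction.mkOfCompact
        ⟨fun x : K => conv (helm k) (fun y => q y * zeroExt h y) x,
          (hbl h).continuous.comp continuous_subtype_val⟩
      map_add' := fun g h => by
        ext x
        have e : (fun y => q y * zeroExt (g + h : K →ᵇ ℂ) y) =
            fun y => q y * zeroExt g y + q y * zeroExt h y := by
          funext y
          by_cases hy : y ∈ K
          · rw [show y = ((⟨y, hy⟩ : K) : E3) from rfl, zeroExt_apply, zeroExt_apply, zeroExt_apply,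
              ← mul_add]
            rfl
          · simp [zeroExt_of_notMem _ hy]
        change conv (helm k) (fun y => q y * zeroExt (g + h : K →ᵇ ℂ) y) x =
          conv (helm k) (fun y => q y * zeroExt g y) x + conv (helm k) (fun y => q y * zeroExt h y) x
        rw [e, conv_helm_add (hsrc g) (hsrc h)]
      map_smul' := fun c h => by
        ext x
        have e : (fun y => q y * zeroExt (c • h : K →ᵇ ℂ) y) =
            fun y => c * (q y * zeroExt h y) := by
          funext y
          by_cases hy : y ∈ K
          · rw [show y = ((⟨y, hy⟩ : K) : E3) from rfl, zeroExt_apply, zeroExt_apply,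
              BoundedContinuousFunction.smul_apply, smul_eq_mul]
            ring
          · simp [zeroExt_of_notMem _ hy]
        change conv (helm k) (fun y => q y * zeroExt (c • h : K →ᵇ ℂ) y) x =
          c * conv (helm k) (fun y => q y * zeroExt h y) x
        rw [e, conv_const_mul] }
  have hLb : ∀ h, ‖L h‖ ≤ C * Q * ‖h‖ := fun h => by
    rw [BoundedContinuousFunction.norm_le (by positivity), mul_assoc]
    exact fun x => (hbl h).bound x
  let T := L.mkContinuous (C * Q) hLb
  refine ⟨T, fun h x => rfl, L.mkContinuous_norm_le (by positivity) _, ?_⟩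
  change IsCompactOperator T.toLinearMap
  rw [isCompactOperator_iff_isCompact_closure_image_closedBall T.toLinearMap zero_lt_one]
  refine BoundedContinuousFunction.arzela_ascoli (Metric.closedBall (0 : ℂ) (C * Q))
    (isCompact_closedBall _ _) _ ?_ ?_
  · rintro _ x ⟨h, hh, rfl⟩
    rw [mem_closedBall_zero_iff] at hh ⊢
    refine ((hbl h).bound x).trans ?_
    have := mul_nonneg hC hQ0
    nlinarith
  · refine Metric.equicontinuous_of_continuity_modulus (fun r => C * Q * r) ?_ _ ?_
    · exact Continuous.tendsto' (by fun_prop) _ _ (by simp)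
    · rintro x y ⟨_, h, hh, rfl⟩
      rw [mem_closedBall_zero_iff] at hh
      rw [dist_eq_norm, Subtype.dist_eq, dist_eq_norm]
      refine ((hbl h).lip x y).trans (mul_le_mul_of_nonneg_right ?_ (norm_nonneg _))
      have := mul_nonneg hC hQ0
      nlinarith

/-- a function vanishing off an open set, Hölder on its closure, is Hölder on the whole space. -/
lemma holder_of_holder_closure {Ω : Set E3} (hΩ : IsOpen Ω) {G : E3 → ℂ} {α H : ℝ} (hα : 0 < α)
    (hH : 0 ≤ H) (h0 : ∀ x ∉ Ω, G x = 0)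
    (h : ∀ x ∈ closure Ω, ∀ y ∈ closure Ω, ‖G x - G y‖ ≤ H * ‖x - y‖ ^ α) (x y : E3) :
    ‖G x - G y‖ ≤ H * ‖x - y‖ ^ α := by
  have key : ∀ x ∈ Ω, ∀ y ∉ Ω, ‖G x‖ ≤ H * ‖x - y‖ ^ α := by
    intro x hx y hy
    obtain ⟨z, hz, hzf⟩ : ∃ z ∈ segment ℝ x y, z ∈ frontier Ω := by
      by_contra! hno
      have hcov : segment ℝ x y ⊆ Ω ∪ (closure Ω)ᶜ := fun z hz => by
        by_cases hzΩ : z ∈ Ω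
        · exact Or.inl hzΩ
        · refine Or.inr fun hzc => hno z hz ?_
          rw [hΩ.frontier_eq]
          exact ⟨hzc, hzΩ⟩
      obtain ⟨z, -, hz1, hz2⟩ := (convex_segment (𝕜 := ℝ) x y).isPreconnected _ _ hΩ
        isClosed_closure.isOpen_compl hcov ⟨x, left_mem_segment ℝ x y, hx⟩
        ⟨y, right_mem_segment ℝ x y,
          (hcov (right_mem_segment ℝ x y)).resolve_left hy⟩
      exact hz2 (subset_closure hz1)
    have hzK := frontier_subset_closure hzf
    have hzΩ : z ∉ Ω := by
      rw [hΩ.frontier_eq] at hzf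
      exact hzf.2
    have h1 := h x (subset_closure hx) z hzK
    rw [h0 z hzΩ, sub_zero] at h1
    refine h1.trans (mul_le_mul_of_nonneg_left ?_ hH)
    refine Real.rpow_le_rpow (norm_nonneg _) ?_ hα.le
    have := norm_sub_le_of_mem_segment hz
    rw [norm_sub_rev, norm_sub_rev x y]
    exact this
  by_cases hx : x ∈ Ω
  · by_cases hy : y ∈ Ω
    · exact h x (subset_closure hx) y (subset_closure hy)
    · rw [h0 y hy, sub_zero]
      exact key x hx y hy
  · rw [h0 x hx, zero_sub, norm_neg]
    by_cases hy : y ∈ Ω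
    · rw [norm_sub_rev]
      exact key y hy x hx
    · rw [h0 y hy, norm_zero]
      positivity

/-- Stability of the inverse of `1 - T` under small perturbations, for compact `T` without
nonzero fixed points. -/
lemma exists_stable_inverse {X : Type*} [NormedAddCommGroup X] [NormedSpace ℂ X] [CompleteSpace X]
    {T : X →L[ℂ] X} (hT : IsCompactOperator T) (hinj : ∀ d, T d = d → d = 0) :
    ∃ ε > 0, ∃ N ≥ 0, ∀ D : X →L[ℂ] X, ‖D‖ ≤ ε →
      (∀ d, ‖d‖ ≤ N * ‖d - (T d + D d)‖) ∧ ∀ g, ∃ d, d - (T d + D d) = g := by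
  have hres : (1 : ℂ) ∈ resolventSet ℂ T := by
    refine (hT.hasEigenvalue_or_mem_resolventSet one_ne_zero).resolve_left fun h => ?_
    obtain ⟨d, hd⟩ := h.exists_hasEigenvector
    refine hd.2 (hinj d ?_)
    simpa using hd.apply_eq_smul
  have hunit : IsUnit (1 - T) := by
    rw [spectrum.mem_resolventSet_iff, map_one] at hres
    exact hres
  obtain ⟨U, hU⟩ := hunit
  obtain ⟨ε, hε, hball⟩ := Metric.isOpen_iff.1 (Units.isOpen (R := X →L[ℂ] X)) (1 - T) ⟨U, hU⟩
  set N : ℝ := ‖((U⁻¹ : (X →L[ℂ] X)ˣ) : X →L[ℂ] X)‖ with hN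
  have hN0 : 0 ≤ N := norm_nonneg _
  have hbd : ∀ d, ‖d‖ ≤ N * ‖d - T d‖ := fun d => by
    have e : ((U⁻¹ : (X →L[ℂ] X)ˣ) : X →L[ℂ] X) (d - T d) = d := by
      have : d - T d = (U : X →L[ℂ] X) d := by rw [hU]; rfl
      rw [this, ← mul_apply_eq_comp, Units.inv_mul]
      rfl
    calc ‖d‖ = ‖((U⁻¹ : (X →L[ℂ] X)ˣ) : X →L[ℂ] X) (d - T d)‖ := by rw [e]
      _ ≤ _ := ContinuousLinearMap.le_opNorm _ _
  refine ⟨min (ε / 2) (1 / (2 * (N + 1))), by positivity, 2 * N, by positivity, fun D hD => ⟨?_, ?_⟩⟩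
  · intro d
    have h1 : N * ‖D‖ ≤ 1 / 2 := by
      have := mul_le_mul_of_nonneg_left (hD.trans (min_le_right _ _)) hN0
      refine this.trans ?_
      rw [mul_one_div, div_le_div_iff₀ (by positivity) (by norm_num)]
      linarith
    have h2 : ‖d - T d‖ ≤ ‖d - (T d + D d)‖ + ‖D‖ * ‖d‖ := by
      have : d - T d = (d - (T d + D d)) + D d := by abel
      rw [this]
      exact (norm_add_le _ _).trans (add_le_add_right (D.le_opNorm d) _)
    have h3 := hbd d
    have h4 := mul_le_mul_of_nonneg_left h2 hN0
    have h5 := mul_le_mul_of_nonneg_right h1 (norm_nonneg d)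
    nlinarith
  · intro g
    have hu : IsUnit (1 - T - D) := hball (by
      rw [Metric.mem_ball, dist_eq_norm]
      have : 1 - T - D - (1 - T) = -D := by abel
      rw [this, norm_neg]
      linarith [hD.trans (min_le_left _ _)])
    obtain ⟨d, hd⟩ := (ContinuousLinearMap.isUnit_iff_bijective.1 hu).2 g
    refine ⟨d, ?_⟩
    rw [← hd]
    simp [sub_sub]

lemma IsSource.add {M A B : ℝ} {F G : E3 → ℂ} (hF : IsSource M A F) (hG : IsSource M B G) :
    IsSource M (A + B) fun x => F x + G x where
  meas := hF.meas.add hG.meas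
  bound x := (norm_add_le _ _).trans (add_le_add (hF.bound x) (hG.bound x))
  supp x hx := by rw [hF.supp x hx, hG.supp x hx, add_zero]

lemma BddLip.add {C D : ℝ} {f g : E3 → ℂ} (hf : BddLip C f) (hg : BddLip D g) :
    BddLip (C + D) fun x => f x + g x := by
  refine ⟨fun x => (norm_add_le _ _).trans (add_le_add (hf.bound x) (hg.bound x)), fun x y => ?_⟩
  rw [add_sub_add_comm, add_mul]
  exact (norm_add_le _ _).trans (add_le_add (hf.lip x y) (hg.lip x y))

lemma BddLip.mono {C D : ℝ} {f : E3 → ℂ} (hf : BddLip C f) (h : C ≤ D) : BddLip D f :=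
  ⟨fun x => (hf.bound x).trans h,
    fun x y => (hf.lip x y).trans (mul_le_mul_of_nonneg_right h (norm_nonneg _))⟩

/-- Product of a small Hölder function with a bounded Lipschitz function. -/
lemma holder_mul_bddLip {α : ℝ} (hα : α ∈ Ioo (0 : ℝ) 1) {σ f : E3 → ℂ} {θ H C : ℝ} (hH : 0 ≤ H)
    (hθ : 0 ≤ θ) (hσ : ∀ x, ‖σ x‖ ≤ θ) (hσH : ∀ x y, ‖σ x - σ y‖ ≤ H * θ * ‖x - y‖ ^ α)
    (hf : BddLip C f) (x y : E3) :
    ‖σ x * f x - σ y * f y‖ ≤ (H + 2) * C * θ * ‖x - y‖ ^ α := by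
  have hC := hf.nonneg
  have hr : 0 ≤ ‖x - y‖ ^ α := by positivity
  refine (norm_mul_sub_mul_le _ _ _ _).trans ?_
  have h1 := mul_le_mul (hσH x y) (hf.bound x) (norm_nonneg _) (by positivity)
  have h2 := mul_le_mul (hσ y) (holder_of_bound_of_lipschitz hα hf.bound hf.lip x y)
    (norm_nonneg _) hθ
  linarith

theorem lippmann_schwinger_stability {α : ℝ} (hα : α ∈ Ioo (0 : ℝ) 1) {k M L U H : ℝ} (hk : 0 < k)
    (hM : 0 ≤ M) (hH : 0 ≤ H) {K : Set E3} (hKc : IsCompact K) (hKM : K ⊆ Metric.closedBall 0 M)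
    {β : E3 → ℝ} (hβ : BddLip L fun x => (β x : ℂ)) (hβ0 : ∀ x ∉ K, β x = 0)
    {us : E3 → ℂ} (hus : BddLip U us) :
    ∃ ε > 0, ∃ Z > 0, ∀ θ ∈ Ioo 0 ε, ∀ σ : E3 → ℂ, Continuous σ → (∀ x, ‖σ x‖ ≤ θ) →
      (∀ x y, ‖σ x - σ y‖ ≤ H * θ * ‖x - y‖ ^ α) → (∀ x ∉ K, σ x = 0) →
      (∃ D : E3 → ℂ,
        (∀ x, D x = conv (helm k)
          (fun y => (k : ℂ) ^ 2 * ((β y + σ y) * D y + σ y * us y)) x) ∧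
        BddLip Z D ∧ ContDiff ℝ 2 D ∧ ∀ l : List (Fin 3), l.length ≤ 2 →
          (∀ x, ‖pderList l D x‖ ≤ Z * θ) ∧
          ∀ x y, ‖pderList l D x - pderList l D y‖ ≤ Z * θ * ‖x - y‖ ^ α) ∧
      ∀ e : E3 → ℂ, ContinuousOn e K →
        (∀ x ∈ K, e x = conv (helm k) (fun y => (k : ℂ) ^ 2 * ((β y + σ y) * e y)) x) →
        ∀ x ∈ K, e x = 0 := by
  have hcs : CompactSpace K := isCompact_iff_compactSpace.1 hKc
  have hL := hβ.nonneg
  have hU := hus.nonneg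
  have hsuppM : ∀ x : E3, M < ‖x‖ → x ∉ K := fun x hx hxK => by
    have := hKM hxK
    rw [mem_closedBall_zero_iff] at this
    linarith
  obtain ⟨C, hC, hop⟩ := exists_potential_operator hk.le hM hKc hKM
  obtain ⟨C₁, hC₁, hpot⟩ := exists_lipschitz_potential hk.le hM
  obtain ⟨C₂, hC₂, hsch⟩ := exists_schauder_potential hα hk.le hM
  have hq0 := hβ.const_mul ((k : ℂ) ^ 2)
  have hnk : ‖(k : ℂ) ^ 2‖ = k ^ 2 := by
    rw [norm_pow, Complex.norm_real, Real.norm_of_nonneg hk.le]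
  obtain ⟨T, hT, -, hTc⟩ := hop _ _ hq0.continuous.aestronglyMeasurable hq0.bound
  have hinj : ∀ d, T d = d → d = 0 := by
    intro d hd
    have hsrc := isSource_mul_zeroExt hKc.measurableSet hKM
      hq0.continuous.aestronglyMeasurable hq0.bound d
    set v := conv (helm k) fun y => (k : ℂ) ^ 2 * β y * zeroExt d y with hv
    have hvl : BddLip _ v := ⟨(hpot _ _ hsrc).1, (hpot _ _ hsrc).2⟩
    have hvd : ∀ x : K, v x = d x := fun x => by
      rw [hv, ← hT, hd]
    have hz := eq_zero_of_lippmann_schwinger hk hM hβ (fun x hx => hβ0 x (hsuppM x hx))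
      hvl.continuous (fun x => by
        rw [hv]
        congr 1
        funext y
        by_cases hy : y ∈ K
        · have h1 := hvd ⟨y, hy⟩
          have h2 := zeroExt_apply d ⟨y, hy⟩
          dsimp only at h1 h2
          rw [← hv, h1, h2]
        · simp [hβ0 y hy])
    ext x
    rw [← hvd, hz]
    rfl
  obtain ⟨ε₁, hε₁, N, hN, hstab⟩ := exists_stable_inverse hTc hinj
  set a : ℝ := N * (C * k ^ 2 * U) with ha
  have ha0 : 0 ≤ a := by positivity
  set b : ℝ := k ^ 2 * ((L + 1) * a + U) with hb
  have hb0 : 0 ≤ b := by positivity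
  set h : ℝ := k ^ 2 * (4 * L * (C₁ * b) + (H + 2) * (C₁ * b + U)) with hh
  have hh0 : 0 ≤ h := by positivity
  refine ⟨min 1 (ε₁ / (C * k ^ 2 + 1)), by positivity, C₂ * (b + h) + C₁ * b + 1, by positivity, ?_⟩
  rintro θ ⟨hθ0, hθ⟩ σ hσc hσ hσH hσ0
  have hθ1 : θ ≤ 1 := hθ.le.trans (min_le_left _ _)
  have hθ2 : C * (k ^ 2 * θ) ≤ ε₁ := by
    have := hθ.le.trans (min_le_right _ _)
    rw [le_div_iff₀ (by positivity)] at this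
    nlinarith
  have hqσ : ∀ x, ‖(k : ℂ) ^ 2 * σ x‖ ≤ k ^ 2 * θ := fun x => by
    rw [norm_mul, hnk]
    exact mul_le_mul_of_nonneg_left (hσ x) (by positivity)
  have hqσc : Continuous fun x => (k : ℂ) ^ 2 * σ x := by fun_prop
  obtain ⟨S, hS, hSn, -⟩ := hop _ _ hqσc.aestronglyMeasurable hqσ
  obtain ⟨hbd, hsurj⟩ := hstab S (hSn.trans hθ2)
  have hsT := fun d : K →ᵇ ℂ => isSource_mul_zeroExt hKc.measurableSet hKM
      hq0.continuous.aestronglyMeasurable hq0.bound d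
  have hsS := fun d : K →ᵇ ℂ => isSource_mul_zeroExt hKc.measurableSet hKM
      hqσc.aestronglyMeasurable hqσ d
  constructor
  · let uK : K →ᵇ ℂ := BoundedContinuousFunction.mkOfCompact
      ⟨fun x : K => us x, hus.continuous.comp continuous_subtype_val⟩
    have huK : ‖uK‖ ≤ U := (BoundedContinuousFunction.norm_le hU).2 fun x => hus.bound x
    obtain ⟨d, hd⟩ := hsurj (S uK)
    have hdn : ‖d‖ ≤ a * θ := by
      refine (hbd d).trans ?_
      rw [hd]
      have h1 : ‖S uK‖ ≤ C * (k ^ 2 * θ) * U :=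
        (S.le_opNorm _).trans (mul_le_mul hSn huK (norm_nonneg _) (by positivity))
      have := mul_le_mul_of_nonneg_left h1 hN
      rw [ha]
      linarith
    set F : E3 → ℂ := fun y => (k : ℂ) ^ 2 * β y * zeroExt d y + (k : ℂ) ^ 2 * σ y * zeroExt d y +
      (k : ℂ) ^ 2 * σ y * zeroExt uK y with hF
    have hFsrc : IsSource M (b * θ) F := by
      have hs := ((hsT d).add (hsS d)).add (hsS uK)
      refine ⟨hs.meas, fun x => (hs.bound x).trans ?_, hs.supp⟩
      rw [hnk]
      have e1 : k ^ 2 * L * ‖d‖ ≤ k ^ 2 * L * (a * θ) := mul_le_mul_of_nonneg_left hdn (by positivity)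
      have e2 : k ^ 2 * θ * ‖d‖ ≤ k ^ 2 * 1 * (a * θ) :=
        mul_le_mul (by gcongr) hdn (norm_nonneg _) (by positivity)
      have e3 : k ^ 2 * θ * ‖uK‖ ≤ k ^ 2 * θ * U := mul_le_mul_of_nonneg_left huK (by positivity)
      rw [hb]
      linarith
    set D := conv (helm k) F with hD
    have hDl : BddLip (C₁ * (b * θ)) D := ⟨(hpot _ _ hFsrc).1, (hpot _ _ hFsrc).2⟩
    have hDd : ∀ x : K, D x = d x := fun x => by
      have e : D x = T d x + S d x + S uK x := by
        rw [hT, hS, hS, hD, hF, conv_helm_add ((hsT d).add (hsS d)) (hsS uK),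
          conv_helm_add (hsT d) (hsS d)]
      have e2 : d = S uK + (T d + S d) := eq_add_of_sub_eq hd
      rw [e]
      conv_rhs => rw [e2]
      simp only [BoundedContinuousFunction.add_apply]
      ring
    have hF2 : F = fun y => (k : ℂ) ^ 2 * ((β y + σ y) * D y + σ y * us y) := by
      funext y
      by_cases hy : y ∈ K
      · have h1 := hDd ⟨y, hy⟩
        have h2 := zeroExt_apply d ⟨y, hy⟩
        have h3 := zeroExt_apply uK ⟨y, hy⟩
        dsimp only at h1 h2 h3
        rw [hF]
        dsimp only
        rw [h1, h2, h3]
        change _ + _ * us y = _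
        ring
      · simp [hF, hβ0 y hy, hσ0 y hy]
    have hDl1 : BddLip (C₁ * b) D := hDl.mono (by
      have := mul_nonneg hC₁ hb0
      nlinarith)
    have hFH : ∀ x y, ‖F x - F y‖ ≤ h * θ * ‖x - y‖ ^ α := by
      intro x y
      have h1 := holder_of_bound_of_lipschitz hα (hβ.mul hDl).bound (hβ.mul hDl).lip x y
      have h2 := holder_mul_bddLip hα hH hθ0.le hσ hσH (hDl1.add hus) x y
      have e : F x - F y = (k : ℂ) ^ 2 * ((β x * D x - β y * D y) +
          (σ x * (D x + us x) - σ y * (D y + us y))) := by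
        rw [hF2]
        ring
      rw [e, norm_mul, hnk]
      have h3 := mul_le_mul_of_nonneg_left ((norm_add_le _ _).trans (add_le_add h1 h2)) (sq_nonneg k)
      refine h3.trans (le_of_eq ?_)
      rw [hh]
      ring
    obtain ⟨hD2, -, -, hDb⟩ := hsch F _ _ hFsrc (by positivity) hFH
    have hZ : C₂ * (b * θ + h * θ) ≤ (C₂ * (b + h) + C₁ * b + 1) * θ := by
      have := mul_nonneg (mul_nonneg hC₁ hb0) hθ0.le
      linarith
    refine ⟨D, fun x => ?_, hDl1.mono ?_, hD2, fun l hl => ⟨fun x => ?_, fun x y => ?_⟩⟩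
    · rw [← hF2]
    · have := mul_nonneg hC₂ (add_nonneg hb0 hh0)
      linarith
    · exact ((hDb l hl).1 x).trans hZ
    · exact ((hDb l hl).2 x y).trans (mul_le_mul_of_nonneg_right hZ (by positivity))
  · intro e hec he x hx
    let eK : K →ᵇ ℂ := BoundedContinuousFunction.mkOfCompact
      ⟨fun x : K => e x, continuousOn_iff_continuous_domRestrict.1 hec⟩
    have hfix : eK - (T eK + S eK) = 0 := by
      ext z
      change e z - (T eK z + S eK z) = 0
      rw [hT, hS, ← conv_helm_add (hsT eK) (hsS eK), he z z.2, sub_eq_zero]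
      congr 1
      funext y
      by_cases hy : y ∈ K
      · have h2 := zeroExt_apply eK ⟨y, hy⟩
        dsimp only at h2
        rw [h2]
        change _ = _ * e y + _ * e y
        ring
      · simp [hβ0 y hy, hσ0 y hy]
    have h0 := hbd eK
    rw [hfix, norm_zero, mul_zero] at h0
    have : eK = 0 := norm_le_zero_iff.1 h0
    exact congrArg (fun f : K →ᵇ ℂ => f ⟨x, hx⟩) this

lemma setIntegral_Phi_eq_conv {Ω : Set E3} (k : ℝ) {q : E3 → ℂ} (hq : ∀ y ∉ Ω, q y = 0)
    (u : E3 → ℂ) (x : E3) :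
    ∫ y in Ω, Phi k x y * q y * u y = conv (helm k) (fun y => q y * u y) x := by
  rw [setIntegral_eq_integral_of_forall_compl_eq_zero fun y hy => by rw [hq y hy]; ring]
  unfold conv
  simp_rw [← mul_assoc]
  rfl

lemma exists_isSource_mul {K : Set E3} {M : ℝ} (hKc : IsCompact K)
    (hKM : K ⊆ Metric.closedBall 0 M) {q u : E3 → ℂ} (hq : Continuous q) (hq0 : ∀ x ∉ K, q x = 0)
    (hu : ContinuousOn u K) : ∃ A, IsSource M A fun y => q y * u y := by
  have hcs : CompactSpace K := isCompact_iff_compactSpace.1 hKc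
  obtain ⟨Q, hQ⟩ := (HasCompactSupport.intro hKc hq0).exists_bound_of_continuous hq
  let uK : K →ᵇ ℂ := BoundedContinuousFunction.mkOfCompact
    ⟨fun x : K => u x, continuousOn_iff_continuous_domRestrict.1 hu⟩
  have e : (fun y => q y * u y) = fun y => q y * zeroExt uK y := by
    funext y
    by_cases hy : y ∈ K
    · have h2 := zeroExt_apply uK ⟨y, hy⟩
      dsimp only at h2
      rw [h2]
      rfl
    · simp [hq0 y hy]
  rw [e]
  exact ⟨_, isSource_mul_zeroExt hKc.measurableSet hKM hq.aestronglyMeasurable hQ uK⟩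

lemma conv_helm_sub_source {M A B k : ℝ} {F G : E3 → ℂ} (hF : IsSource M A F) (hG : IsSource M B G)
    (x : E3) : conv (helm k) (fun y => F y - G y) x = conv (helm k) F x - conv (helm k) G x := by
  unfold conv
  simp_rw [mul_sub]
  exact integral_sub (hF.integrable_helm_mul k x) (hG.integrable_helm_mul k x)

lemma pderList_add_of_contDiff_two {f g : E3 → ℂ} (hf : ContDiff ℝ 2 f) (hg : ContDiff ℝ 2 g)
    {l : List (Fin 3)} (hl : l.length ≤ 2) :
    pderList l (fun x => f x + g x) = fun x => pderList l f x + pderList l g x := by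
  have h1 : ∀ i, pder i (fun x => f x + g x) = fun x => pder i f x + pder i g x := fun i =>
    funext fun x => pder_add (hf.differentiable (by norm_num) x)
      (hg.differentiable (by norm_num) x) i
  match l, hl with
  | [], _ => rfl
  | [i], _ => exact h1 i
  | [i, j], _ =>
    funext x
    change pder i (pder j fun x => f x + g x) x = pder i (pder j f) x + pder i (pder j g) x
    rw [h1 j]
    exact pder_add ((contDiff_pder (m := 1) (by norm_num) hf j).differentiable (by norm_num) x)
      ((contDiff_pder (m := 1) (by norm_num) hg j).differentiable (by norm_num) x) i

lemma bddAbove_supSet {f : E3 → ℂ} {S : Set E3} {B : ℝ} (h : ∀ x ∈ S, ‖f x‖ ≤ B) :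
    BddAbove (supSet f S) := ⟨B, by rintro _ ⟨x, hx, rfl⟩; exact h x hx⟩

lemma le_of_mem_holderSet {α : ℝ} {f : E3 → ℂ} {S : Set E3} {B : ℝ}
    (h : ∀ x ∈ S, ∀ y ∈ S, ‖f x - f y‖ ≤ B * ‖x - y‖ ^ α) : ∀ r ∈ holderSet α f S, r ≤ B := by
  rintro _ ⟨x, hx, y, hy, hxy, rfl⟩
  have : 0 < ‖x - y‖ := norm_pos_iff.2 (sub_ne_zero.2 hxy)
  rw [div_le_iff₀ (by positivity)]
  exact h x hx y hy

lemma norm_sub_le_of_holderSet {α : ℝ} {f : E3 → ℂ} {S : Set E3} {B : ℝ}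
    (h : ∀ r ∈ holderSet α f S, r ≤ B) (x : E3) (hx : x ∈ S) (y : E3) (hy : y ∈ S) (hB : 0 ≤ B) :
    ‖f x - f y‖ ≤ B * ‖x - y‖ ^ α := by
  by_cases hxy : x = y
  · subst hxy
    rw [sub_self, norm_zero]
    positivity
  have : 0 < ‖x - y‖ := norm_pos_iff.2 (sub_ne_zero.2 hxy)
  rw [← div_le_iff₀ (by positivity)]
  exact h _ ⟨x, hx, y, hy, hxy, rfl⟩

lemma hNorm_le {α : ℝ} {f : E3 → ℂ} {S : Set E3} {B : ℝ} (hB : 0 ≤ B) (h0 : ∀ x ∈ S, ‖f x‖ ≤ B)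
    (h : ∀ x ∈ S, ∀ y ∈ S, ‖f x - f y‖ ≤ B * ‖x - y‖ ^ α) : hNorm α f S ≤ 2 * B := by
  have h1 : sSup (supSet f S) ≤ B :=
    Real.sSup_le (by rintro _ ⟨x, hx, rfl⟩; exact h0 x hx) hB
  have h2 : sSup (holderSet α f S) ≤ B := Real.sSup_le (le_of_mem_holderSet h) hB
  unfold hNorm
  linarith

lemma cNorm_two_le {α : ℝ} {f : E3 → ℂ} {S : Set E3} {B : ℝ} (hB : 0 ≤ B)
    (h : ∀ l : List (Fin 3), l.length ≤ 2 → (∀ x, ‖pderList l f x‖ ≤ B) ∧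
      ∀ x y, ‖pderList l f x - pderList l f y‖ ≤ B * ‖x - y‖ ^ α) :
    cNorm 2 α f S ≤ 26 * B := by
  unfold cNorm
  have : ∀ k ∈ Finset.range (2 + 1), ∑ γ : Fin k → Fin 3, hNorm α (pderList (List.ofFn γ) f) S ≤
      ∑ γ : Fin k → Fin 3, 2 * B := fun k hk => Finset.sum_le_sum fun γ _ => by
    have hl := h (List.ofFn γ) (by
      rw [List.length_ofFn]
      exact Nat.lt_succ_iff.1 (Finset.mem_range.1 hk))
    exact hNorm_le hB (fun x _ => hl.1 x) fun x _ y _ => hl.2 x y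
  refine (Finset.sum_le_sum this).trans ?_
  simp [Finset.sum_range_succ]
  linarith

lemma bounds_of_hNorm_le {α θ : ℝ} {f : E3 → ℂ} {S : Set E3} (h0 : BddAbove (supSet f S))
    (h1 : BddAbove (holderSet α f S)) (h : hNorm α f S ≤ θ) :
    (∀ x ∈ S, ‖f x‖ ≤ θ) ∧ ∀ r ∈ holderSet α f S, r ≤ θ := by
  have p0 : 0 ≤ sSup (supSet f S) :=
    Real.sSup_nonneg (by rintro _ ⟨x, _, rfl⟩; exact norm_nonneg _)
  have p1 : 0 ≤ sSup (holderSet α f S) :=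
    Real.sSup_nonneg (by rintro _ ⟨x, _, y, _, _, rfl⟩; positivity)
  unfold hNorm at h
  refine ⟨fun x hx => ?_, fun r hr => ?_⟩
  · have := le_csSup h0 ⟨x, hx, rfl⟩
    dsimp only at this
    linarith
  · have := le_csSup h1 hr
    linarith

lemma InHolder.exists_bddLip {α : ℝ} {u : E3 → ℂ} (hu : InHolder 2 α u univ) :
    ∃ U, BddLip U u := by
  obtain ⟨-, hd, hb⟩ := hu
  have hd' : ContDiff ℝ 2 u := contDiffOn_univ.1 hd
  obtain ⟨B₀, hB₀⟩ := (hb 0 (by norm_num) Fin.elim0).1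
  have h0 : ∀ x, ‖u x‖ ≤ B₀ := fun x => hB₀ ⟨x, mem_univ x, rfl⟩
  choose B hB using fun i : Fin 3 => (hb 1 (by norm_num) fun _ => i).1
  have h1 : ∀ i x, ‖pder i u x‖ ≤ ∑ j, |B j| := fun i x =>
    (hB i ⟨x, mem_univ x, by simp [pderList]⟩ : ‖pder i u x‖ ≤ B i).trans
      ((le_abs_self _).trans (Finset.single_le_sum (f := fun j => |B j|)
        (fun j _ => abs_nonneg _) (Finset.mem_univ i)))
  refine ⟨max B₀ (3 * ∑ j, |B j|), fun x => (h0 x).trans (le_max_left _ _), fun x y => ?_⟩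
  exact (dist_le_of_pder_bound (hd'.differentiable (by norm_num)) h1 x y).trans
    (mul_le_mul_of_nonneg_right (le_max_right _ _) (norm_nonneg _))

lemma continuous_of_holder {α H : ℝ} (hα : 0 < α) {f : E3 → ℂ}
    (h : ∀ x y, ‖f x - f y‖ ≤ H * ‖x - y‖ ^ α) : Continuous f := by
  refine continuous_iff_continuousAt.2 fun x => ?_
  rw [ContinuousAt, tendsto_iff_norm_sub_tendsto_zero]
  refine squeeze_zero (fun _ => norm_nonneg _) (fun y => h y x) ?_
  have : Continuous fun y => H * ‖y - x‖ ^ α :=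
    continuous_const.mul ((by fun_prop : Continuous fun y => ‖y - x‖).rpow_const
      fun _ => Or.inr hα.le)
  have h2 := this.tendsto x
  simpa [Real.zero_rpow hα.ne'] using h2

end

/-- Theorem 4.1. Stability of the Lippmann–Schwinger equation under
perturbations `ρ̂ = χρ` of `β*`: if `|ρ − β*|_α ≤ θ < θ*`, the perturbed equation has a unique
solution `u_ρ ∈ C^α(Ω̄)`, which lies in `C^{2+α}(ℝ³)` and satisfies
`|u_ρ − u*(·,k̄)|_{2+α} ≤ Z*θ`. -/
theorem statement9 (α : ℝ) (hα : α ∈ Set.Ioo (0 : ℝ) 1)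
    (Ω₁ Ω : Set E3) (hΩ₁o : IsOpen Ω₁) (hΩo : IsOpen Ω)
    (hΩ₁conn : IsConnected Ω₁) (hΩconn : IsConnected Ω)
    (hΩb : Bornology.IsBounded Ω) (hΩconv : Convex ℝ Ω)
    (hsub : closure Ω₁ ⊆ Ω)
    (hbdry : HolderBoundary 2 α Ω) (hbdry₁ : HolderBoundary 2 α Ω₁)
    (βs : E3 → ℝ) (hc15 : ContDiff ℝ 15 (fun x => (1 : ℝ) + βs x))
    (hβpos : ∀ x, 0 ≤ βs x) (hβ0 : ∀ x ∉ Ω₁, βs x = 0)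
    (kbar : ℝ) (hk : 0 < kbar)
    (us : E3 → ℂ) (hus : InHolder 2 α us Set.univ)
    (husLS : ∀ x : E3, us x = planeWave kbar x +
      (kbar : ℂ) ^ 2 * ∫ y in Ω, Phi kbar x y * (βs y : ℂ) * us y)
    (χ : E3 → ℝ) (hχ : ContDiff ℝ 2 χ) (hχ1 : ∀ x ∈ Ω₁, χ x = 1)
    (hχ01 : ∀ x : E3, 0 ≤ χ x ∧ χ x ≤ 1) (hχ0 : ∀ x ∉ Ω, χ x = 0) :
    ∃ θs : ℝ, θs ∈ Set.Ioo (0 : ℝ) 1 ∧ ∃ Zs : ℝ, 0 < Zs ∧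
      ∀ θ : ℝ, θ ∈ Set.Ioo 0 θs →
      ∀ ρ : E3 → ℂ, InHolder 0 α ρ (closure Ω) →
        hNorm α (fun x => ρ x - (βs x : ℂ)) (closure Ω) ≤ θ →
        ∃ uρ : E3 → ℂ,
          ((∀ x : E3, uρ x = planeWave kbar x +
              (kbar : ℂ) ^ 2 * ∫ y in Ω, Phi kbar x y * ((χ y : ℂ) * ρ y) * uρ y) ∧
            InHolder 2 α uρ Set.univ ∧
            cNorm 2 α (fun x => uρ x - us x) (closure Ω) ≤ Zs * θ) ∧
          ∀ u' : E3 → ℂ, InHolder 0 α u' (closure Ω) →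
            (∀ x ∈ closure Ω, u' x = planeWave kbar x +
              (kbar : ℂ) ^ 2 * ∫ y in Ω, Phi kbar x y * ((χ y : ℂ) * ρ y) * u' y) →
            Set.EqOn u' uρ (closure Ω) := by
  have hKc : IsCompact (closure Ω) := hΩb.isCompact_closure
  obtain ⟨M, hM, hKM⟩ : ∃ M, 0 ≤ M ∧ closure Ω ⊆ Metric.closedBall 0 M := by
    obtain ⟨M, hM⟩ := hKc.isBounded.subset_closedBall (0 : E3)
    exact ⟨max M 0, le_max_right _ _, hM.trans (Metric.closedBall_subset_closedBall (le_max_left _ _))⟩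
  have hβΩ : ∀ x ∉ Ω, βs x = 0 := fun x hx => hβ0 x fun h => hx (hsub (subset_closure h))
  have hβd : ContDiff ℝ 1 βs := by
    have := (hc15.sub (contDiff_const (c := (1 : ℝ)))).of_le (m := 1) (by norm_num)
    simpa using this
  obtain ⟨L, hβL⟩ := exists_bddLip_of_contDiff hβd
    (HasCompactSupport.intro hKc fun x hx => hβΩ x fun h => hx (subset_closure h))
  obtain ⟨X, hχL⟩ := exists_bddLip_of_contDiff (hχ.of_le (m := 1) (by norm_num))
    (HasCompactSupport.intro hKc fun x hx => hχ0 x fun h => hx (subset_closure h))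
  obtain ⟨U, husL⟩ := hus.exists_bddLip
  have hus2 : ContDiff ℝ 2 us := contDiffOn_univ.1 hus.2.1
  have hX := hχL.nonneg
  obtain ⟨ε, hε, Z, hZ, hmain⟩ := lippmann_schwinger_stability hα hk hM
    (H := 2 * X + 1) (by positivity) hKc hKM hβL
    (fun x hx => hβΩ x fun h => hx (subset_closure h)) husL
  refine ⟨min ε (1 / 2), ⟨by positivity, by
    have := min_le_right ε (1 / 2)
    linarith⟩, 26 * Z, by positivity, ?_⟩
  rintro θ ⟨hθ0, hθ⟩ ρ hρ hρθ
  have hρ0 := hρ.2.2 0 le_rfl Fin.elim0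
  obtain ⟨⟨Bρ, hBρ⟩, ⟨Hρ, hHρ⟩⟩ := hρ0
  have hρb : ∀ x ∈ closure Ω, ‖ρ x‖ ≤ Bρ := fun x hx => hBρ ⟨x, hx, rfl⟩
  have hρH : ∀ x ∈ closure Ω, ∀ y ∈ closure Ω, ‖ρ x - ρ y‖ ≤ max Hρ 0 * ‖x - y‖ ^ α :=
    fun x hx y hy => norm_sub_le_of_holderSet
      (fun r hr => (hHρ hr).trans (le_max_left _ _)) x hx y hy (le_max_right _ _)
  have hβH := holder_of_bound_of_lipschitz hα hβL.bound hβL.lip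
  obtain ⟨hτ, hτH⟩ := bounds_of_hNorm_le
    (bddAbove_supSet (B := Bρ + L) fun x hx =>
      (norm_sub_le _ _).trans (add_le_add (hρb x hx) (hβL.bound x)))
    ⟨max Hρ 0 + 2 * L, le_of_mem_holderSet fun x hx y hy => by
      rw [sub_sub_sub_comm, add_mul]
      exact (norm_sub_le _ _).trans (add_le_add (hρH x hx y hy) (hβH x y))⟩ hρθ
  set σ : E3 → ℂ := fun x => (χ x : ℂ) * (ρ x - βs x) with hσdef
  have hσΩ : ∀ x ∉ Ω, σ x = 0 := fun x hx => by simp [hσdef, hχ0 x hx]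
  have hχb : ∀ x, ‖(χ x : ℂ)‖ ≤ 1 := fun x => by
    rw [Complex.norm_real, Real.norm_of_nonneg (hχ01 x).1]
    exact (hχ01 x).2
  have hσb : ∀ x, ‖σ x‖ ≤ θ := fun x => by
    by_cases hx : x ∈ Ω
    · rw [hσdef]
      dsimp only
      rw [norm_mul]
      have := mul_le_mul (hχb x) (hτ x (subset_closure hx)) (norm_nonneg _) zero_le_one
      linarith
    · rw [hσΩ x hx, norm_zero]
      exact hθ0.le
  have hσH : ∀ x y, ‖σ x - σ y‖ ≤ (2 * X + 1) * θ * ‖x - y‖ ^ α := by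
    refine holder_of_holder_closure hΩo hα.1 (by positivity) hσΩ fun x hx y hy => ?_
    refine (norm_mul_sub_mul_le _ _ _ _).trans ?_
    have h1 := mul_le_mul (holder_of_bound_of_lipschitz hα hχL.bound hχL.lip x y) (hτ x hx)
      (norm_nonneg _) (by positivity)
    have h2 := mul_le_mul (hχb y) (norm_sub_le_of_holderSet hτH x hx y hy hθ0.le)
      (norm_nonneg _) zero_le_one
    linarith
  have hσc : Continuous σ := continuous_of_holder hα.1 hσH
  obtain ⟨⟨D, hD, hDl, hD2, hDb⟩, huniq⟩ := hmain θ ⟨hθ0, hθ.trans_le (min_le_left _ _)⟩ σ hσc hσb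
    hσH fun x hx => hσΩ x fun h => hx (subset_closure h)
  have hq : ∀ y, (χ y : ℂ) * ρ y = βs y + σ y := fun y => by
    by_cases hy : y ∈ Ω₁
    · simp [hσdef, hχ1 y hy]
    · simp [hσdef, hβ0 y hy]
  have hqΩ : ∀ y ∉ Ω, (βs y : ℂ) + σ y = 0 := fun y hy => by simp [hσΩ y hy, hβΩ y hy]
  have hqK : ∀ y ∉ closure Ω, (βs y : ℂ) + σ y = 0 := fun y hy =>
    hqΩ y fun h => hy (subset_closure h)
  have hqc : Continuous fun y => (βs y : ℂ) + σ y := hβL.continuous.add hσc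
  have hconv : ∀ (u : E3 → ℂ) x, ∫ y in Ω, Phi kbar x y * ((χ y : ℂ) * ρ y) * u y =
      conv (helm kbar) (fun y => ((βs y : ℂ) + σ y) * u y) x := fun u x => by
    simp_rw [hq]
    exact setIntegral_Phi_eq_conv kbar hqΩ u x
  have husc : ∀ x, us x = planeWave kbar x +
      (kbar : ℂ) ^ 2 * conv (helm kbar) (fun y => (βs y : ℂ) * us y) x := fun x => by
    rw [← setIntegral_Phi_eq_conv (Ω := Ω) kbar fun y hy => by rw [hβΩ y hy, Complex.ofReal_zero]]
    exact husLS x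
  have hcu : Continuous fun x => us x + D x := husL.continuous.add hDl.continuous
  have hLS : ∀ x, us x + D x = planeWave kbar x + (kbar : ℂ) ^ 2 *
      conv (helm kbar) (fun y => ((βs y : ℂ) + σ y) * (us y + D y)) x := by
    intro x
    obtain ⟨A₁, hA₁⟩ := exists_isSource_mul hKc hKM hβL.continuous
      (fun x hx => by rw [hβΩ x fun h => hx (subset_closure h), Complex.ofReal_zero])
      husL.continuous.continuousOn
    obtain ⟨A₂, hA₂⟩ := exists_isSource_mul hKc hKM hqc hqK hDl.continuous.continuousOn
    obtain ⟨A₃, hA₃⟩ := exists_isSource_mul hKc hKM hσc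
      (fun x hx => hσΩ x fun h => hx (subset_closure h)) husL.continuous.continuousOn
    have e : (fun y => ((βs y : ℂ) + σ y) * (us y + D y)) = fun y => (βs y : ℂ) * us y +
        (((βs y : ℂ) + σ y) * D y + σ y * us y) := by
      funext y
      ring
    rw [e, conv_helm_add hA₁ (hA₂.add hA₃), husc x, hD x, conv_const_mul]
    ring
  refine ⟨fun x => us x + D x, ⟨fun x => ?_, ⟨hcu.continuousOn, ?_, ?_⟩, ?_⟩, ?_⟩
  · rw [hconv]
    exact hLS x
  · exact contDiffOn_univ.2 (hus2.add hD2)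
  · intro n hn γ
    have hl : (List.ofFn γ).length ≤ 2 := by rwa [List.length_ofFn]
    obtain ⟨⟨B, hB⟩, ⟨H, hH⟩⟩ := hus.2.2 n hn γ
    rw [pderList_add_of_contDiff_two hus2 hD2 hl]
    refine ⟨bddAbove_supSet (B := B + Z * θ) fun x _ => (norm_add_le _ _).trans
      (add_le_add (hB ⟨x, mem_univ x, rfl⟩) ((hDb _ hl).1 x)),
      ⟨max H 0 + Z * θ, le_of_mem_holderSet fun x hx y hy => ?_⟩⟩
    rw [add_sub_add_comm, add_mul]
    exact (norm_add_le _ _).trans (add_le_add (norm_sub_le_of_holderSet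
      (fun r hr => (hH hr).trans (le_max_left _ _)) x hx y hy (le_max_right _ _))
      ((hDb _ hl).2 x y))
  · have e : (fun x => us x + D x - us x) = D := by
      funext x
      ring
    rw [e, mul_assoc]
    exact cNorm_two_le (by positivity) hDb
  · intro u' hu' hu'LS x hx
    have hu'c : ContinuousOn u' (closure Ω) := by
      have := hu'.1
      rwa [closure_closure] at this
    obtain ⟨A₁, hA₁⟩ := exists_isSource_mul hKc hKM hqc hqK hu'c
    obtain ⟨A₂, hA₂⟩ := exists_isSource_mul hKc hKM hqc hqK hcu.continuousOn
    refine sub_eq_zero.1 (huniq (fun x => u' x - (us x + D x)) (hu'c.sub hcu.continuousOn)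
      (fun z hz => ?_) x hx)
    have h1 := hu'LS z hz
    rw [hconv] at h1
    rw [conv_const_mul]
    simp_rw [mul_sub]
    rw [conv_helm_sub_source hA₁ hA₂, h1, hLS z]
    ring

end
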